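/- Let H ∈ (0, 1/2) and T > 0. Then liminf_{u→∞} P(M_H(T) > u) / (u^{2/H − 2} Ψ(u)) ≥ (T/H) · (1/2)^{1/H} · 𝓗_{2H}². -/

import Mathlib

open MeasureTheory ProbabilityTheory Real Filter Set

/-- Tail `Ψ(u) = P(N > u)` of a standard normal random variable. -/
noncomputable def stdNormalTail (u : ℝ) : ℝ :=
  ((ProbabilityTheory.gaussianReal 0 1) (Set.Ioi u)).toReal

/-- `X` is a finite centered Gaussian family with covariance matrix `K`, expressed through its
characteristic function. -/
structure CenteredGaussian {Ω ι : Type*} [MeasurableSpace Ω] [Fintype ι] (μ : Measure Ω)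
    (X : ι → Ω → ℝ) (K : ι → ι → ℝ) : Prop where
  meas : ∀ i, Measurable (X i)
  char : ∀ c : ι → ℝ, ∫ ω, Complex.exp ((∑ i, c i * X i ω : ℝ) * Complex.I) ∂μ =
    ((rexp (-(∑ i, ∑ j, c i * c j * K i j) / 2) : ℝ) : ℂ)

namespace CenteredGaussian

variable {Ω Ω' ι κ : Type*} [MeasurableSpace Ω] [MeasurableSpace Ω'] [Fintype ι] [Fintype κ]
  {μ : Measure Ω} {ν : Measure Ω'} {X : ι → Ω → ℝ} {K : ι → ι → ℝ}

lemma measurable_pi (h : CenteredGaussian μ X K) : Measurable fun ω i => X i ω :=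
  measurable_pi_lambda _ h.meas

lemma measurable_toLp (h : CenteredGaussian μ X K) :
    Measurable fun ω => WithLp.toLp 2 (fun i => X i ω) :=
  (WithLp.measurable_toLp 2 _).comp h.measurable_pi

lemma charFun_map (h : CenteredGaussian μ X K) (t : EuclideanSpace ℝ ι) :
    charFun (μ.map fun ω => WithLp.toLp 2 (fun i => X i ω)) t =
      ((rexp (-(∑ i, ∑ j, t i * t j * K i j) / 2) : ℝ) : ℂ) := by
  rw [charFun_apply, integral_map h.measurable_toLp.aemeasurable]
  · rw [← h.char t]
    congr 1 with ω
  · exact (by fun_prop : Continuous fun x : EuclideanSpace ℝ ι =>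
      Complex.exp ((inner ℝ x t : ℝ) * Complex.I)).aestronglyMeasurable

lemma map_eq [IsFiniteMeasure μ] [IsFiniteMeasure ν] {Y : ι → Ω' → ℝ}
    (h : CenteredGaussian μ X K) (h' : CenteredGaussian ν Y K) :
    μ.map (fun ω i => X i ω) = ν.map (fun ω i => Y i ω) := by
  have key : μ.map (fun ω => WithLp.toLp 2 (fun i => X i ω)) =
      ν.map (fun ω => WithLp.toLp 2 (fun i => Y i ω)) := by
    apply Measure.ext_of_charFun
    ext t
    rw [h.charFun_map, h'.charFun_map]
  have := congrArg (fun m => m.map (WithLp.ofLp)) key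
  rwa [Measure.map_map (WithLp.measurable_ofLp 2 _) h.measurable_toLp,
    Measure.map_map (WithLp.measurable_ofLp 2 _) h'.measurable_toLp] at this

lemma lintegral_eq [IsFiniteMeasure μ] [IsFiniteMeasure ν] {Y : ι → Ω' → ℝ}
    (h : CenteredGaussian μ X K) (h' : CenteredGaussian ν Y K)
    {g : (ι → ℝ) → ENNReal} (hg : Measurable g) :
    ∫⁻ ω, g (fun i => X i ω) ∂μ = ∫⁻ ω, g (fun i => Y i ω) ∂ν := by
  rw [← lintegral_map hg h.measurable_pi, ← lintegral_map hg h'.measurable_pi, h.map_eq h']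

lemma congr_cov {K' : ι → ι → ℝ} (h : CenteredGaussian μ X K) (hK : ∀ i j, K i j = K' i j) :
    CenteredGaussian μ X K' := by
  have : K = K' := by ext i j; exact hK i j
  exact this ▸ h

lemma linear (h : CenteredGaussian μ X K) (A : κ → ι → ℝ) :
    CenteredGaussian μ (fun k ω => ∑ i, A k i * X i ω)
      (fun k l => ∑ i, ∑ j, A k i * A l j * K i j) where
  meas k := Finset.measurable_sum _ fun i _ => (h.meas i).const_mul _
  char c := by
    have h1 := h.char (fun i => ∑ k, c k * A k i)
    have e1 : ∀ ω, ∑ k, c k * ∑ i, A k i * X i ω = ∑ i, (∑ k, c k * A k i) * X i ω := by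
      intro ω
      simp_rw [Finset.mul_sum, Finset.sum_mul]
      rw [Finset.sum_comm]
      simp_rw [mul_assoc]
    have e2 : ∑ k, ∑ l, c k * c l * ∑ i, ∑ j, A k i * A l j * K i j =
        ∑ i, ∑ j, (∑ k, c k * A k i) * (∑ k, c k * A k j) * K i j := by
      simp_rw [Finset.sum_mul_sum, Finset.sum_mul, Finset.mul_sum]
      calc _ = ∑ k, ∑ i, ∑ l, ∑ j, c k * c l * (A k i * A l j * K i j) := by
            refine Finset.sum_congr rfl fun k _ => ?_
            rw [Finset.sum_comm]
        _ = ∑ i, ∑ k, ∑ j, ∑ l, c k * c l * (A k i * A l j * K i j) := by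
            rw [Finset.sum_comm]
            refine Finset.sum_congr rfl fun k _ => Finset.sum_congr rfl fun i _ => ?_
            rw [Finset.sum_comm]
        _ = _ := by
            refine Finset.sum_congr rfl fun k _ => ?_
            rw [Finset.sum_comm]
            refine Finset.sum_congr rfl fun k _ => Finset.sum_congr rfl fun i _ =>
              Finset.sum_congr rfl fun i _ => by ring
    simp_rw [e1, e2]
    exact h1

lemma reindex (h : CenteredGaussian μ X K) (f : κ → ι) :
    CenteredGaussian μ (fun k => X (f k)) (fun k l => K (f k) (f l)) := by
  classical
  have := h.linear (fun k i => if f k = i then 1 else 0)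
  simpa [ite_mul, Finset.sum_ite_eq] using this

lemma prod_add [SFinite μ] [SFinite ν] {Y : ι → Ω' → ℝ} {L : ι → ι → ℝ}
    (h : CenteredGaussian μ X K) (h' : CenteredGaussian ν Y L) :
    CenteredGaussian (μ.prod ν) (fun i p => X i p.1 + Y i p.2)
      (fun i j => K i j + L i j) where
  meas i := ((h.meas i).comp measurable_fst).add ((h'.meas i).comp measurable_snd)
  char c := by
    have e : ∀ p : Ω × Ω', Complex.exp ((∑ i, c i * (X i p.1 + Y i p.2) : ℝ) * Complex.I) =
        Complex.exp ((∑ i, c i * X i p.1 : ℝ) * Complex.I) *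
          Complex.exp ((∑ i, c i * Y i p.2 : ℝ) * Complex.I) := by
      intro p
      rw [← Complex.exp_add, ← add_mul, ← Complex.ofReal_add, ← Finset.sum_add_distrib]
      simp_rw [mul_add]
    simp_rw [e]
    rw [integral_prod_mul (μ := μ) (ν := ν)
      (fun ω => Complex.exp ((∑ i, c i * X i ω : ℝ) * Complex.I))
      (fun ω => Complex.exp ((∑ i, c i * Y i ω : ℝ) * Complex.I)), h.char, h'.char,
      ← Complex.ofReal_mul, ← Real.exp_add]
    simp_rw [mul_add, Finset.sum_add_distrib]
    congr 2
    ring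

lemma gaussianReal_const_mul (v : NNReal) (c : ι → ℝ) :
    CenteredGaussian (gaussianReal 0 v) (fun i x => c i * x) (fun i j => c i * c j * v) where
  meas i := measurable_id.const_mul _
  char d := by
    have h := charFun_gaussianReal (μ := 0) (v := v) (∑ i, d i * c i)
    rw [charFun_apply_real] at h
    have e1 : ∀ x : ℝ, ((∑ i, d i * (c i * x) : ℝ) : ℂ) * Complex.I =
        ((∑ i, d i * c i : ℝ) : ℂ) * x * Complex.I := by
      intro x
      rw [← Complex.ofReal_mul, Finset.sum_mul]
      simp_rw [mul_assoc]
    have e2 : ∑ i, ∑ j, d i * d j * (c i * c j * v) = v * (∑ i, d i * c i) ^ 2 := by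
      rw [pow_two, Finset.sum_mul_sum, Finset.mul_sum]
      refine Finset.sum_congr rfl fun i _ => ?_
      rw [Finset.mul_sum]
      exact Finset.sum_congr rfl fun j _ => by ring
    simp_rw [e1, h, e2]
    rw [Complex.ofReal_exp]
    congr 1
    push_cast
    ring

/-- Regression of a Gaussian family on one of its members. -/
lemma lintegral_eq_regression [IsProbabilityMeasure μ] (h : CenteredGaussian μ X K) {o : ι}
    {v : NNReal} (hv : K o o = v) (hsymm : ∀ i, K i o = K o i) {c : ι → ℝ}
    (hc : ∀ i, c i * v = K i o) {g : (ι → ℝ) → ENNReal} (hg : Measurable g) :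
    ∫⁻ ω, g (fun i => X i ω) ∂μ =
      ∫⁻ ω, ∫⁻ x, g (fun i => c i * x + (X i ω - c i * X o ω)) ∂(gaussianReal 0 v) ∂μ := by
  classical
  have h2 := h.linear (fun i j => (if i = j then 1 else 0) - c i * (if o = j then 1 else 0))
  have h3 := (gaussianReal_const_mul v c).prod_add h2
  have h4 : CenteredGaussian (Measure.prod (gaussianReal 0 v) μ)
      (fun i p => c i * p.1 + (X i p.2 - c i * X o p.2)) K := by
    convert h3 using 3 with i p i j
    · simp [sub_mul, Finset.sum_sub_distrib]
    · simp only [sub_mul, mul_sub, Finset.sum_sub_distrib]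
      simp [mul_assoc]
      rw [← hsymm j, hv, ← hc i, ← hc j]
      ring
  rw [h.lintegral_eq h4 hg, lintegral_prod_symm]
  exact (hg.comp h4.measurable_pi).aemeasurable

lemma lintegral_exp_mul_gaussianReal (v : NNReal) {g : ℝ → ENNReal} (hg : Measurable g) :
    ∫⁻ x, ENNReal.ofReal (rexp x) * g x ∂(gaussianReal 0 v) =
      ENNReal.ofReal (rexp (v / 2)) * ∫⁻ x, g (x + v) ∂(gaussianReal 0 v) := by
  by_cases hv : v = 0
  · subst hv
    simp [gaussianReal_zero_var, lintegral_dirac]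
  have e : ∫⁻ x, g (x + v) ∂(gaussianReal 0 v) = ∫⁻ x, g x ∂(gaussianReal v v) := by
    have := gaussianReal_map_add_const (μ := 0) (v := v) (v : ℝ)
    rw [zero_add] at this
    rw [← this, lintegral_map hg (by fun_prop)]
  rw [e, gaussianReal_of_var_ne_zero _ hv, gaussianReal_of_var_ne_zero _ hv,
    lintegral_withDensity_eq_lintegral_mul _ (measurable_gaussianPDF _ _) (by fun_prop),
    lintegral_withDensity_eq_lintegral_mul _ (measurable_gaussianPDF _ _) (by fun_prop),
    ← lintegral_const_mul _ (by fun_prop)]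
  refine lintegral_congr fun x => ?_
  simp only [Pi.mul_apply, gaussianPDF]
  rw [← mul_assoc, ← mul_assoc, ← ENNReal.ofReal_mul (gaussianPDFReal_nonneg _ _ _),
    ← ENNReal.ofReal_mul (by positivity)]
  congr 2
  simp only [gaussianPDFReal]
  have hv' : (v : ℝ) ≠ 0 := by exact_mod_cast hv
  rw [mul_assoc, ← Real.exp_add, mul_left_comm, ← Real.exp_add]
  congr 2
  field_simp
  ring

/-- Cameron–Martin formula for a finite centered Gaussian family. -/
lemma lintegral_exp_mul [IsProbabilityMeasure μ] (h : CenteredGaussian μ X K) {o : ι}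
    {v : NNReal} (hv : K o o = v) (hsymm : ∀ i, K i o = K o i) {c : ι → ℝ}
    (hco : c o = 1) (hc : ∀ i, c i * v = K i o) {g : (ι → ℝ) → ENNReal} (hg : Measurable g) :
    ∫⁻ ω, ENNReal.ofReal (rexp (X o ω)) * g (fun i => X i ω) ∂μ =
      ENNReal.ofReal (rexp (v / 2)) * ∫⁻ ω, g (fun i => X i ω + K i o) ∂μ := by
  have h1 := h.lintegral_eq_regression hv hsymm hc
    (g := fun x => ENNReal.ofReal (rexp (x o)) * g x) (by fun_prop)
  have h2 := h.lintegral_eq_regression hv hsymm hc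
    (g := fun x => g (fun i => x i + K i o))
    (hg.comp (measurable_pi_lambda _ fun i => by fun_prop))
  have hm (ω : Ω) : Measurable fun x : ℝ => fun i => c i * x + (X i ω - c i * X o ω) :=
    measurable_pi_lambda _ fun i => by fun_prop
  rw [h1, h2, ← lintegral_const_mul']
  · refine lintegral_congr fun ω => ?_
    have := lintegral_exp_mul_gaussianReal v
      (g := fun x => g (fun i => c i * x + (X i ω - c i * X o ω))) (hg.comp (hm ω))
    simp only [hco, one_mul, sub_self, add_zero]
    rw [this]
    congr 1
    refine lintegral_congr fun x => ?_
    congr 1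
    ext i
    rw [← hc]
    ring
  · exact ENNReal.ofReal_ne_top

lemma map_add_const_apply (h : CenteredGaussian μ X K) (m : ι → ℝ) (t : EuclideanSpace ℝ ι) :
    charFun (μ.map fun ω => WithLp.toLp 2 (fun i => X i ω + m i)) t =
      ((rexp (-(∑ i, ∑ j, t i * t j * K i j) / 2) : ℝ) : ℂ) *
        Complex.exp ((inner ℝ (WithLp.toLp 2 m) t : ℝ) * Complex.I) := by
  have := charFun_map_add_const (μ := μ.map fun ω => WithLp.toLp 2 (fun i => X i ω))
    (WithLp.toLp 2 m) t
  rw [Measure.map_map (by fun_prop) h.measurable_toLp] at this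
  rw [← h.charFun_map, ← this]
  rfl

/-- Convergence of covariances and means gives lower semicontinuity of the probabilities that
some coordinate exceeds a level. -/
lemma le_liminf_measure {Ω : ℕ → Type*} [∀ n, MeasurableSpace (Ω n)]
    {P : ∀ n, Measure (Ω n)} [∀ n, IsProbabilityMeasure (P n)]
    {Xn : ∀ n, ι → Ω n → ℝ} {Kn : ℕ → ι → ι → ℝ} {mn : ℕ → ι → ℝ} {m : ι → ℝ}
    [IsProbabilityMeasure ν] {Y : ι → Ω' → ℝ}
    (hX : ∀ n, CenteredGaussian (P n) (Xn n) (Kn n)) (hY : CenteredGaussian ν Y K)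
    (hK : ∀ i j, Tendsto (fun n => Kn n i j) atTop (nhds (K i j)))
    (hm : ∀ i, Tendsto (fun n => mn n i) atTop (nhds (m i))) (w : ℝ) :
    ν {ω | ∃ i, w < Y i ω + m i} ≤
      liminf (fun n => P n {ω | ∃ i, w < Xn n i ω + mn n i}) atTop := by
  have hXm : ∀ n, Measurable fun ω => WithLp.toLp 2 (fun i => Xn n i ω + mn n i) := fun n =>
    (WithLp.measurable_toLp 2 _).comp (measurable_pi_lambda _ fun i =>
      ((hX n).meas i).add_const _)
  have hYm : Measurable fun ω => WithLp.toLp 2 (fun i => Y i ω + m i) :=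
    (WithLp.measurable_toLp 2 _).comp (measurable_pi_lambda _ fun i => (hY.meas i).add_const _)
  let Q : ℕ → ProbabilityMeasure (EuclideanSpace ℝ ι) := fun n =>
    ⟨(P n).map fun ω => WithLp.toLp 2 (fun i => Xn n i ω + mn n i),
      Measure.isProbabilityMeasure_map (hXm n).aemeasurable⟩
  let Q0 : ProbabilityMeasure (EuclideanSpace ℝ ι) :=
    ⟨ν.map fun ω => WithLp.toLp 2 (fun i => Y i ω + m i),
      Measure.isProbabilityMeasure_map hYm.aemeasurable⟩
  have hQ : Tendsto Q atTop (nhds Q0) := by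
    refine ProbabilityMeasure.tendsto_of_tendsto_charFun fun t => ?_
    simp only [Q, Q0, ProbabilityMeasure.coe_mk, (hX _).map_add_const_apply,
      hY.map_add_const_apply]
    refine Tendsto.mul ?_ ?_
    · refine (Complex.continuous_ofReal.comp Real.continuous_exp).continuousAt.tendsto.comp ?_
      refine Tendsto.div_const (Tendsto.neg ?_) _
      exact tendsto_finsetSum _ fun i _ => tendsto_finsetSum _ fun j _ => (hK i j).const_mul _
    · refine Complex.continuous_exp.continuousAt.tendsto.comp (Tendsto.mul_const _ ?_)
      refine Complex.continuous_ofReal.continuousAt.tendsto.comp ?_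
      simp only [PiLp.inner_apply]
      exact tendsto_finsetSum _ fun i _ => by simpa using (hm i).const_mul _
  have hopen : IsOpen {x : EuclideanSpace ℝ ι | ∃ i, w < x i} := by
    simp only [ofPred_exists]
    exact isOpen_iUnion fun i => isOpen_lt continuous_const (by fun_prop)
  have := ProbabilityMeasure.le_liminf_measure_open_of_tendsto hQ hopen
  simp only [Q, Q0, ProbabilityMeasure.coe_mk] at this
  rw [Measure.map_apply hYm hopen.measurableSet] at this
  simp_rw [fun n => Measure.map_apply (hXm n) hopen.measurableSet] at this
  exact this

end CenteredGaussian

/-- Fractional Brownian motion with Hurst index `H < 1/2`, indexed by the nonnegative reals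
(values at negative times are unconstrained up to joint Gaussianity and continuity). -/
structure IsRoughFBM {Ω : Type*} [MeasurableSpace Ω] (μ : Measure Ω) (H : ℝ)
    (B : ℝ → Ω → ℝ) : Prop where
  pos : 0 < H
  lt_half : H < 1 / 2
  meas : ∀ t : ℝ, Measurable (B t)
  zero : ∀ ω, B 0 ω = 0
  cont : ∀ᵐ ω ∂μ, Continuous fun t => B t ω
  gauss : ∀ (n : ℕ) (c : Fin n → ℝ) (t : Fin n → ℝ),
      ∃ v : NNReal, μ.map (fun ω => ∑ i, c i * B (t i) ω) = gaussianReal 0 v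
  cov : ∀ t s : ℝ, 0 ≤ t → 0 ≤ s →
      ∫ ω, B t ω * B s ω ∂μ = (t ^ (2*H) + s ^ (2*H) - |t - s| ^ (2*H)) / 2

/-- Covariance of the scaled increments `θ i * (B (y i) - B (x i))`. -/
noncomputable def incrementCov {ι : Type*} (H : ℝ) (θ x y : ι → ℝ) (i j : ι) : ℝ :=
  θ i * θ j * (|y i - x j| ^ (2*H) + |x i - y j| ^ (2*H) - |y i - y j| ^ (2*H)
    - |x i - x j| ^ (2*H)) / 2

namespace IsRoughFBM

variable {Ω ι : Type*} [MeasurableSpace Ω] [Fintype ι] {μ : Measure Ω} [IsProbabilityMeasure μ]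
  {H : ℝ} {B : ℝ → Ω → ℝ}

omit [IsProbabilityMeasure μ] in
lemma memLp_two (h : IsRoughFBM μ H B) (t : ℝ) : MemLp (B t) 2 μ := by
  obtain ⟨v, hv⟩ := h.gauss 1 (fun _ => 1) (fun _ => t)
  simp only [Finset.univ_unique, Fin.default_eq_zero, Finset.sum_singleton, one_mul] at hv
  have := memLp_id_gaussianReal (μ := 0) (v := v) 2
  rw [← hv] at this
  exact (memLp_map_measure_iff (by fun_prop) (h.meas t).aemeasurable).1 this

omit [IsProbabilityMeasure μ] in
lemma centeredGaussian (h : IsRoughFBM μ H B) {t : ι → ℝ} (ht : ∀ i, 0 ≤ t i) :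
    CenteredGaussian μ (fun i => B (t i))
      (fun i j => (t i ^ (2*H) + t j ^ (2*H) - |t i - t j| ^ (2*H)) / 2) where
  meas i := h.meas _
  char c := by
    let e := (Fintype.equivFin ι).symm
    obtain ⟨v, hv⟩ := h.gauss _ (c ∘ e) (t ∘ e)
    have hs : ∀ ω, ∑ i, (c ∘ e) i * B ((t ∘ e) i) ω = ∑ i, c i * B (t i) ω := fun ω =>
      e.sum_comp (fun i => c i * B (t i) ω)
    simp_rw [hs] at hv
    have hmeas : Measurable fun ω => ∑ i, c i * B (t i) ω :=
      Finset.measurable_sum _ fun i _ => (h.meas _).const_mul _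
    have hvar : (v : ℝ) = ∑ i, ∑ j, c i * c j *
        ((t i ^ (2*H) + t j ^ (2*H) - |t i - t j| ^ (2*H)) / 2) := by
      have h1 : ∫ x, x ^ 2 ∂(gaussianReal 0 v) = v := by
        have := variance_fun_id_gaussianReal (μ := 0) (v := v)
        rw [variance_eq_integral (by fun_prop)] at this
        simpa using this
      rw [← h1, ← hv, integral_map hmeas.aemeasurable (by fun_prop)]
      simp_rw [pow_two, Finset.sum_mul_sum]
      have hmul : ∀ i j, Integrable (fun ω => c i * B (t i) ω * (c j * B (t j) ω)) μ := by
        intro i j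
        have := ((h.memLp_two (t i)).integrable_mul (h.memLp_two (t j))).const_mul (c i * c j)
        refine this.congr (Eventually.of_forall fun ω => ?_)
        simp only [Pi.mul_apply]
        ring
      rw [integral_finsetSum _ fun i _ => integrable_finsetSum _ fun j _ => hmul i j]
      refine Finset.sum_congr rfl fun i _ => ?_
      rw [integral_finsetSum _ fun j _ => hmul i j]
      refine Finset.sum_congr rfl fun j _ => ?_
      rw [← h.cov _ _ (ht i) (ht j), ← integral_const_mul]
      congr 1 with ω
      ring
    have h2 := charFun_gaussianReal (μ := 0) (v := v) 1
    rw [charFun_apply_real, ← hv, integral_map hmeas.aemeasurable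
      (by fun_prop)] at h2
    rw [← hvar, Complex.ofReal_exp]
    simp only [Complex.ofReal_one, one_mul, mul_zero, zero_mul, Complex.ofReal_zero, one_pow,
      mul_one, zero_sub] at h2
    rw [h2]
    congr 1
    push_cast
    ring

omit [IsProbabilityMeasure μ] in
lemma increments (h : IsRoughFBM μ H B) (θ : ι → ℝ) {x y : ι → ℝ} (hx : ∀ i, 0 ≤ x i)
    (hy : ∀ i, 0 ≤ y i) :
    CenteredGaussian μ (fun i ω => θ i * (B (y i) ω - B (x i) ω)) (incrementCov H θ x y) := by
  classical
  have h1 := (h.centeredGaussian (t := Sum.elim y x) (by rintro (i | i) <;> simp [hx, hy])).linear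
    (κ := ι) (fun i => Sum.elim (fun j => if i = j then θ i else 0)
      (fun j => if i = j then - θ i else 0))
  convert h1 using 3 with i ω i j
  · simp
    ring
  · simp [incrementCov, Finset.sum_add_distrib]
    ring

/-- Cameron–Martin formula for the increments of a fractional Brownian motion. -/
lemma lintegral_exp_increment_mul (h : IsRoughFBM μ H B) {θ₀ x₀ y₀ : ℝ} (hx₀ : 0 ≤ x₀)
    (hy₀ : 0 ≤ y₀) (θ : ι → ℝ) {x y : ι → ℝ} (hx : ∀ i, 0 ≤ x i) (hy : ∀ i, 0 ≤ y i)
    {g : (ι → ℝ) → ENNReal} (hg : Measurable g) :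
    ∫⁻ ω, ENNReal.ofReal (rexp (θ₀ * (B y₀ ω - B x₀ ω))) *
        g (fun i => θ i * (B (y i) ω - B (x i) ω)) ∂μ =
      ENNReal.ofReal (rexp (θ₀ ^ 2 * |y₀ - x₀| ^ (2*H) / 2)) *
        ∫⁻ ω, g (fun i => θ i * (B (y i) ω - B (x i) ω) +
          θ i * θ₀ * (|y i - x₀| ^ (2*H) + |x i - y₀| ^ (2*H) - |y i - y₀| ^ (2*H)
            - |x i - x₀| ^ (2*H)) / 2) ∂μ := by
  have hH : (2 * H) ≠ 0 := by linarith [h.pos]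
  by_cases h0 : θ₀ = 0 ∨ y₀ = x₀
  · rcases h0 with h0 | h0 <;> subst h0 <;> simp [zero_rpow hH]
  push Not at h0
  have hpos : 0 < θ₀ ^ 2 * |y₀ - x₀| ^ (2*H) :=
    mul_pos (by positivity [h0.1]) (rpow_pos_of_pos (abs_pos.2 (sub_ne_zero.2 h0.2)) _)
  obtain ⟨v, hve⟩ : ∃ v : NNReal, (v : ℝ) = θ₀ ^ 2 * |y₀ - x₀| ^ (2*H) := ⟨⟨_, hpos.le⟩, rfl⟩
  rw [← hve] at hpos
  have hcg := h.increments (ι := Option ι) (fun o => o.elim θ₀ θ) (x := fun o => o.elim x₀ x)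
    (y := fun o => o.elim y₀ y) (by rintro (_ | i) <;> simp [hx₀, hx])
    (by rintro (_ | i) <;> simp [hy₀, hy])
  have hv : incrementCov H (fun o : Option ι => o.elim θ₀ θ) (fun o => o.elim x₀ x)
      (fun o => o.elim y₀ y) none none = v := by
    simp [incrementCov, hve, zero_rpow hH, abs_sub_comm x₀ y₀]
    ring
  have key := hcg.lintegral_exp_mul hv (fun i => ?_)
    (c := fun o => incrementCov H (fun o : Option ι => o.elim θ₀ θ) (fun o => o.elim x₀ x)
      (fun o => o.elim y₀ y) o none / v) ?_ (fun i => ?_)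
    (g := fun z => g (fun i => z (some i)))
    (hg.comp (measurable_pi_lambda _ fun i => measurable_pi_apply _))
  · rw [← hve]
    simpa [incrementCov] using key
  · simp only [incrementCov]
    rw [abs_sub_comm (Option.elim none x₀ x), abs_sub_comm (Option.elim none y₀ y),
      abs_sub_comm (Option.elim none y₀ y), abs_sub_comm (Option.elim none x₀ x)]
    ring
  · rw [hv]
    exact div_self hpos.ne'
  · exact div_mul_cancel₀ _ hpos.ne'

omit [IsProbabilityMeasure μ] in
lemma two_H_pos (h : IsRoughFBM μ H B) : 0 < 2 * H := by linarith [h.pos]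

end IsRoughFBM

namespace IsRoughFBM

variable {Ω ι : Type*} [MeasurableSpace Ω] [Fintype ι] {μ : Measure Ω} [IsProbabilityMeasure μ]
  {H : ℝ} {B : ℝ → Ω → ℝ}

/-- The exponential `exp (√2 B_t - t^{2H})` entering the Pickands constant. -/
noncomputable def pickandsExp (H : ℝ) (B : ℝ → Ω → ℝ) (t : ℝ) (ω : Ω) : ENNReal :=
  ENNReal.ofReal (rexp (√2 * B t ω - t ^ (2*H)))

/-- Maximum of `pickandsExp` over the dyadic points of level `n` in `[a, a + k]`. -/
noncomputable def gridSup (H : ℝ) (B : ℝ → Ω → ℝ) (a : ℝ) (n k : ℕ) (ω : Ω) : ENNReal :=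
  ⨆ j : Fin (k * 2 ^ n + 1), pickandsExp H B (a + j / 2 ^ n) ω

/-- The expectation of `gridSup` started at the origin. -/
noncomputable def gridConst (μ : Measure Ω) (H : ℝ) (B : ℝ → Ω → ℝ) (n k : ℕ) : ENNReal :=
  ∫⁻ ω, gridSup H B 0 n k ω ∂μ

/-- The Pickands functional of the interval `[0, k]`. -/
noncomputable def contConst (μ : Measure Ω) (H : ℝ) (B : ℝ → Ω → ℝ) (k : ℝ) : ENNReal :=
  ∫⁻ ω, ⨆ t ∈ Icc 0 k, pickandsExp H B t ω ∂μ

omit [IsProbabilityMeasure μ] in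
lemma measurable_pickandsExp (h : IsRoughFBM μ H B) (t : ℝ) :
    Measurable (pickandsExp H B t) := by
  have := h.meas t
  unfold pickandsExp
  fun_prop

omit [IsProbabilityMeasure μ] in
lemma measurable_gridSup (h : IsRoughFBM μ H B) (a : ℝ) (n k : ℕ) :
    Measurable (gridSup H B a n k) :=
  Measurable.iSup fun _ => h.measurable_pickandsExp _

lemma lintegral_iSup_pickandsExp_shift (h : IsRoughFBM μ H B) {a : ℝ} (ha : 0 ≤ a) {s : ι → ℝ}
    (hs : ∀ i, 0 ≤ s i) :
    ∫⁻ ω, ⨆ i, pickandsExp H B (a + s i) ω ∂μ = ∫⁻ ω, ⨆ i, pickandsExp H B (s i) ω ∂μ := by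
  have hH : (2 * H) ≠ 0 := by linarith [h.pos]
  have h2 : √2 ^ 2 = 2 := Real.sq_sqrt (by norm_num)
  have h2' : √2 * √2 = 2 := Real.mul_self_sqrt (by norm_num)
  have hg (m : ι → ℝ) : Measurable fun z : ι → ℝ => ⨆ i, ENNReal.ofReal (rexp (z i - m i)) := by
    refine Measurable.iSup fun i => ?_
    fun_prop
  have key := h.lintegral_exp_increment_mul (θ₀ := √2) (x₀ := 0) (y₀ := a) le_rfl ha
    (fun _ : ι => √2) (x := fun _ => a) (y := fun i => a + s i) (fun _ => ha)
    (fun i => add_nonneg ha (hs i)) (hg (fun i => (a + s i) ^ (2*H)))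
  calc _ = ∫⁻ ω, ENNReal.ofReal (rexp (√2 * (B a ω - B 0 ω))) *
        ⨆ i, ENNReal.ofReal (rexp (√2 * (B (a + s i) ω - B a ω) - (a + s i) ^ (2*H))) ∂μ := by
        refine lintegral_congr fun ω => ?_
        rw [ENNReal.mul_iSup]
        refine iSup_congr fun i => ?_
        rw [← ENNReal.ofReal_mul (by positivity), ← Real.exp_add, h.zero, pickandsExp]
        congr 2
        ring
    _ = _ := key
    _ = ∫⁻ ω, ⨆ i, ENNReal.ofReal (rexp (√2 * (B (a + s i) ω - B a ω) - s i ^ (2*H))) ∂μ := by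
        rw [← lintegral_const_mul' _ _ ENNReal.ofReal_ne_top]
        refine lintegral_congr fun ω => ?_
        rw [ENNReal.mul_iSup]
        refine iSup_congr fun i => ?_
        rw [← ENNReal.ofReal_mul (by positivity), ← Real.exp_add]
        congr 2
        simp only [sub_zero, abs_of_nonneg ha, abs_of_nonneg (add_nonneg ha (hs i)), h2, h2',
          add_sub_cancel_left, abs_of_nonneg (hs i), sub_self, abs_zero, zero_rpow hH]
        ring
    _ = ∫⁻ ω, ⨆ i, ENNReal.ofReal (rexp (√2 * (B (s i) ω - B 0 ω) - s i ^ (2*H))) ∂μ := by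
        have e1 := h.increments (fun _ : ι => √2) (x := fun _ => a) (y := fun i => a + s i)
          (fun _ => ha) (fun i => add_nonneg ha (hs i))
        have e2 := h.increments (fun _ : ι => √2) (x := fun _ => 0) (y := fun i => s i)
          (fun _ => le_rfl) hs
        refine e1.lintegral_eq (e2.congr_cov fun i j => ?_) (hg (fun i => s i ^ (2*H)))
        simp [incrementCov]
    _ = _ := by
        simp_rw [h.zero, sub_zero]
        rfl

lemma lintegral_gridSup (h : IsRoughFBM μ H B) {a : ℝ} (ha : 0 ≤ a) (n k : ℕ) :
    ∫⁻ ω, gridSup H B a n k ω ∂μ = gridConst μ H B n k := by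
  have := h.lintegral_iSup_pickandsExp_shift ha (s := fun j : Fin (k * 2 ^ n + 1) => j / 2 ^ n)
    (fun i => by positivity)
  simp only [gridConst, gridSup, zero_add, this]

omit [MeasurableSpace Ω] in
lemma gridSup_mono_level {a : ℝ} {n n' : ℕ} (hn : n ≤ n') (k : ℕ) (ω : Ω) :
    gridSup H B a n k ω ≤ gridSup H B a n' k ω := by
  refine iSup_le fun j => ?_
  have hj : (j : ℕ) * 2 ^ (n' - n) < k * 2 ^ n' + 1 := by
    have h1 := Nat.lt_succ_iff.1 j.2
    have h2 := Nat.mul_le_mul_right (2 ^ (n' - n)) h1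
    rw [mul_assoc, ← pow_add, Nat.add_sub_cancel' hn] at h2
    omega
  refine le_trans (le_of_eq ?_) (le_iSup _ (⟨_, hj⟩ : Fin (k * 2 ^ n' + 1)))
  congr 2
  push_cast
  rw [show (2 : ℝ) ^ n' = 2 ^ n * 2 ^ (n' - n) by rw [← pow_add, Nat.add_sub_cancel' hn]]
  field_simp

omit [MeasurableSpace Ω] in
lemma gridSup_cell_le {n k i : ℕ} (hi : i < k) (ω : Ω) :
    gridSup H B i n 1 ω ≤ gridSup H B 0 n k ω := by
  refine iSup_le fun j => ?_
  have hj : i * 2 ^ n + (j : ℕ) < k * 2 ^ n + 1 := by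
    have h1 := Nat.lt_succ_iff.1 j.2
    have h2 := Nat.mul_le_mul_right (2 ^ n) hi
    rw [Nat.succ_mul] at h2
    omega
  refine le_trans (le_of_eq ?_) (le_iSup _ (⟨_, hj⟩ : Fin (k * 2 ^ n + 1)))
  congr 1
  push_cast
  field_simp
  ring

omit [MeasurableSpace Ω] in
lemma exists_gridSup_le_cell {n k : ℕ} (hk : 0 < k) (ω : Ω) :
    ∃ i < k, gridSup H B 0 n k ω ≤ gridSup H B i n 1 ω := by
  obtain ⟨j, hj⟩ := exists_eq_ciSup_of_finite
    (f := fun j : Fin (k * 2 ^ n + 1) => pickandsExp H B (0 + j / 2 ^ n) ω)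
  rw [gridSup, ← hj]
  have hp : 0 < 2 ^ n := by positivity
  have hjk := Nat.lt_succ_iff.1 j.2
  obtain ⟨i, hi, r, hr, he⟩ : ∃ i < k, ∃ r ≤ 2 ^ n, (j : ℕ) = i * 2 ^ n + r := by
    rcases eq_or_lt_of_le hjk with he | hlt
    · refine ⟨k - 1, by omega, 2 ^ n, le_rfl, ?_⟩
      rw [he, ← Nat.succ_mul]
      congr 1
      omega
    · refine ⟨j / 2 ^ n, (Nat.div_lt_iff_lt_mul hp).2 hlt, j % 2 ^ n,
        (Nat.mod_lt _ hp).le, (Nat.div_add_mod' _ _).symm⟩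
  refine ⟨i, hi, le_trans (le_of_eq ?_)
    (le_iSup _ (⟨r, by omega⟩ : Fin (1 * 2 ^ n + 1)))⟩
  congr 1
  rw [he]
  push_cast
  field_simp
  ring

omit [MeasurableSpace Ω] in
lemma gridSup_add_sum_le {n n' k : ℕ} (hn : n ≤ n') (hk : 0 < k) (ω : Ω) :
    gridSup H B 0 n' k ω + ∑ i ∈ Finset.range k, gridSup H B i n 1 ω ≤
      gridSup H B 0 n k ω + ∑ i ∈ Finset.range k, gridSup H B i n' 1 ω := by
  obtain ⟨i, hi, hle⟩ := exists_gridSup_le_cell (H := H) (B := B) (n := n') hk ω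
  rw [← Finset.add_sum_erase _ _ (Finset.mem_range.2 hi),
    ← Finset.add_sum_erase (Finset.range k) (fun i : ℕ => gridSup H B i n' 1 ω)
      (Finset.mem_range.2 hi)]
  calc _ ≤ gridSup H B i n' 1 ω + (gridSup H B 0 n k ω +
        ∑ i ∈ (Finset.range k).erase i, gridSup H B i n' 1 ω) := by
        gcongr with j hj
        · exact gridSup_cell_le hi ω
        · exact gridSup_mono_level hn 1 ω
    _ = _ := by rw [add_left_comm]

lemma gridConst_add_le (h : IsRoughFBM μ H B) {n n' k : ℕ} (hn : n ≤ n') (hk : 0 < k) :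
    gridConst μ H B n' k + k * gridConst μ H B n 1 ≤
      gridConst μ H B n k + k * gridConst μ H B n' 1 := by
  have := lintegral_mono (μ := μ) fun ω => gridSup_add_sum_le (H := H) (B := B) hn hk ω
  rw [lintegral_add_left (h.measurable_gridSup _ _ _), lintegral_add_left
    (h.measurable_gridSup _ _ _), lintegral_finsetSum _ fun i _ => h.measurable_gridSup _ _ _,
    lintegral_finsetSum _ fun i _ => h.measurable_gridSup _ _ _] at this
  have e0 : ∀ n k, ∫⁻ a, gridSup H B 0 n k a ∂μ = gridConst μ H B n k := fun _ _ => rfl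
  simpa only [e0, h.lintegral_gridSup (Nat.cast_nonneg _), Finset.sum_const, Finset.card_range,
    nsmul_eq_mul] using this

omit [IsProbabilityMeasure μ] in
lemma continuous_exponent (h : IsRoughFBM μ H B) {ω : Ω} (hω : Continuous fun t => B t ω) :
    Continuous fun t => √2 * B t ω - t ^ (2*H) :=
  (continuous_const.mul hω).sub (continuous_id.rpow_const fun _ => Or.inr h.two_H_pos.le)

omit [IsProbabilityMeasure μ] in
lemma iSup_gridSup (h : IsRoughFBM μ H B) {ω : Ω} (hω : Continuous fun t => B t ω) (k : ℕ) :
    ⨆ n, gridSup H B 0 n k ω = ⨆ t ∈ Icc (0 : ℝ) k, pickandsExp H B t ω := by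
  apply le_antisymm
  · refine iSup_le fun n => iSup_le fun j => ?_
    refine le_iSup₂_of_le (0 + j / 2 ^ n : ℝ) ⟨by positivity, ?_⟩ le_rfl
    rw [zero_add, div_le_iff₀ (by positivity)]
    exact_mod_cast Nat.lt_succ_iff.1 j.2
  · refine iSup₂_le fun t ht => ?_
    have hcont : Continuous fun t => pickandsExp H B t ω :=
      ENNReal.continuous_ofReal.comp (Real.continuous_exp.comp (h.continuous_exponent hω))
    have h1 : Tendsto (fun n : ℕ => (⌊t * 2 ^ n⌋₊ : ℝ) / 2 ^ n) atTop (nhds t) :=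
      (tendsto_nat_floor_mul_div_atTop ht.1).comp
        (tendsto_pow_atTop_atTop_of_one_lt (by norm_num : (1 : ℝ) < 2))
    refine le_of_tendsto' ((hcont.tendsto t).comp h1) fun n => le_iSup_of_le n ?_
    have hj : ⌊t * 2 ^ n⌋₊ < k * 2 ^ n + 1 := by
      rw [Nat.lt_succ_iff]
      refine Nat.floor_le_of_le ?_
      push_cast
      gcongr
      exact ht.2
    refine le_trans (le_of_eq ?_) (le_iSup _ (⟨_, hj⟩ : Fin (k * 2 ^ n + 1)))
    simp

omit [IsProbabilityMeasure μ] in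
lemma iSup_gridConst (h : IsRoughFBM μ H B) (k : ℕ) :
    ⨆ n, gridConst μ H B n k = contConst μ H B k := by
  unfold gridConst contConst
  rw [← lintegral_iSup (fun n => h.measurable_gridSup _ _ _)
    (fun n n' hn ω => gridSup_mono_level hn k ω)]
  refine lintegral_congr_ae ?_
  filter_upwards [h.cont] with ω hω using h.iSup_gridSup hω k

lemma contConst_add_le (h : IsRoughFBM μ H B) (n : ℕ) {k : ℕ} (hk : 0 < k) :
    contConst μ H B k + k * gridConst μ H B n 1 ≤
      gridConst μ H B n k + k * contConst μ H B 1 := by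
  have h1 := h.iSup_gridConst k
  have h2 := h.iSup_gridConst 1
  rw [Nat.cast_one] at h2
  rw [← h1, ENNReal.iSup_add]
  refine iSup_le fun m => ?_
  calc _ ≤ gridConst μ H B (max m n) k + k * gridConst μ H B n 1 := by
        gcongr
        exact lintegral_mono fun ω => gridSup_mono_level (le_max_left _ _) k ω
    _ ≤ _ := h.gridConst_add_le (le_max_right _ _) hk
    _ ≤ _ := by
        gcongr
        rw [← h2]
        exact le_iSup (fun n => gridConst μ H B n 1) _

omit [IsProbabilityMeasure μ] in
lemma integral_exp_iSup (h : IsRoughFBM μ H B) (k : ℕ) :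
    ∫ ω, rexp (⨆ t : Icc (0:ℝ) k, (√2 * B (t:ℝ) ω - (t:ℝ) ^ (2*H))) ∂μ =
      (contConst μ H B k).toReal := by
  have e : ∀ᵐ ω ∂μ, ENNReal.ofReal (rexp (⨆ t : Icc (0:ℝ) k,
      (√2 * B (t:ℝ) ω - (t:ℝ) ^ (2*H)))) = ⨆ t ∈ Icc (0 : ℝ) k, pickandsExp H B t ω := by
    filter_upwards [h.cont] with ω hω
    have : Nonempty (Icc (0:ℝ) k) := ⟨⟨0, by simp⟩⟩
    have hmono : Monotone fun x : ℝ => ENNReal.ofReal (rexp x) := fun x y hxy =>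
      ENNReal.ofReal_le_ofReal (Real.exp_le_exp.2 hxy)
    have hc := h.continuous_exponent hω
    have hb : BddAbove (range fun t : Icc (0:ℝ) k => √2 * B (t:ℝ) ω - (t:ℝ) ^ (2*H)) := by
      have := (isCompact_Icc (a := (0:ℝ)) (b := k)).bddAbove_image hc.continuousOn
      rwa [image_eq_range] at this
    refine (hmono.map_ciSup_of_continuousAt (ENNReal.continuous_ofReal.comp
      Real.continuous_exp).continuousAt hb).trans ?_
    rw [iSup_subtype]
    rfl
  have hm : AEMeasurable (fun ω => ⨆ t ∈ Icc (0 : ℝ) k, pickandsExp H B t ω) μ := by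
    refine ⟨fun ω => ⨆ n, gridSup H B 0 n k ω, Measurable.iSup fun n =>
      h.measurable_gridSup _ _ _, ?_⟩
    filter_upwards [h.cont] with ω hω using (h.iSup_gridSup hω k).symm
  have e' : (fun ω => rexp (⨆ t : Icc (0:ℝ) k, (√2 * B (t:ℝ) ω - (t:ℝ) ^ (2*H)))) =ᵐ[μ]
      fun ω => (⨆ t ∈ Icc (0 : ℝ) k, pickandsExp H B t ω).toReal := by
    filter_upwards [e] with ω hω
    rw [← hω, ENNReal.toReal_ofReal (Real.exp_pos _).le]
  rw [integral_eq_lintegral_of_nonneg_ae (Eventually.of_forall fun ω => (Real.exp_pos _).le)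
    (hm.ennreal_toReal.congr e'.symm).aestronglyMeasurable, lintegral_congr_ae e]
  rfl

/-- The defining property of the Pickands constant `HH`, read off from the process `B`. -/
def HasPickandsConstant (μ : Measure Ω) (H : ℝ) (B : ℝ → Ω → ℝ) (HH : ℝ) : Prop :=
  Tendsto (fun lam : ℝ => lam⁻¹ * ∫ ω, Real.exp (⨆ t : Set.Icc (0:ℝ) lam,
          (Real.sqrt 2 * B (t:ℝ) ω - (t:ℝ) ^ (2*H))) ∂μ) atTop (nhds HH)

omit [IsProbabilityMeasure μ] in
lemma tendsto_contConst (h : IsRoughFBM μ H B) {HH : ℝ} (hP : HasPickandsConstant μ H B HH) :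
    Tendsto (fun k : ℕ => (k : ℝ)⁻¹ * (contConst μ H B k).toReal) atTop (nhds HH) := by
  have := hP.comp tendsto_natCast_atTop_atTop
  refine this.congr fun k => ?_
  simp only [Function.comp, h.integral_exp_iSup k]

omit [IsProbabilityMeasure μ] in
lemma contConst_ne_top (h : IsRoughFBM μ H B) {HH : ℝ} (hHH : 0 < HH)
    (hP : HasPickandsConstant μ H B HH) (x : ℝ) : contConst μ H B x ≠ ⊤ := by
  have h1 := (h.tendsto_contConst hP).eventually (lt_mem_nhds hHH)
  obtain ⟨m, hm, hkm⟩ := (h1.and (eventually_ge_atTop ⌈x⌉₊)).exists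
  have h2 : contConst μ H B m ≠ ⊤ := by
    intro h3
    simp [h3] at hm
  refine ne_top_of_le_ne_top h2 (lintegral_mono fun ω => ?_)
  exact biSup_mono fun t ht => ⟨ht.1, ht.2.trans ((Nat.le_ceil x).trans (by exact_mod_cast hkm))⟩

omit [IsProbabilityMeasure μ] in
lemma gridConst_ne_top (h : IsRoughFBM μ H B) {HH : ℝ} (hHH : 0 < HH)
    (hP : HasPickandsConstant μ H B HH) (n k : ℕ) : gridConst μ H B n k ≠ ⊤ :=
  ne_top_of_le_ne_top (h.contConst_ne_top hHH hP k)
    (h.iSup_gridConst k ▸ le_iSup (fun n => gridConst μ H B n k) n)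

/-- The discrete Pickands constants approximate the continuous one from below. -/
lemma exists_le_gridConst (h : IsRoughFBM μ H B) {HH : ℝ} (hHH : 0 < HH)
    (hP : HasPickandsConstant μ H B HH) {ε : ℝ} (hε : 0 < ε) :
    ∃ n, ∀ᶠ k : ℕ in atTop, (HH - ε) * k ≤ (gridConst μ H B n k).toReal := by
  have htop := h.contConst_ne_top hHH hP
  have h1 : Tendsto (fun n => (gridConst μ H B n 1).toReal) atTop
      (nhds (contConst μ H B 1).toReal) := by
    refine (ENNReal.tendsto_toReal (htop 1)).comp ?_
    have := h.iSup_gridConst 1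
    rw [Nat.cast_one] at this
    rw [← this]
    exact tendsto_atTop_iSup fun n n' hn => lintegral_mono fun ω => gridSup_mono_level hn 1 ω
  obtain ⟨n, hn⟩ := (h1.eventually (lt_mem_nhds
    (show (contConst μ H B 1).toReal - ε / 2 < (contConst μ H B 1).toReal by linarith))).exists
  refine ⟨n, ?_⟩
  filter_upwards [(h.tendsto_contConst hP).eventually (lt_mem_nhds
    (show HH - ε / 2 < HH by linarith)), eventually_gt_atTop 0] with k hk hk0
  have h2 := h.contConst_add_le n hk0
  have hkpos : (0 : ℝ) < k := by exact_mod_cast hk0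
  have h3 := ENNReal.toReal_mono (by
    simp [ENNReal.add_eq_top, ENNReal.mul_eq_top, h.gridConst_ne_top hHH hP, htop]) h2
  rw [ENNReal.toReal_add (htop _) (ENNReal.mul_ne_top (by simp) (h.gridConst_ne_top hHH hP _ _)),
    ENNReal.toReal_add (h.gridConst_ne_top hHH hP _ _) (ENNReal.mul_ne_top (by simp) (htop _)),
    ENNReal.toReal_mul, ENNReal.toReal_mul, ENNReal.toReal_natCast] at h3
  rw [inv_mul_eq_div, lt_div_iff₀ hkpos] at hk
  nlinarith

end IsRoughFBM

lemma lintegral_gaussianReal_sub_div {u : ℝ} (hu : 0 < u) {v : NNReal} (hv : v ≠ 0)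
    {f : ℝ → ENNReal} (hf : Measurable f) :
    ∫⁻ x, f x ∂(gaussianReal 0 v) =
      ∫⁻ w, ENNReal.ofReal ((u * √(2 * π * v))⁻¹ * rexp (-u ^ 2 / (2 * v)) *
        rexp (w / v - w ^ 2 / (2 * u ^ 2 * v))) * f (u - w / u) := by
  let s : NNReal := ⟨u ^ 2, sq_nonneg u⟩
  have hs : (s : ℝ) = u ^ 2 := rfl
  have hs0 : s ≠ 0 := fun h => (pow_pos hu 2).ne' (by rw [← hs, h, NNReal.coe_zero])
  have hsv : s * v ≠ 0 := mul_ne_zero hs0 hv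
  have hvpos : (0 : ℝ) < v := by positivity
  have e1 : gaussianReal 0 v = (gaussianReal (u ^ 2) (s * v)).map fun w => u - w / u := by
    have : (fun w : ℝ => u - w / u) = (fun x => u - x) ∘ fun w => w / u := rfl
    rw [this, ← Measure.map_map (by fun_prop) (by fun_prop), gaussianReal_map_div_const,
      gaussianReal_map_const_sub]
    congr 1
    · field_simp
      ring
    · ext
      push_cast
      rw [hs]
      field_simp
  rw [e1, lintegral_map hf (by fun_prop), gaussianReal_of_var_ne_zero _ hsv,
    lintegral_withDensity_eq_lintegral_mul _ (measurable_gaussianPDF _ _) (by fun_prop)]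
  refine lintegral_congr fun w => ?_
  simp only [Pi.mul_apply, gaussianPDF, gaussianPDFReal]
  congr 2
  push_cast
  rw [mul_assoc ((u * √(2 * π * v))⁻¹), ← Real.exp_add, hs]
  congr 2
  · rw [show 2 * π * (u ^ 2 * (v : ℝ)) = u ^ 2 * (2 * π * v) by ring, Real.sqrt_mul (sq_nonneg u),
      Real.sqrt_sq hu.le]
  · field_simp
    ring

lemma lintegral_exp_mul_measure_exists_lt {Ω ι : Type*} [MeasurableSpace Ω] [Finite ι]
    [Nonempty ι] {ν : Measure Ω} [SFinite ν] {Z : ι → Ω → ℝ} (hZ : ∀ i, Measurable (Z i)) :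
    ∫⁻ w, ENNReal.ofReal (rexp w) * ν {ω | ∃ i, w < Z i ω} =
      ∫⁻ ω, ⨆ i, ENNReal.ofReal (rexp (Z i ω)) ∂ν := by
  have hms : MeasurableSet {p : ℝ × Ω | ∃ i, p.1 < Z i p.2} := by
    simp only [ofPred_exists]
    exact MeasurableSet.iUnion fun i => measurableSet_lt measurable_fst
      ((hZ i).comp measurable_snd)
  have e1 (w : ℝ) : ENNReal.ofReal (rexp w) * ν {ω | ∃ i, w < Z i ω} =
      ∫⁻ ω, {p : ℝ × Ω | ∃ i, p.1 < Z i p.2}.indicator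
        (fun p => ENNReal.ofReal (rexp p.1)) (w, ω) ∂ν := by
    have : (fun ω => {p : ℝ × Ω | ∃ i, p.1 < Z i p.2}.indicator
        (fun p => ENNReal.ofReal (rexp p.1)) (w, ω)) =
        {ω | ∃ i, w < Z i ω}.indicator fun _ => ENNReal.ofReal (rexp w) := by
      ext ω
      simp [indicator]
    rw [this]
    exact (lintegral_indicator_const (hms.preimage measurable_prodMk_left) _).symm
  have hmeas : Measurable ({p : ℝ × Ω | ∃ i, p.1 < Z i p.2}.indicator
      (fun p => ENNReal.ofReal (rexp p.1))) := Measurable.indicator (by fun_prop) hms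
  simp_rw [e1]
  rw [lintegral_lintegral_swap (f := fun w ω => {p : ℝ × Ω | ∃ i, p.1 < Z i p.2}.indicator
      (fun p => ENNReal.ofReal (rexp p.1)) (w, ω)) hmeas.aemeasurable]
  refine lintegral_congr fun ω => ?_
  obtain ⟨j, hj⟩ := exists_eq_ciSup_of_finite (f := fun i => Z i ω)
  have hle (i) : Z i ω ≤ Z j ω := by
    rw [hj]
    exact le_ciSup (Set.finite_range fun i => Z i ω).bddAbove i
  have e2 : (fun w : ℝ => {p : ℝ × Ω | ∃ i, p.1 < Z i p.2}.indicator
        (fun p => ENNReal.ofReal (rexp p.1)) (w, ω)) =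
      (Iio (Z j ω)).indicator fun w => ENNReal.ofReal (rexp w) := by
    ext w
    have : (∃ i, w < Z i ω) ↔ w < Z j ω := ⟨fun ⟨i, hi⟩ => hi.trans_le (hle i), fun h => ⟨j, h⟩⟩
    simp [indicator, this]
  rw [e2, lintegral_indicator measurableSet_Iio, Measure.restrict_congr_set Iio_ae_eq_Iic,
    ← ofReal_integral_eq_lintegral_ofReal (integrableOn_exp_Iic _)
      (ae_of_all _ fun x => (Real.exp_pos x).le), integral_exp_Iic]
  exact le_antisymm (le_iSup (fun i => ENNReal.ofReal (rexp (Z i ω))) j)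
    (iSup_le fun i => ENNReal.ofReal_le_ofReal (Real.exp_le_exp.2 (hle i)))

namespace CenteredGaussian

variable {Ω Ω' ι : Type*} [MeasurableSpace Ω] [MeasurableSpace Ω'] [Fintype ι]
  {μ : Measure Ω} [IsProbabilityMeasure μ] {ν : Measure Ω'} [IsProbabilityMeasure ν]

lemma measure_exists_lt_eq {X : ι → Ω → ℝ} {K : ι → ι → ℝ} (h : CenteredGaussian μ X K) {o : ι}
    {v : NNReal} (hv0 : v ≠ 0) (hv : K o o = v) (hsymm : ∀ i, K i o = K o i)
    {c : ι → ℝ} (hc : ∀ i, c i * v = K i o) {u : ℝ} (hu : 0 < u) :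
    μ {ω | ∃ i, u < X i ω} =
      ∫⁻ w, ENNReal.ofReal ((u * √(2 * π * v))⁻¹ * rexp (-u ^ 2 / (2 * v)) *
        rexp (w / v - w ^ 2 / (2 * u ^ 2 * v))) *
        μ {ω | ∃ i, w < u * (X i ω - c i * X o ω) + (-(u ^ 2 * (1 - c i)) + (1 - c i) * w)} := by
  have hms : MeasurableSet {x : ι → ℝ | ∃ i, u < x i} := by
    simp only [ofPred_exists]
    exact MeasurableSet.iUnion fun i => measurableSet_lt measurable_const (measurable_pi_apply i)
  have h1 := h.lintegral_eq_regression hv hsymm hc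
    (g := {x : ι → ℝ | ∃ i, u < x i}.indicator 1) (measurable_one.indicator hms)
  have e0 : ∫⁻ ω, {x : ι → ℝ | ∃ i, u < x i}.indicator 1 (fun i => X i ω) ∂μ =
      μ {ω | ∃ i, u < X i ω} := lintegral_indicator_one (h.measurable_pi hms)
  have hmeas : Measurable fun p : Ω × ℝ =>
      {x : ι → ℝ | ∃ i, u < x i}.indicator (1 : (ι → ℝ) → ENNReal)
        (fun i => c i * p.2 + (X i p.1 - c i * X o p.1)) := by
    refine (measurable_one.indicator hms).comp (measurable_pi_lambda _ fun i => ?_)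
    exact (measurable_snd.const_mul _).add (((h.meas i).comp measurable_fst).sub
      (((h.meas o).comp measurable_fst).const_mul _))
  rw [e0, lintegral_lintegral_swap hmeas.aemeasurable] at h1
  rw [h1, lintegral_gaussianReal_sub_div hu hv0 (hmeas.lintegral_prod_left')]
  refine lintegral_congr fun w => ?_
  congr 1
  have hm2 : Measurable fun ω => fun i => c i * (u - w / u) + (X i ω - c i * X o ω) :=
    measurable_pi_lambda _ fun i => ((h.meas i).sub ((h.meas o).const_mul _)).const_add _
  have : (fun ω => {x : ι → ℝ | ∃ i, u < x i}.indicator (1 : (ι → ℝ) → ENNReal)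
      (fun i => c i * (u - w / u) + (X i ω - c i * X o ω))) =
      ((fun ω => fun i => c i * (u - w / u) + (X i ω - c i * X o ω)) ⁻¹'
        {x : ι → ℝ | ∃ i, u < x i}).indicator 1 := rfl
  rw [this, lintegral_indicator_one (hm2 hms)]
  congr 1
  ext ω
  simp only [mem_preimage, mem_ofPred_eq]
  refine exists_congr fun i => ?_
  rw [← mul_lt_mul_iff_right₀ hu]
  have : u * (c i * (u - w / u) + (X i ω - c i * X o ω)) =
      c i * u ^ 2 - c i * w + u * (X i ω - c i * X o ω) := by
    field_simp
  rw [this]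
  constructor <;> intro h <;> nlinarith

/-- Pickands' conditional limit argument: the lower half. -/
lemma lintegral_le_liminf [Nonempty ι] {X : ℕ → ι → Ω → ℝ} {K : ℕ → ι → ι → ℝ}
    (h : ∀ n, CenteredGaussian μ (X n) (K n)) {o : ι}
    {u v : ℕ → ℝ} (hv : ∀ n, 0 < v n) (hu : ∀ n, 0 < u n) (hKo : ∀ n, K n o o = v n)
    (hsymm : ∀ n i, K n i o = K n o i) (hutop : Tendsto u atTop atTop)
    (hv1 : Tendsto v atTop (nhds 1)) {d : ι → ℝ}
    (hd : ∀ i, Tendsto (fun n => u n ^ 2 * (1 - K n i o / v n)) atTop (nhds (d i)))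
    {Y : ι → Ω' → ℝ} {L : ι → ι → ℝ} (hY : CenteredGaussian ν Y L)
    (hL : ∀ i j, Tendsto (fun n => u n ^ 2 * (K n i j - K n i o * K n j o / v n)) atTop
      (nhds (L i j))) :
    ∫⁻ ω, ⨆ i, ENNReal.ofReal (rexp (Y i ω - d i)) ∂ν ≤
      liminf (fun n => ENNReal.ofReal (u n * √(2 * π) * rexp (u n ^ 2 / (2 * v n))) *
        μ {ω | ∃ i, u n < X n i ω}) atTop := by
  classical
  let R : ℕ → ι → Ω → ℝ := fun n i ω => u n * (X n i ω - K n i o / v n * X n o ω)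
  have hR (n) : CenteredGaussian μ (R n) (fun i j => u n ^ 2 *
      (K n i j - K n i o * K n j o / v n)) := by
    have h2 := (h n).linear (fun i j => u n * ((if i = j then 1 else 0) -
      K n i o / v n * (if o = j then 1 else 0)))
    convert h2 using 3 with i ω i j
    · simp [R, mul_sub, sub_mul, Finset.sum_sub_distrib]
      ring
    · have := (hv n).ne'
      simp [mul_sub, sub_mul, Finset.sum_sub_distrib, hsymm n j, hKo]
      field_simp
      ring
  let b : ℕ → ℝ → ENNReal := fun n w =>
    μ {ω | ∃ i, w < R n i ω + (-(u n ^ 2 * (1 - K n i o / v n)) + (1 - K n i o / v n) * w)}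
  have hbmeas (n) : Measurable (b n) := by
    refine measurable_measure_prodMk_left (s := {p : ℝ × Ω | ∃ i, p.1 < R n i p.2 +
      (-(u n ^ 2 * (1 - K n i o / v n)) + (1 - K n i o / v n) * p.1)}) ?_
    simp only [ofPred_exists]
    refine MeasurableSet.iUnion fun i => measurableSet_lt measurable_fst ?_
    exact (((hR n).meas i).comp measurable_snd).add
      ((measurable_fst.const_mul _).const_add _)
  have hzero (i) : Tendsto (fun n => 1 - K n i o / v n) atTop (nhds 0) := by
    have := (hd i).mul ((tendsto_pow_atTop (two_ne_zero)).comp hutop).inv_tendsto_atTop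
    rw [mul_zero] at this
    refine this.congr fun n => ?_
    have := (hu n).ne'
    simp only [Pi.inv_apply, Function.comp]
    field_simp
  have hb (w : ℝ) : ν {ω | ∃ i, w < Y i ω + -d i} ≤ liminf (fun n => b n w) atTop := by
    refine le_liminf_measure (P := fun _ => μ) hR hY hL (fun i => ?_) w
    have := (hd i).neg.add ((hzero i).mul_const w)
    rwa [zero_mul, add_zero] at this
  let a : ℕ → ℝ → ENNReal := fun n w =>
    ENNReal.ofReal ((√(v n))⁻¹ * rexp (w / v n - w ^ 2 / (2 * u n ^ 2 * v n)))
  have ha (w : ℝ) : Tendsto (fun n => a n w) atTop (nhds (ENNReal.ofReal (rexp w))) := by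
    refine ENNReal.tendsto_ofReal ?_
    have h1 : Tendsto (fun n => (√(v n))⁻¹) atTop (nhds 1) := by
      simpa using ((Real.continuous_sqrt.tendsto 1).comp hv1).inv₀ (by simp)
    have h2 : Tendsto (fun n => w / v n - w ^ 2 / (2 * u n ^ 2 * v n)) atTop (nhds w) := by
      have h3 := (tendsto_const_nhds (x := w)).div hv1 one_ne_zero
      have h4 := ((tendsto_pow_atTop (two_ne_zero (α := ℕ))).comp hutop).inv_tendsto_atTop
      have h5 := ((h4.const_mul (w ^ 2 / 2)).div hv1 one_ne_zero)
      have h6 := h3.sub h5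
      simp only [mul_zero, sub_zero, div_one] at h6
      refine h6.congr fun n => ?_
      simp only [Pi.div_apply, Pi.inv_apply, Function.comp]
      have := (hu n).ne'
      have := (hv n).ne'
      field_simp
    simpa using h1.mul ((Real.continuous_exp.tendsto _).comp h2)
  have e (n) : ENNReal.ofReal (u n * √(2 * π) * rexp (u n ^ 2 / (2 * v n))) *
      μ {ω | ∃ i, u n < X n i ω} = ∫⁻ w, a n w * b n w := by
    obtain ⟨v', hv'⟩ : ∃ v' : NNReal, (v' : ℝ) = v n := ⟨⟨v n, (hv n).le⟩, rfl⟩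
    have hvn := hv n
    have hun := hu n
    rw [(h n).measure_exists_lt_eq (v := v') (fun h0 => by simp [h0] at hv'; linarith)
      ((hKo n).trans hv'.symm) (hsymm n) (c := fun i => K n i o / v n)
      (fun i => by rw [hv']; field_simp) (hu n), hv',
      ← lintegral_const_mul' _ _ ENNReal.ofReal_ne_top]
    refine lintegral_congr fun w => ?_
    rw [← mul_assoc, ← ENNReal.ofReal_mul (by positivity)]
    congr 2
    rw [Real.sqrt_mul (by positivity) (v n), neg_div, Real.exp_neg]
    have := Real.exp_pos (u n ^ 2 / (2 * v n))
    have : 0 < √(v n) := by positivity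
    field_simp
  simp_rw [e]
  rw [← lintegral_exp_mul_measure_exists_lt fun i => (hY.meas i).sub_const _]
  calc _ ≤ ∫⁻ w, liminf (fun n => a n w * b n w) atTop := by
        refine lintegral_mono fun w => ?_
        have h1 := ENNReal.le_liminf_mul (f := atTop) (u := fun n => a n w) (v := fun n => b n w)
        rw [(ha w).liminf_eq] at h1
        refine le_trans ?_ h1
        gcongr
        simpa only [sub_eq_add_neg] using hb w
    _ ≤ _ := lintegral_liminf_le fun n => by
        refine Measurable.mul ?_ (hbmeas n)
        fun_prop

end CenteredGaussian

lemma rpow_sub_rpow_le_mul {a b α : ℝ} (ha : 0 < a) (hb : 0 < b) (h0 : 0 ≤ α) (h1 : α ≤ 1) :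
    b ^ α - a ^ α ≤ α * a ^ (α - 1) * (b - a) := by
  have h := rpow_one_add_le_one_add_mul_self (s := b / a - 1)
    (by linarith [div_pos hb ha]) h0 h1
  rw [add_sub_cancel, div_rpow hb.le ha.le, div_le_iff₀ (rpow_pos_of_pos ha _)] at h
  rw [rpow_sub_one ha.ne']
  have : (1 + α * (b / a - 1)) * a ^ α = a ^ α + α * (a ^ α / a) * (b - a) := by
    field_simp
  linarith

lemma rpow_sub_rpow_le_two_mul {a b α : ℝ} (ha : 1 / 2 ≤ a) (hab : a ≤ b) (h0 : 0 ≤ α)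
    (h1 : α ≤ 1) : b ^ α - a ^ α ≤ 2 * (b - a) := by
  have ha' : 0 < a := by linarith
  refine (rpow_sub_rpow_le_mul ha' (by linarith) h0 h1).trans ?_
  have h2 : a ^ (α - 1) ≤ 2 := by
    calc a ^ (α - 1) ≤ (1 / 2 : ℝ) ^ (α - 1) :=
          rpow_le_rpow_of_nonpos (by norm_num) ha (by linarith)
      _ ≤ (1 / 2 : ℝ) ^ (-1 : ℝ) :=
          rpow_le_rpow_of_exponent_ge (by norm_num) (by norm_num) (by linarith)
      _ = 2 := by rw [rpow_neg_one]; norm_num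
  have h3 : 0 ≤ a ^ (α - 1) := rpow_nonneg ha'.le _
  gcongr
  nlinarith

lemma abs_rpow_sub_rpow_le {a b α : ℝ} (ha : 1 / 2 ≤ a) (hb : 1 / 2 ≤ b) (h0 : 0 ≤ α)
    (h1 : α ≤ 1) : |b ^ α - a ^ α| ≤ 2 * |b - a| := by
  rcases le_total a b with h | h
  · rw [abs_of_nonneg (sub_nonneg.2 (rpow_le_rpow (by linarith) h h0)),
      abs_of_nonneg (sub_nonneg.2 h)]
    exact rpow_sub_rpow_le_two_mul ha h h0 h1
  · rw [abs_sub_comm, abs_sub_comm b,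
      abs_of_nonneg (sub_nonneg.2 (rpow_le_rpow (by linarith) h h0)),
      abs_of_nonneg (sub_nonneg.2 h)]
    exact rpow_sub_rpow_le_two_mul hb h h0 h1

/-- The length scale `q` with `u ^ 2 * q ^ (2 * H) = 2` of excursions above the level `u`. -/
noncomputable def pickandsScale (H u : ℝ) : ℝ := (2 / u ^ 2) ^ (1 / (2 * H))

lemma pickandsScale_nonneg (H u : ℝ) : 0 ≤ pickandsScale H u := by
  unfold pickandsScale
  positivity

lemma pickandsScale_pos {H u : ℝ} (hu : 0 < u) : 0 < pickandsScale H u := by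
  unfold pickandsScale
  positivity

lemma sq_mul_pickandsScale_rpow {H u : ℝ} (hH : 0 < H) (hu : 0 < u) :
    u ^ 2 * pickandsScale H u ^ (2 * H) = 2 := by
  rw [pickandsScale, ← rpow_mul (by positivity), one_div_mul_cancel (by positivity), rpow_one]
  field_simp

lemma tendsto_sq_mul_pickandsScale {H : ℝ} (hH : 0 < H) (hH' : H < 1 / 2) :
    Tendsto (fun u => u ^ 2 * pickandsScale H u) atTop (nhds 0) := by
  have hp : 0 < 1 / (2 * H) - 1 := by
    rw [sub_pos, lt_div_iff₀ (by positivity)]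
    linarith
  have h1 : Tendsto (fun u : ℝ => 2 / u ^ 2) atTop (nhds 0) :=
    (tendsto_pow_atTop two_ne_zero).const_div_atTop 2
  have h2 := (h1.rpow_const (Or.inr hp.le)).const_mul 2
  rw [zero_rpow hp.ne', mul_zero] at h2
  refine h2.congr' ?_
  filter_upwards [eventually_gt_atTop 0] with u hu
  rw [pickandsScale, rpow_sub_one (by positivity)]
  field_simp

lemma tendsto_pickandsScale {H : ℝ} (hH : 0 < H) (hH' : H < 1 / 2) :
    Tendsto (pickandsScale H) atTop (nhds 0) := by
  have h1 := (tendsto_sq_mul_pickandsScale hH hH').mul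
    ((tendsto_pow_atTop (α := ℝ) two_ne_zero).inv_tendsto_atTop)
  rw [zero_mul] at h1
  refine h1.congr' ?_
  filter_upwards [eventually_gt_atTop 0] with u hu
  simp only [Pi.inv_apply]
  field_simp

lemma incrementCov_scaled {ι : Type*} {H s τ q : ℝ} (hq : 0 ≤ q) (x y : ι → ℝ) (i j : ι) :
    incrementCov H (fun _ => 1) (fun i => s + q * x i) (fun i => s + τ + q * y i) i j =
      (|τ + q * (y i - x j)| ^ (2*H) + |τ + q * (y j - x i)| ^ (2*H)
        - q ^ (2*H) * |y i - y j| ^ (2*H) - q ^ (2*H) * |x i - x j| ^ (2*H)) / 2 := by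
  have e1 : s + τ + q * y i - (s + q * x j) = τ + q * (y i - x j) := by ring
  have e2 : s + q * x i - (s + τ + q * y j) = -(τ + q * (y j - x i)) := by ring
  have e3 : s + τ + q * y i - (s + τ + q * y j) = q * (y i - y j) := by ring
  have e4 : s + q * x i - (s + q * x j) = q * (x i - x j) := by ring
  rw [incrementCov, e1, e2, e3, e4, abs_neg, abs_mul q, abs_mul q, abs_of_nonneg hq,
    mul_rpow hq (abs_nonneg _), mul_rpow hq (abs_nonneg _)]
  ring

lemma incrementCov_comm {ι : Type*} {H : ℝ} (θ x y : ι → ℝ) (i j : ι) :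
    incrementCov H θ x y i j = incrementCov H θ x y j i := by
  rw [incrementCov, incrementCov, abs_sub_comm (y i) (y j), abs_sub_comm (x i) (x j),
    abs_sub_comm (y i), abs_sub_comm (x i)]
  ring

section limits

variable {H : ℝ} {u τ : ℕ → ℝ}

lemma tendsto_sq_mul_rpow_sub (hH : 0 < H) (hH' : H < 1 / 2) (hu : Tendsto u atTop atTop)
    (hτ : Tendsto τ atTop (nhds 1)) (z : ℝ) :
    Tendsto (fun n => u n ^ 2 * (|τ n + pickandsScale H (u n) * z| ^ (2*H) - τ n ^ (2*H)))
      atTop (nhds 0) := by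
  have h1 := ((tendsto_sq_mul_pickandsScale hH hH').comp hu).mul_const (2 * |z|)
  rw [zero_mul] at h1
  have h2 := hτ.add (((tendsto_pickandsScale hH hH').comp hu).mul_const z)
  rw [zero_mul, add_zero] at h2
  refine squeeze_zero_norm' ?_ h1
  filter_upwards [hτ.eventually (lt_mem_nhds (show (1 / 2 : ℝ) < 1 by norm_num)),
    h2.eventually (lt_mem_nhds (show (1 / 2 : ℝ) < 1 by norm_num))] with n hn hn2
  simp only [Function.comp] at hn2 ⊢
  have := abs_rpow_sub_rpow_le hn.le hn2.le (α := 2 * H) (by linarith) (by linarith)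
  rw [add_sub_cancel_left, abs_mul, abs_of_nonneg (pickandsScale_nonneg _ _)] at this
  rw [Real.norm_eq_abs, abs_mul, abs_of_nonneg (sq_nonneg _),
    abs_of_pos (by linarith : 0 < τ n + _)]
  calc _ ≤ u n ^ 2 * (2 * (pickandsScale H (u n) * |z|)) := by gcongr
    _ = _ := by ring

variable {ι : Type*} {s : ℕ → ℝ} (x y : ι → ℝ)

lemma tendsto_sq_mul_incrementCov (hH : 0 < H) (hH' : H < 1 / 2) (hu : Tendsto u atTop atTop)
    (hu0 : ∀ n, 0 < u n) (hτ : Tendsto τ atTop (nhds 1)) (i j : ι) :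
    Tendsto (fun n => u n ^ 2 * (τ n ^ (2*H) - incrementCov H (fun _ => 1)
        (fun i => s n + pickandsScale H (u n) * x i)
        (fun i => s n + τ n + pickandsScale H (u n) * y i) i j)) atTop
      (nhds (|y i - y j| ^ (2*H) + |x i - x j| ^ (2*H))) := by
  have h1 := ((tendsto_sq_mul_rpow_sub hH hH' hu hτ (y i - x j)).add
    (tendsto_sq_mul_rpow_sub hH hH' hu hτ (y j - x i))).const_mul (-(1/2))
  have h2 := h1.add_const (|y i - y j| ^ (2*H) + |x i - x j| ^ (2*H))
  rw [add_zero, mul_zero, zero_add] at h2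
  refine h2.congr fun n => ?_
  rw [incrementCov_scaled (pickandsScale_nonneg _ _)]
  linear_combination -((|y i - y j| ^ (2*H) + |x i - x j| ^ (2*H)) / 2) *
    sq_mul_pickandsScale_rpow hH (hu0 n)

end limits

lemma rpow_neg_le_one_add {τ a : ℝ} (hτ : 1 / 2 ≤ τ) (h0 : 0 ≤ a) (h1 : a ≤ 1) :
    (τ ^ a)⁻¹ ≤ 1 + a * (1 - τ) + 2 * a * (1 - τ) ^ 2 := by
  have hτ0 : 0 < τ := by linarith
  have h := rpow_one_add_le_one_add_mul_self (s := τ⁻¹ - 1)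
    (by linarith [inv_pos.2 hτ0]) h0 h1
  rw [add_sub_cancel, inv_rpow hτ0.le] at h
  refine h.trans ?_
  have h2 : τ⁻¹ - 1 ≤ (1 - τ) + 2 * (1 - τ) ^ 2 := by
    rw [sub_le_iff_le_add, inv_le_iff_one_le_mul₀ hτ0]
    nlinarith [mul_nonneg (sq_nonneg (1 - τ)) (by linarith : 0 ≤ 2 * τ - 1)]
  nlinarith

namespace IsRoughFBM

variable {Ω : Type*} [MeasurableSpace Ω] {μ : Measure Ω} [IsProbabilityMeasure μ]
  {H : ℝ} {B : ℝ → Ω → ℝ}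

lemma lintegral_iSup_pickandsExp_prod (h : IsRoughFBM μ H B) (n k : ℕ) :
    ∫⁻ p, ⨆ i : Fin (k * 2 ^ n + 1) × Fin (k * 2 ^ n + 1),
      ENNReal.ofReal (rexp (√2 * B (i.1 / 2 ^ n) p.1 + √2 * B (i.2 / 2 ^ n) p.2
        - (|(i.2 / 2 ^ n : ℝ)| ^ (2*H) + |(i.1 / 2 ^ n : ℝ)| ^ (2*H)))) ∂(μ.prod μ) =
      gridConst μ H B n k ^ 2 := by
  have e (p : Ω × Ω) : ⨆ i : Fin (k * 2 ^ n + 1) × Fin (k * 2 ^ n + 1),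
      ENNReal.ofReal (rexp (√2 * B (i.1 / 2 ^ n) p.1 + √2 * B (i.2 / 2 ^ n) p.2
        - (|(i.2 / 2 ^ n : ℝ)| ^ (2*H) + |(i.1 / 2 ^ n : ℝ)| ^ (2*H)))) =
      gridSup H B 0 n k p.1 * gridSup H B 0 n k p.2 := by
    simp only [gridSup, ENNReal.iSup_mul, ENNReal.mul_iSup, iSup_prod, pickandsExp, zero_add]
    rw [iSup_comm]
    refine iSup_congr fun i => iSup_congr fun j => ?_
    rw [← ENNReal.ofReal_mul (Real.exp_pos _).le, ← Real.exp_add, abs_of_nonneg (by positivity),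
      abs_of_nonneg (by positivity)]
    congr 2
    ring
  simp_rw [e]
  rw [lintegral_prod_mul (h.measurable_gridSup _ _ _).aemeasurable
    (h.measurable_gridSup _ _ _).aemeasurable, pow_two]
  rfl

lemma gridConst_sq_le_liminf (h : IsRoughFBM μ H B) (n k : ℕ) {u τ s : ℕ → ℝ}
    (hu : Tendsto u atTop atTop) (hu0 : ∀ j, 0 < u j) (hτ : Tendsto τ atTop (nhds 1))
    (hτ0 : ∀ j, 0 < τ j) (hs : ∀ j, 0 ≤ s j) :
    gridConst μ H B n k ^ 2 ≤ liminf (fun j => ENNReal.ofReal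
      (u j * √(2 * π) * rexp (u j ^ 2 / (2 * τ j ^ (2*H)))) *
      μ {ω | ∃ i : Fin (k * 2 ^ n + 1) × Fin (k * 2 ^ n + 1),
        u j < B (s j + τ j + pickandsScale H (u j) * (i.2 / 2 ^ n)) ω -
          B (s j + pickandsScale H (u j) * (i.1 / 2 ^ n)) ω}) atTop := by
  have hH := h.pos
  have h2H := h.two_H_pos
  let x : Fin (k * 2 ^ n + 1) × Fin (k * 2 ^ n + 1) → ℝ := fun i => i.1 / 2 ^ n
  let y : Fin (k * 2 ^ n + 1) × Fin (k * 2 ^ n + 1) → ℝ := fun i => i.2 / 2 ^ n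
  have hx (i) : 0 ≤ x i := by positivity
  have hy (i) : 0 ≤ y i := by positivity
  let K : ℕ → _ → _ → ℝ := fun j => incrementCov H (fun _ => 1)
    (fun i => s j + pickandsScale H (u j) * x i)
    (fun i => s j + τ j + pickandsScale H (u j) * y i)
  let o : Fin (k * 2 ^ n + 1) × Fin (k * 2 ^ n + 1) := (0, 0)
  have hxo : x o = 0 := by simp [x, o]
  have hyo : y o = 0 := by simp [y, o]
  have hX (j) := h.increments (fun _ => 1) (x := fun i => s j + pickandsScale H (u j) * x i)
    (y := fun i => s j + τ j + pickandsScale H (u j) * y i)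
    (fun i => by have := hs j; have := pickandsScale_nonneg H (u j); have := hx i; positivity)
    (fun i => by
      have := hs j; have := (hτ0 j).le; have := pickandsScale_nonneg H (u j); have := hy i
      positivity)
  simp only [one_mul] at hX
  have hv (j) : 0 < τ j ^ (2*H) := rpow_pos_of_pos (hτ0 j) _
  have hv1 : Tendsto (fun j => τ j ^ (2*H)) atTop (nhds 1) := by
    simpa using hτ.rpow_const (p := 2*H) (Or.inl one_ne_zero)
  have hA (i i') := tendsto_sq_mul_incrementCov (s := s) x y hH h.lt_half hu hu0 hτ i i'
  have hd (i) : Tendsto (fun j => u j ^ 2 * (1 - K j i o / τ j ^ (2*H))) atTop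
      (nhds (|y i| ^ (2*H) + |x i| ^ (2*H))) := by
    have := (hA i o).div hv1 one_ne_zero
    rw [div_one, hxo, hyo, sub_zero, sub_zero] at this
    refine this.congr fun j => ?_
    have := (hv j).ne'
    simp only [Pi.div_apply, K]
    field_simp
  have hinv : Tendsto (fun j => (u j ^ 2)⁻¹) atTop (nhds 0) :=
    ((tendsto_pow_atTop two_ne_zero).comp hu).inv_tendsto_atTop
  have hL (i i') : Tendsto (fun j => u j ^ 2 * (K j i i' - K j i o * K j i' o / τ j ^ (2*H)))
      atTop (nhds ((|y i| ^ (2*H) + |x i| ^ (2*H)) + (|y i'| ^ (2*H) + |x i'| ^ (2*H)) -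
        (|y i - y i'| ^ (2*H) + |x i - x i'| ^ (2*H)))) := by
    have h1 := hA i o
    have h2 := hA i' o
    rw [hxo, hyo, sub_zero, sub_zero] at h1 h2
    have h3 := ((h1.add h2).sub (hA i i')).sub ((h1.mul h2).mul (hinv.div hv1 one_ne_zero))
    rw [div_one, mul_zero, sub_zero] at h3
    refine h3.congr fun j => ?_
    have := (hv j).ne'
    have := (hu0 j).ne'
    simp only [Pi.div_apply, K]
    field_simp
    ring
  have hY1 := (h.centeredGaussian hx).linear (fun i i' => √2 * if i = i' then 1 else 0)
  have hY2 := (h.centeredGaussian hy).linear (fun i i' => √2 * if i = i' then 1 else 0)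
  have hY : CenteredGaussian (μ.prod μ) (fun i p => √2 * B (x i) p.1 + √2 * B (y i) p.2)
      (fun i i' => (|y i| ^ (2*H) + |x i| ^ (2*H)) + (|y i'| ^ (2*H) + |x i'| ^ (2*H)) -
        (|y i - y i'| ^ (2*H) + |x i - x i'| ^ (2*H))) := by
    have hsq : √2 * √2 = 2 := Real.mul_self_sqrt (by norm_num)
    convert hY1.prod_add hY2 using 3 with i p i i'
    · simp
    · simp [abs_of_nonneg (hx _), abs_of_nonneg (hy _), hsq]
      ring
  have hKo (j) : K j o o = τ j ^ (2*H) := by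
    simp only [K]
    rw [incrementCov_scaled (pickandsScale_nonneg _ _)]
    simp [hxo, hyo, zero_rpow h2H.ne', abs_of_pos (hτ0 j)]
  have := CenteredGaussian.lintegral_le_liminf hX hv hu0 hKo
    (fun j i => incrementCov_comm _ _ _ _ _) hu hv1 hd hY hL
  rw [← h.lintegral_iSup_pickandsExp_prod]
  exact this

/-- Uniform lower bound for the excursion probability of a local block of the increment field. -/
lemma exists_block_lower_bound (h : IsRoughFBM μ H B) {n k : ℕ} {c : ℝ}
    (hc : ENNReal.ofReal c < gridConst μ H B n k ^ 2) (K : ℝ) :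
    ∃ U, ∀ u ≥ U, ∀ τ s : ℝ, 0 ≤ s → τ ≤ 1 → u ^ 2 * (1 - τ) ≤ K →
      ENNReal.ofReal c ≤ ENNReal.ofReal
        (u * √(2 * π) * rexp (u ^ 2 / 2 + H * (u ^ 2 * (1 - τ)))) *
      μ {ω | ∃ i : Fin (k * 2 ^ n + 1) × Fin (k * 2 ^ n + 1),
        u < B (s + τ + pickandsScale H u * (i.2 / 2 ^ n)) ω -
          B (s + pickandsScale H u * (i.1 / 2 ^ n)) ω} := by
  by_contra! hcon
  have hmax (j : ℕ) := hcon (max (j + 1) (√(2 * |K|)))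
  choose u huU τ s hs hτ1 hK hlt using hmax
  have huj (j : ℕ) : (j : ℝ) + 1 ≤ u j := (le_max_left _ _).trans (huU j)
  have hu0 (j) : 0 < u j := by
    have := huj j
    have : (0 : ℝ) ≤ j := Nat.cast_nonneg j
    linarith
  have hu : Tendsto u atTop atTop := tendsto_atTop_mono
    (fun j => (le_add_of_nonneg_right zero_le_one).trans (huj j)) tendsto_natCast_atTop_atTop
  have hinv : Tendsto (fun j => (u j ^ 2)⁻¹) atTop (nhds 0) :=
    ((tendsto_pow_atTop two_ne_zero).comp hu).inv_tendsto_atTop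
  have h1τ (j) : 1 - τ j ≤ |K| * (u j ^ 2)⁻¹ := by
    rw [← div_eq_mul_inv, le_div_iff₀ (pow_pos (hu0 j) 2), mul_comm]
    exact (hK j).trans (le_abs_self K)
  have hhalf (j) : 1 / 2 ≤ τ j := by
    have h1 : √(2 * |K|) ≤ u j := (le_max_right _ _).trans (huU j)
    have h2 : 2 * |K| ≤ u j ^ 2 := by
      have := Real.sq_sqrt (show 0 ≤ 2 * |K| by positivity)
      nlinarith [Real.sqrt_nonneg (2 * |K|)]
    have h3 := h1τ j
    rw [← div_eq_mul_inv, le_div_iff₀ (pow_pos (hu0 j) 2)] at h3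
    have := pow_pos (hu0 j) 2
    by_contra! h4
    nlinarith
  have hτ : Tendsto τ atTop (nhds 1) := by
    refine tendsto_of_tendsto_of_tendsto_of_le_of_le (g := fun j => 1 - |K| * (u j ^ 2)⁻¹) ?_
      tendsto_const_nhds (fun j => by linarith [h1τ j]) hτ1
    simpa using (hinv.const_mul |K|).const_sub 1
  have hlim := h.gridConst_sq_le_liminf n k hu hu0 hτ (fun j => by linarith [hhalf j]) hs
  have hHpos := h.pos
  have hHlt := h.lt_half
  have hbound : Tendsto (fun j => ENNReal.ofReal (rexp (2 * H * K ^ 2 * (u j ^ 2)⁻¹)) *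
      ENNReal.ofReal c) atTop (nhds (ENNReal.ofReal c)) := by
    have h1 := ENNReal.tendsto_ofReal
      ((Real.continuous_exp.tendsto _).comp (hinv.const_mul (2 * H * K ^ 2)))
    rw [mul_zero, Real.exp_zero, ENNReal.ofReal_one] at h1
    simpa using ENNReal.Tendsto.mul_const h1 (Or.inl one_ne_zero)
  refine absurd (hlim.trans ?_) (not_le.2 hc)
  rw [← hbound.liminf_eq]
  refine liminf_le_liminf (Eventually.of_forall fun j => ?_)
  refine le_trans ?_ (mul_le_mul_right (hlt j).le _)
  rw [← mul_assoc, ← ENNReal.ofReal_mul (Real.exp_pos _).le]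
  refine mul_le_mul_left (ENNReal.ofReal_le_ofReal ?_) _
  rw [mul_left_comm, ← Real.exp_add]
  have := (hu0 j).le
  gcongr
  have h1 := rpow_neg_le_one_add (a := 2 * H) (hhalf j) (by linarith) (by linarith)
  have h2 : u j ^ 2 * (1 - τ j) ^ 2 ≤ K ^ 2 * (u j ^ 2)⁻¹ := by
    have h3 := pow_le_pow_left₀ (by linarith [hτ1 j]) (h1τ j) 2
    have hu2 := pow_pos (hu0 j) 2
    calc u j ^ 2 * (1 - τ j) ^ 2 ≤ u j ^ 2 * (|K| * (u j ^ 2)⁻¹) ^ 2 := by gcongr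
      _ = _ := by
        rw [mul_pow, sq_abs]
        field_simp
  calc u j ^ 2 / (2 * τ j ^ (2*H)) = u j ^ 2 / 2 * (τ j ^ (2*H))⁻¹ := by
        rw [div_mul_eq_div_mul_one_div, one_div]
    _ ≤ u j ^ 2 / 2 * (1 + 2 * H * (1 - τ j) + 2 * (2 * H) * (1 - τ j) ^ 2) := by gcongr
    _ ≤ _ := by nlinarith

end IsRoughFBM

/-- The leading term `φ(u) / u` of the Gaussian tail at `u`. -/
noncomputable def millsTerm (u : ℝ) : ℝ := (u * √(2 * π))⁻¹ * rexp (-u ^ 2 / 2)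

lemma millsTerm_pos {u : ℝ} (hu : 0 < u) : 0 < millsTerm u := by
  unfold millsTerm
  positivity

lemma gaussianReal_Ioi_le {u : ℝ} (hu : 0 < u) (v : NNReal) :
    gaussianReal 0 v (Ioi u) ≤
      ENNReal.ofReal (√v * (u * √(2 * π))⁻¹ * rexp (-u ^ 2 / (2 * v))) := by
  by_cases hv : v = 0
  · subst hv
    rw [gaussianReal_zero_var, Measure.dirac_apply' _ measurableSet_Ioi]
    simp [hu.le]
  have hvpos : (0 : ℝ) < v := by positivity
  rw [← lintegral_indicator_one measurableSet_Ioi,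
    lintegral_gaussianReal_sub_div hu hv (measurable_one.indicator measurableSet_Ioi)]
  have hI : ∫⁻ w in Iic (0 : ℝ), ENNReal.ofReal (rexp ((v : ℝ)⁻¹ * w)) =
      ENNReal.ofReal v := by
    rw [← ofReal_integral_eq_lintegral_ofReal (integrableOn_exp_mul_Iic (by positivity) _)
      (ae_of_all _ fun x => (Real.exp_pos _).le), integral_exp_mul_Iic (by positivity)]
    simp
  calc _ ≤ ∫⁻ w, (Iic (0 : ℝ)).indicator (fun w => ENNReal.ofReal ((u * √(2 * π * v))⁻¹ *
        rexp (-u ^ 2 / (2 * v))) * ENNReal.ofReal (rexp ((v : ℝ)⁻¹ * w))) w := by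
        refine lintegral_mono fun w => ?_
        by_cases hw : w < 0
        · rw [indicator_of_mem (show w ∈ Iic (0:ℝ) from hw.le),
            ENNReal.ofReal_mul (p := _ * _) (by positivity)]
          refine mul_le_of_le_of_le_one ?_ ?_
          · gcongr
            rw [← div_eq_inv_mul]
            have : 0 ≤ w ^ 2 / (2 * u ^ 2 * v) := by positivity
            linarith
          · exact indicator_le_self' (by simp) _
        · have : u - w / u ∉ Ioi u := by
            have := div_nonneg (not_lt.1 hw) hu.le
            simp only [mem_Ioi, not_lt]
            linarith
          simp [this]
    _ = ENNReal.ofReal ((u * √(2 * π * v))⁻¹ * rexp (-u ^ 2 / (2 * v))) *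
          ENNReal.ofReal v := by
        rw [lintegral_indicator measurableSet_Iic, lintegral_const_mul' _ _ ENNReal.ofReal_ne_top,
          hI]
    _ = _ := by
        rw [← ENNReal.ofReal_mul (by positivity), Real.sqrt_mul (by positivity)]
        congr 1
        have h1 : √(v : ℝ) ≠ 0 := by positivity
        have h2 := Real.mul_self_sqrt hvpos.le
        field_simp
        rw [pow_two, h2]

lemma stdNormalTail_le {u : ℝ} (hu : 0 < u) : stdNormalTail u ≤ millsTerm u := by
  refine ENNReal.toReal_le_of_le_ofReal (millsTerm_pos hu).le ?_
  simpa [millsTerm] using gaussianReal_Ioi_le hu 1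

lemma le_stdNormalTail {u : ℝ} (hu : 1 ≤ u) : rexp (-2) * millsTerm u ≤ stdNormalTail u := by
  have hu0 : 0 < u := by linarith
  rw [stdNormalTail, ← ENNReal.ofReal_le_iff_le_toReal (measure_ne_top _ _),
    ← lintegral_indicator_one measurableSet_Ioi,
    lintegral_gaussianReal_sub_div hu0 one_ne_zero (measurable_one.indicator measurableSet_Ioi)]
  calc ENNReal.ofReal (rexp (-2) * millsTerm u)
      = ∫⁻ w, (Ioo (-1 : ℝ) 0).indicator
          (fun _ => ENNReal.ofReal (rexp (-2) * millsTerm u)) w := by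
        rw [lintegral_indicator_const measurableSet_Ioo]
        simp
    _ ≤ _ := by
        refine lintegral_mono fun w => ?_
        by_cases hw : w ∈ Ioo (-1 : ℝ) 0
        · have : u - w / u ∈ Ioi u := by
            have := div_neg_of_neg_of_pos hw.2 hu0
            simp only [mem_Ioi]
            linarith
          rw [indicator_of_mem hw, indicator_of_mem this]
          simp only [Pi.one_apply, mul_one, NNReal.coe_one, div_one]
          rw [mul_comm, millsTerm]
          gcongr
          have h1 : w ^ 2 / (2 * u ^ 2) ≤ 1 := by
            rw [div_le_one (by positivity)]
            nlinarith [hw.1, hw.2]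
          linarith [hw.1]
        · simp [hw]

lemma CenteredGaussian.diag_nonneg {Ω ι : Type*} [MeasurableSpace Ω] [Fintype ι]
    {μ : Measure Ω} [IsProbabilityMeasure μ] {X : ι → Ω → ℝ} {K : ι → ι → ℝ}
    (h : CenteredGaussian μ X K) (i : ι) : 0 ≤ K i i := by
  have h1 := (h.reindex fun _ : Unit => i).char fun _ => 1
  have h2 := norm_integral_le_integral_norm (μ := μ) fun ω =>
    Complex.exp ((∑ _j : Unit, (1 : ℝ) * X i ω : ℝ) * Complex.I)
  rw [h1] at h2
  simp only [Complex.norm_exp_ofReal_mul_I, integral_const, probReal_univ, smul_eq_mul, mul_one,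
    Complex.norm_real, Real.norm_eq_abs, Real.abs_exp, Real.exp_le_one_iff] at h2
  simp at h2
  linarith

lemma CenteredGaussian.measure_lt_le {Ω ι : Type*} [MeasurableSpace Ω] [Fintype ι]
    {μ : Measure Ω} [IsProbabilityMeasure μ] {X : ι → Ω → ℝ} {K : ι → ι → ℝ}
    (h : CenteredGaussian μ X K) (i : ι) {u : ℝ} (hu : 0 < u) {v : ℝ} (hv : 0 ≤ v)
    (hK : K i i = v) :
    μ {ω | u < X i ω} ≤ ENNReal.ofReal (√v * (u * √(2 * π))⁻¹ * rexp (-u ^ 2 / (2 * v))) := by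
  lift v to NNReal using hv
  have h1 := (h.reindex fun _ : Unit => i).congr_cov (K' := fun _ _ => 1 * 1 * (v : ℝ))
    (fun _ _ => by rw [hK]; ring)
  have h2 := CenteredGaussian.gaussianReal_const_mul v (fun _ : Unit => (1 : ℝ))
  have hms : MeasurableSet {x : Unit → ℝ | u < x ()} :=
    measurableSet_lt measurable_const (measurable_pi_apply _)
  have h3 := h1.lintegral_eq h2 (g := {x : Unit → ℝ | u < x ()}.indicator 1)
    (measurable_one.indicator hms)
  have h4 : μ {ω | u < X i ω} = gaussianReal 0 v (Ioi u) := by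
    simp only [one_mul] at h3
    refine ((lintegral_indicator_one (h1.measurable_pi hms)).symm.trans h3).trans ?_
    exact lintegral_indicator_one measurableSet_Ioi
  rw [h4]
  exact gaussianReal_Ioi_le hu v

/-- Two-point excursion bound: `D` bounds below the variance of the difference of the increments. -/
lemma IsRoughFBM.measure_pair_le {Ω : Type*} [MeasurableSpace Ω] {μ : Measure Ω}
    [IsProbabilityMeasure μ] {H : ℝ} {B : ℝ → Ω → ℝ} (h : IsRoughFBM μ H B) {x y x' y' u D : ℝ}
    (hx : 0 ≤ x) (hy : 0 ≤ y) (hx' : 0 ≤ x') (hy' : 0 ≤ y') (hu : 0 < u)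
    (h1 : |y - x| ^ (2*H) ≤ 1) (h2 : |y' - x'| ^ (2*H) ≤ 1) (hD0 : 0 ≤ D)
    (hD : D ≤ |y - x| ^ (2*H) + |y' - x'| ^ (2*H) + |y - y'| ^ (2*H) + |x - x'| ^ (2*H) -
      |y - x'| ^ (2*H) - |x - y'| ^ (2*H)) :
    μ ({ω | u < B y ω - B x ω} ∩ {ω | u < B y' ω - B x' ω}) ≤
      ENNReal.ofReal (millsTerm u * rexp (-(u ^ 2 * D / 8))) := by
  have hg := (h.increments (fun _ : Bool => 1) (x := fun b => if b then x else x')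
    (y := fun b => if b then y else y') (by rintro (_ | _) <;> simp [hx, hx'])
    (by rintro (_ | _) <;> simp [hy, hy'])).linear (κ := Unit) fun _ _ => 1
  set V := 2 * |y - x| ^ (2*H) + 2 * |y' - x'| ^ (2*H) -
    (|y - x| ^ (2*H) + |y' - x'| ^ (2*H) + |y - y'| ^ (2*H) + |x - x'| ^ (2*H) -
      |y - x'| ^ (2*H) - |x - y'| ^ (2*H)) with hV
  have hKV : ∑ i : Bool, ∑ j : Bool, (1 : ℝ) * 1 * incrementCov H (fun _ => 1)
      (fun b => if b then x else x') (fun b => if b then y else y') i j = V := by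
    simp [incrementCov, zero_rpow h.two_H_pos.ne', abs_sub_comm y' y, abs_sub_comm x' x,
      abs_sub_comm x y, abs_sub_comm x' y', abs_sub_comm x' y, abs_sub_comm y' x, hV]
    ring
  have hle := hg.measure_lt_le () (u := 2 * u) (by positivity) (hg.diag_nonneg ()) rfl
  rw [hKV] at hle
  simp only [one_mul, Fintype.sum_bool] at hle
  replace hle := (measure_mono (s := {ω | u < B y ω - B x ω} ∩ {ω | u < B y' ω - B x' ω})
    fun ω hω => by
      have h1 : u < B y ω - B x ω := hω.1
      have h2 : u < B y' ω - B x' ω := hω.2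
      simp only [mem_ofPred_eq]
      simp
      linarith).trans hle
  rcases lt_or_eq_of_le (hKV ▸ hg.diag_nonneg ()) with hVpos | hVpos
  · have hV4 : V ≤ 4 - D := by linarith
    refine hle.trans (ENNReal.ofReal_le_ofReal ?_)
    rw [millsTerm, mul_assoc (u * √(2 * π))⁻¹, ← Real.exp_add]
    have e1 : √V * (2 * u * √(2 * π))⁻¹ ≤ (u * √(2 * π))⁻¹ := by
      have : √V ≤ 2 := by
        rw [Real.sqrt_le_left (by norm_num)]
        linarith
      rw [mul_assoc 2, mul_inv, ← mul_assoc]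
      refine mul_le_of_le_one_left (by positivity) ?_
      linarith
    gcongr ?_ * rexp ?_
    rw [div_le_iff₀ (by positivity)]
    nlinarith [mul_pos hu hu, mul_nonneg (sub_nonneg.2 hV4) (by positivity : 0 ≤ u ^ 2 * (4 + D)),
      mul_nonneg (sq_nonneg u) (sq_nonneg D)]
  · rw [← hVpos] at hle
    simp only [Real.sqrt_zero, zero_mul, ENNReal.ofReal_zero] at hle
    exact hle.trans zero_le

lemma rpow_add_rpow_le_of_spread {a b c d α : ℝ} (ha : 0 ≤ a) (hac : a ≤ c) (had : a ≤ d)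
    (hsum : a + b = c + d) (h0 : 0 ≤ α) (h1 : α ≤ 1) : a ^ α + b ^ α ≤ c ^ α + d ^ α := by
  rcases eq_or_lt_of_le (show a ≤ b by linarith) with hab | hab
  · have : c = a := by linarith
    have : d = a := by linarith
    subst_vars
    rfl
  have hconc := Real.concaveOn_rpow h0 h1
  have hba : 0 < b - a := by linarith
  have hb : 0 ≤ b := by linarith
  have hd' : d - a = b - c := by linarith
  have key (z : ℝ) (hz : a ≤ z) (hz' : z ≤ b) :
      (b - z) / (b - a) * a ^ α + (z - a) / (b - a) * b ^ α ≤ z ^ α := by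
    have := hconc.2 (mem_Ici.2 ha) (mem_Ici.2 hb)
      (div_nonneg (sub_nonneg.2 hz') hba.le) (div_nonneg (sub_nonneg.2 hz) hba.le)
      (by field_simp; ring)
    simp only [smul_eq_mul] at this
    have e : (b - z) / (b - a) * a + (z - a) / (b - a) * b = z := by
      field_simp
      ring
    rwa [e] at this
  have k1 := key c hac (by linarith)
  have k2 := key d had (by linarith)
  have e1 : (b - c) / (b - a) + (b - d) / (b - a) = 1 := by
    field_simp
    linarith
  have e2 : (c - a) / (b - a) + (d - a) / (b - a) = 1 := by
    field_simp
    linarith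
  calc a ^ α + b ^ α = ((b - c) / (b - a) + (b - d) / (b - a)) * a ^ α +
        ((c - a) / (b - a) + (d - a) / (b - a)) * b ^ α := by rw [e1, e2]; ring
    _ ≤ _ := by linarith

lemma le_increment_distance_aux {x y x' y' α t : ℝ} (h0 : 0 < α) (h1 : α ≤ 1) (hxx : x' ≤ x)
    (hτ : 1 / 2 ≤ y - x) (hτ' : 1 / 2 ≤ y' - x') (hτ1 : y - x ≤ 1) (hτ1' : y' - x' ≤ 1)
    (ht : 1 - t ≤ y - x)
    (hsmall : ∀ h, 0 ≤ h → h ≤ t → 4 * h ≤ h ^ α) :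
    min ((|x - x'| ^ α + |y - y'| ^ α) / 2) 1 ≤
      |y - x| ^ α + |y' - x'| ^ α + |y - y'| ^ α + |x - x'| ^ α - |y - x'| ^ α - |x - y'| ^ α := by
  have hx0 : 0 ≤ x - x' := by linarith
  rw [abs_of_nonneg hx0, abs_of_pos (by linarith : 0 < y - x),
    abs_of_pos (by linarith : 0 < y' - x'), abs_of_pos (by linarith : 0 < y - x')]
  have hk : 0 ≤ |y - y'| ^ α := by positivity
  have hh : 0 ≤ (x - x') ^ α := rpow_nonneg hx0 _
  rcases le_total y' x with hyx | hyx
  · refine (min_le_right _ _).trans ?_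
    rw [abs_of_nonneg (by linarith : 0 ≤ x - y'), abs_of_pos (by linarith : 0 < y - y')]
    have hspread := rpow_add_rpow_le_of_spread (a := x - y') (b := y - x') (c := y - y')
      (d := x - x') (by linarith) (by linarith) (by linarith) (by ring) h0.le h1
    have g1 := self_le_rpow_of_le_one (by linarith) hτ1 h1
    have g2 := self_le_rpow_of_le_one (by linarith) hτ1' h1
    linarith
  · refine (min_le_left _ _).trans ?_
    rw [abs_sub_comm x y', abs_of_nonneg (by linarith : 0 ≤ y' - x)]
    rcases le_total (y' - x') (y - x') with hcase | hcase
    · have hspread := rpow_add_rpow_le_of_spread (a := y' - x) (b := y - x') (c := y - x)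
        (d := y' - x') (by linarith) (by linarith) (by linarith) (by ring) h0.le h1
      linarith
    · have g1 := rpow_sub_rpow_le_two_mul hτ (b := y - x') (by linarith) h0.le h1
      have g2 : (y' - x) ^ α ≤ (y' - x') ^ α := rpow_le_rpow (by linarith) (by linarith) h0.le
      have g3 := hsmall (x - x') hx0 (by linarith)
      linarith

/-- Lower bound for the variance of the difference of two almost maximal increments. -/
lemma le_increment_distance {x y x' y' α t : ℝ} (h0 : 0 < α) (h1 : α ≤ 1)
    (hτ : 1 / 2 ≤ y - x) (hτ' : 1 / 2 ≤ y' - x') (hτ1 : y - x ≤ 1) (hτ1' : y' - x' ≤ 1)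
    (ht : 1 - t ≤ y - x) (ht' : 1 - t ≤ y' - x')
    (hsmall : ∀ h, 0 ≤ h → h ≤ t → 4 * h ≤ h ^ α) :
    min ((|x - x'| ^ α + |y - y'| ^ α) / 2) 1 ≤
      |y - x| ^ α + |y' - x'| ^ α + |y - y'| ^ α + |x - x'| ^ α - |y - x'| ^ α - |x - y'| ^ α := by
  rcases le_total x' x with hxx | hxx
  · exact le_increment_distance_aux h0 h1 hxx hτ hτ' hτ1 hτ1' ht hsmall
  · have := le_increment_distance_aux h0 h1 hxx hτ' hτ hτ1' hτ1 ht' hsmall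
    rw [abs_sub_comm x' x, abs_sub_comm y' y, abs_sub_comm y' x, abs_sub_comm x' y] at this
    linarith

lemma exists_four_mul_le_rpow {α : ℝ} (h1 : α < 1) :
    ∃ t > 0, ∀ h : ℝ, 0 ≤ h → h ≤ t → 4 * h ≤ h ^ α := by
  have hp : 0 < 1 - α := by linarith
  refine ⟨(1 / 4 : ℝ) ^ (1 / (1 - α)), by positivity, fun h h0 ht => ?_⟩
  rcases eq_or_lt_of_le h0 with rfl | hpos
  · simpa using rpow_nonneg le_rfl α
  have h2 : h ^ (1 - α) ≤ 1 / 4 := by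
    have := rpow_le_rpow h0 ht hp.le
    rwa [← rpow_mul (by norm_num), one_div_mul_cancel hp.ne', rpow_one] at this
  have h3 : h = h ^ (1 - α) * h ^ α := by
    rw [← rpow_add hpos, sub_add_cancel, rpow_one]
  have h4 := rpow_pos_of_pos hpos α
  nlinarith

lemma summable_exp_neg_mul_rpow {κ α : ℝ} (hκ : 0 < κ) (hα : 0 < α) :
    Summable fun n : ℕ => rexp (-κ * (n : ℝ) ^ α) := by
  refine summable_of_isBigO_nat (Real.summable_nat_rpow.2 (show (-2 : ℝ) < -1 by norm_num)) ?_
  have h1 := ((isLittleO_exp_neg_mul_rpow_atTop hκ (-2 / α)).comp_tendsto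
    (tendsto_rpow_atTop hα)).comp_tendsto tendsto_natCast_atTop_atTop
  refine h1.isBigO.congr_right fun n => ?_
  simp only [Function.comp]
  rw [← rpow_mul (Nat.cast_nonneg n), mul_div_cancel₀ _ hα.ne']

/-- Total weight, in the lattice of relative positions, of the pairs of grid points at
distance greater than `G`. -/
noncomputable def pairTail (κ α : ℝ) (G : ℕ) : ENNReal :=
  ∑' z : ℤ × ℤ, if (G : ℤ) < |z.1| ∨ (G : ℤ) < |z.2| then
    ENNReal.ofReal (rexp (-κ * (|(z.1 : ℝ)| ^ α + |(z.2 : ℝ)| ^ α))) else 0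

lemma tendsto_pairTail {κ α : ℝ} (hκ : 0 < κ) (hα : 0 < α) :
    Tendsto (pairTail κ α) atTop (nhds 0) := by
  let f : ℤ × ℤ → ENNReal := fun z =>
    ENNReal.ofReal (rexp (-κ * (|(z.1 : ℝ)| ^ α + |(z.2 : ℝ)| ^ α)))
  have hsum : Summable fun z : ℤ => rexp (-κ * |(z : ℝ)| ^ α) :=
    Summable.of_nat_of_neg (by simpa using summable_exp_neg_mul_rpow hκ hα)
      (by simpa using summable_exp_neg_mul_rpow hκ hα)
  have hf : ∑' z, f z ≠ ⊤ := by
    have e (z : ℤ × ℤ) : f z = ENNReal.ofReal (rexp (-κ * |(z.1 : ℝ)| ^ α)) *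
        ENNReal.ofReal (rexp (-κ * |(z.2 : ℝ)| ^ α)) := by
      rw [← ENNReal.ofReal_mul (Real.exp_pos _).le, ← Real.exp_add, ← mul_add]
    simp_rw [e]
    rw [ENNReal.tsum_prod (f := fun a b : ℤ => ENNReal.ofReal (rexp (-κ * |(a : ℝ)| ^ α)) *
      ENNReal.ofReal (rexp (-κ * |(b : ℝ)| ^ α)))]
    simp_rw [ENNReal.tsum_mul_left, ENNReal.tsum_mul_right]
    exact ENNReal.mul_ne_top hsum.tsum_ofReal_ne_top hsum.tsum_ofReal_ne_top
  let S : ℕ → Finset (ℤ × ℤ) := fun G => Finset.Icc (-(G : ℤ)) G ×ˢ Finset.Icc (-(G : ℤ)) G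
  have hS : Tendsto S atTop atTop := by
    refine tendsto_atTop_finset_of_monotone (fun G G' hG => ?_) fun z => ?_
    · exact Finset.product_subset_product (Finset.Icc_subset_Icc (by omega) (by omega))
        (Finset.Icc_subset_Icc (by omega) (by omega))
    · refine ⟨max z.1.natAbs z.2.natAbs, ?_⟩
      simp only [S, Finset.mem_product, Finset.mem_Icc]
      omega
  refine ((ENNReal.tendsto_tsum_compl_atTop_zero hf).comp hS).congr fun G => ?_
  simp only [Function.comp, pairTail]
  refine (tsum_subtype {z | z ∉ S G} f).trans (tsum_congr fun z => ?_)
  have : z ∈ {z | z ∉ S G} ↔ ((G : ℤ) < |z.1| ∨ (G : ℤ) < |z.2|) := by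
    simp only [S, mem_ofPred_eq, Finset.mem_product, Finset.mem_Icc, lt_abs]
    omega
  simp only [indicator, this, f]

lemma sum_measure_le_measure_biUnion_add {Ω ι : Type*} [MeasurableSpace Ω] [DecidableEq ι]
    {μ : Measure Ω} (S : Finset ι) {A : ι → Set Ω} (hA : ∀ i, MeasurableSet (A i)) :
    ∑ i ∈ S, μ (A i) ≤ μ (⋃ i ∈ S, A i) + ∑ i ∈ S, ∑ j ∈ S.erase i, μ (A i ∩ A j) := by
  let C : ι → Set Ω := fun i => A i \ ⋃ j ∈ S.erase i, A j
  have hC (i) : MeasurableSet (C i) :=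
    (hA i).diff (Finset.measurableSet_biUnion _ fun j _ => hA j)
  have hdisj : (S : Set ι).PairwiseDisjoint C := by
    intro i hi j hj hij
    refine disjoint_left.2 fun ω h1 h2 => h1.2 ?_
    exact mem_biUnion (Finset.mem_erase.2 ⟨hij.symm, hj⟩) h2.1
  have h1 (i) : μ (A i) ≤ μ (C i) + ∑ j ∈ S.erase i, μ (A i ∩ A j) := by
    calc μ (A i) ≤ μ (C i ∪ ⋃ j ∈ S.erase i, A i ∩ A j) := by
          refine measure_mono fun ω hω => ?_
          by_cases h : ω ∈ ⋃ j ∈ S.erase i, A j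
          · right
            simp only [mem_iUnion] at h ⊢
            obtain ⟨j, hj, hjω⟩ := h
            exact ⟨j, hj, hω, hjω⟩
          · exact Or.inl ⟨hω, h⟩
      _ ≤ _ := (measure_union_le _ _).trans (add_le_add_right (measure_biUnion_finset_le _ _) _)
  calc _ ≤ ∑ i ∈ S, (μ (C i) + ∑ j ∈ S.erase i, μ (A i ∩ A j)) :=
        Finset.sum_le_sum fun i _ => h1 i
    _ = μ (⋃ i ∈ S, C i) + ∑ i ∈ S, ∑ j ∈ S.erase i, μ (A i ∩ A j) := by
        rw [Finset.sum_add_distrib, measure_biUnion_finset hdisj fun i _ => hC i]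
    _ ≤ _ := by
        gcongr
        exact sdiff_subset

/-- Lattice coordinate of the left end of a grid point in a block. -/
def blockLeft (L : ℕ) {m : ℕ} (b : ℕ × ℕ) (p : Fin (m + 1) × Fin (m + 1)) : ℤ := b.1 * L + p.1

/-- Lattice coordinate, relative to one, of the right end of a grid point in a block. -/
def blockRight (L : ℕ) {m : ℕ} (b : ℕ × ℕ) (p : Fin (m + 1) × Fin (m + 1)) : ℤ :=
  (b.1 - b.2 - 1) * L + p.2

lemma lt_abs_mul_add {A c : ℤ} {m G : ℕ} (hA : A ≠ 0) (hc : |c| ≤ m) :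
    (G : ℤ) < |A * (m + 1 + G : ℕ) + c| := by
  have h1 : 1 ≤ |A| := Int.one_le_abs hA
  have h2 : |A * (m + 1 + G : ℕ)| ≤ |A * (m + 1 + G : ℕ) + c| + |c| := by
    simpa using abs_sub (A * (m + 1 + G : ℕ) + c) c
  rw [abs_mul, Nat.abs_cast] at h2
  push_cast at h2 ⊢
  nlinarith

lemma abs_fin_sub_le {m : ℕ} (r r' : Fin (m + 1)) : |(r' : ℤ) - r| ≤ m := by
  rw [abs_le]
  omega

lemma lt_abs_block_sub {m G : ℕ} {b b' : ℕ × ℕ} (h : b' ≠ b)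
    (p p' : Fin (m + 1) × Fin (m + 1)) :
    (G : ℤ) < |blockLeft (m + 1 + G) b' p' - blockLeft (m + 1 + G) b p| ∨
      (G : ℤ) < |blockRight (m + 1 + G) b' p' - blockRight (m + 1 + G) b p| := by
  by_cases h1 : b'.1 = b.1
  · right
    have h2 : b'.2 ≠ b.2 := fun h2 => h (Prod.ext h1 h2)
    have := lt_abs_mul_add (A := (b.2 : ℤ) - b'.2) (G := G)
      (by omega) (abs_fin_sub_le p.2 p'.2)
    simp only [blockRight, h1]
    convert this using 2
    ring
  · left
    have := lt_abs_mul_add (A := (b'.1 : ℤ) - b.1) (G := G)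
      (by omega) (abs_fin_sub_le p.1 p'.1)
    simp only [blockLeft]
    convert this using 2
    ring

lemma block_injective (m G : ℕ) :
    Function.Injective fun q : (ℕ × ℕ) × (Fin (m + 1) × Fin (m + 1)) =>
      (blockLeft (m + 1 + G) q.1 q.2, blockRight (m + 1 + G) q.1 q.2) := by
  rintro ⟨b, p⟩ ⟨b', p'⟩ h
  obtain ⟨h1, h2⟩ := Prod.ext_iff.1 h
  simp only at h1 h2
  have hb : b' = b := by
    by_contra hb
    have := lt_abs_block_sub (G := G) hb p p'
    rw [h1, h2] at this
    simp at this
    omega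
  subst hb
  simp only [blockLeft, blockRight, add_right_inj, Nat.cast_inj] at h1 h2
  exact Prod.ext rfl (Prod.ext (Fin.ext h1) (Fin.ext h2))

namespace IsRoughFBM

variable {Ω : Type*} [MeasurableSpace Ω] {μ : Measure Ω} [IsProbabilityMeasure μ]
  {H : ℝ} {B : ℝ → Ω → ℝ}

omit [IsProbabilityMeasure μ] in
lemma measurableSet_lt_increment (h : IsRoughFBM μ H B) (u x y : ℝ) :
    MeasurableSet {ω | u < B y ω - B x ω} :=
  measurableSet_lt measurable_const ((h.meas y).sub (h.meas x))

/-- Bonferroni bound for a family of well separated blocks of lattice increments. -/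
lemma sum_measure_block_le (h : IsRoughFBM μ H B) {a u t : ℝ} {m G Ns Nτ : ℕ} (ha : 0 < a)
    (hu : 0 < u) (ht : t ≤ 1 / 2) (hsmall : ∀ h, 0 ≤ h → h ≤ t → 4 * h ≤ h ^ (2*H))
    (hat : a * ((m + 1 + G) * (Nτ + 1)) ≤ t) :
    ∑ b ∈ Finset.range Ns ×ˢ Finset.range Nτ,
      μ {ω | ∃ p : Fin (m + 1) × Fin (m + 1),
        u < B (1 + a * blockRight (m + 1 + G) b p) ω - B (a * blockLeft (m + 1 + G) b p) ω} ≤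
    μ {ω | ∃ b ∈ Finset.range Ns ×ˢ Finset.range Nτ, ∃ p : Fin (m + 1) × Fin (m + 1),
        u < B (1 + a * blockRight (m + 1 + G) b p) ω - B (a * blockLeft (m + 1 + G) b p) ω} +
    (Ns * Nτ * (m + 1) ^ 2) * (ENNReal.ofReal (millsTerm u) *
      (pairTail (u ^ 2 * a ^ (2*H) / 16) (2*H) G +
        (Ns * Nτ * (m + 1) ^ 2) * ENNReal.ofReal (rexp (-(u ^ 2 / 8))))) := by
  classical
  set S := Finset.range Ns ×ˢ Finset.range Nτ with hS
  set L := m + 1 + G with hL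
  let E (b : ℕ × ℕ) (p : Fin (m + 1) × Fin (m + 1)) : Set Ω :=
    {ω | u < B (1 + a * blockRight L b p) ω - B (a * blockLeft L b p) ω}
  let A (b : ℕ × ℕ) : Set Ω := {ω | ∃ p, ω ∈ E b p}
  have hA' (b) : A b = ⋃ p, E b p := by ext; simp [A]
  have hE (b p) : MeasurableSet (E b p) := h.measurableSet_lt_increment _ _ _
  have hA (b) : MeasurableSet (A b) := by
    rw [hA']
    exact MeasurableSet.iUnion fun p => hE b p
  have hLR : (L : ℝ) = m + 1 + G := by simp [hL]
  have hα1 : 2 * H ≤ 1 := by linarith [h.lt_half]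
  have hx (b) (p : Fin (m + 1) × Fin (m + 1)) : 0 ≤ a * (blockLeft L b p : ℝ) := by
    simp only [blockLeft, Int.cast_add, Int.cast_mul, Int.cast_natCast]
    positivity
  have hfin (r : Fin (m + 1)) : ((r : ℕ) : ℝ) ≤ m := by exact_mod_cast Nat.lt_succ_iff.1 r.2
  have hdiff (b) (p : Fin (m + 1) × Fin (m + 1)) :
      1 + a * (blockRight L b p : ℝ) - a * blockLeft L b p =
      1 - a * ((b.2 + 1) * L + (p.1 : ℕ) - (p.2 : ℕ)) := by
    simp only [blockLeft, blockRight]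
    push_cast
    ring
  have hup (b) (p : Fin (m + 1) × Fin (m + 1)) :
      1 + a * (blockRight L b p : ℝ) - a * blockLeft L b p ≤ 1 := by
    rw [hdiff, sub_le_self_iff]
    refine mul_nonneg ha.le ?_
    have h1 := hfin p.2
    have h2 : (L : ℝ) ≤ (b.2 + 1) * L := le_mul_of_one_le_left (by positivity) (by simp)
    have h3 : (0 : ℝ) ≤ G := by positivity
    have h4 : (0 : ℝ) ≤ ((p.1 : ℕ) : ℝ) := by positivity
    linarith
  have hlow (b) (hb : b ∈ S) (p : Fin (m + 1) × Fin (m + 1)) :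
      1 - t ≤ 1 + a * (blockRight L b p : ℝ) - a * blockLeft L b p := by
    rw [hdiff]
    have hb2 : (b.2 : ℝ) + 1 ≤ Nτ := by
      have := (Finset.mem_range.1 (Finset.mem_product.1 hb).2)
      exact_mod_cast this
    have h1 := hfin p.1
    have h4 : (0 : ℝ) ≤ ((p.2 : ℕ) : ℝ) := by positivity
    have h5 : ((b.2 : ℝ) + 1) * L + (p.1 : ℕ) - (p.2 : ℕ) ≤ L * (Nτ + 1) := by
      have : ((b.2 : ℝ) + 1) * L ≤ Nτ * L := by gcongr
      have h3 : (0 : ℝ) ≤ G := by positivity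
      linarith
    have h6 := mul_le_mul_of_nonneg_left h5 ha.le
    rw [hLR] at h6 ⊢
    linarith
  set κ := u ^ 2 * a ^ (2*H) / 16 with hκ
  let g (z : ℤ × ℤ) : ENNReal := if (G : ℤ) < |z.1| ∨ (G : ℤ) < |z.2| then
    ENNReal.ofReal (rexp (-κ * (|(z.1 : ℝ)| ^ (2*H) + |(z.2 : ℝ)| ^ (2*H)))) else 0
  set e0 := ENNReal.ofReal (rexp (-(u ^ 2 / 8))) with he0
  have hpair (b) (hb : b ∈ S) (b') (hb' : b' ∈ S.erase b) (p p') :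
      μ (E b p ∩ E b' p') ≤ ENNReal.ofReal (millsTerm u) *
        (g (blockLeft L b' p' - blockLeft L b p, blockRight L b' p' - blockRight L b p) + e0) := by
    have hb'S := Finset.mem_of_mem_erase hb'
    have l1 := hlow b hb p
    have l2 := hlow b' hb'S p'
    have hD := le_increment_distance (α := 2*H) h.two_H_pos hα1 (by linarith) (by linarith)
      (hup b p) (hup b' p') l1 l2 hsmall
    have hm := h.measure_pair_le (hx b p) (y := 1 + a * blockRight L b p)
      (by linarith [hx b p]) (hx b' p') (y' := 1 + a * blockRight L b' p')
      (by linarith [hx b' p']) hu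
      (rpow_le_one (abs_nonneg _) (by rw [abs_le]; constructor <;> linarith [hup b p])
        h.two_H_pos.le)
      (rpow_le_one (abs_nonneg _) (by rw [abs_le]; constructor <;> linarith [hup b' p'])
        h.two_H_pos.le) (by positivity) hD
    refine hm.trans ?_
    rw [ENNReal.ofReal_mul (millsTerm_pos hu).le]
    refine mul_le_mul_right ?_ _
    simp only [g]
    rw [if_pos (lt_abs_block_sub (Finset.ne_of_mem_erase hb') p p'), he0,
      ← ENNReal.ofReal_add (Real.exp_pos _).le (Real.exp_pos _).le]
    refine ENNReal.ofReal_le_ofReal ?_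
    have hsc (v w : ℤ) : |a * (v : ℝ) - a * w| ^ (2*H) =
        a ^ (2*H) * |((w - v : ℤ) : ℝ)| ^ (2*H) := by
      rw [← mul_sub, abs_mul, abs_of_pos ha, mul_rpow ha.le (abs_nonneg _), abs_sub_comm]
      push_cast
      rfl
    rw [add_sub_add_left_eq_sub, hsc, hsc]
    rcases min_cases ((a ^ (2*H) * |((blockLeft L b' p' - blockLeft L b p : ℤ) : ℝ)| ^ (2*H) +
      a ^ (2*H) * |((blockRight L b' p' - blockRight L b p : ℤ) : ℝ)| ^ (2*H)) / 2) 1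
      with ⟨e, -⟩ | ⟨e, -⟩
    · rw [e]
      refine le_add_of_le_of_nonneg (Real.exp_le_exp.2 (le_of_eq ?_)) (Real.exp_pos _).le
      rw [hκ]
      ring
    · rw [e, mul_one]
      exact le_add_of_nonneg_left (Real.exp_pos _).le
  have hcardS : (S.card : ENNReal) = Ns * Nτ := by simp [hS]
  have hcardP : (Fintype.card (Fin (m + 1) × Fin (m + 1)) : ENNReal) = (m + 1) ^ 2 := by
    simp [pow_two]
  have hrow (b) (hb : b ∈ S) (p) :
      ∑ b' ∈ S.erase b, ∑ p', μ (E b p ∩ E b' p') ≤ ENNReal.ofReal (millsTerm u) *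
        (pairTail κ (2*H) G + (Ns * Nτ * (m + 1) ^ 2) * e0) := by
    calc ∑ b' ∈ S.erase b, ∑ p', μ (E b p ∩ E b' p')
        ≤ ∑ b' ∈ S.erase b, ∑ p', ENNReal.ofReal (millsTerm u) *
          (g (blockLeft L b' p' - blockLeft L b p, blockRight L b' p' - blockRight L b p) +
            e0) :=
          Finset.sum_le_sum fun b' hb' => Finset.sum_le_sum fun p' _ => hpair b hb b' hb' p p'
      _ ≤ ∑ b' ∈ S, ∑ p', ENNReal.ofReal (millsTerm u) *
          (g (blockLeft L b' p' - blockLeft L b p, blockRight L b' p' - blockRight L b p) +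
            e0) := Finset.sum_le_sum_of_subset (Finset.erase_subset _ _)
      _ = ENNReal.ofReal (millsTerm u) * (∑ q ∈ S ×ˢ Finset.univ,
          g (blockLeft L q.1 q.2 - blockLeft L b p, blockRight L q.1 q.2 - blockRight L b p) +
            (Ns * Nτ * (m + 1) ^ 2) * e0) := by
          simp_rw [← Finset.mul_sum, Finset.sum_add_distrib, Finset.sum_product,
            Finset.sum_const, Finset.card_univ, nsmul_eq_mul, hcardS, hcardP, mul_assoc]
          rfl
      _ ≤ _ := by
          refine mul_le_mul_right (add_le_add_left ?_ _) _
          refine (ENNReal.sum_le_tsum _).trans ?_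
          refine ENNReal.tsum_comp_le_tsum_of_injective (f := fun q : (ℕ × ℕ) × _ =>
            (blockLeft L q.1 q.2 - blockLeft L b p, blockRight L q.1 q.2 - blockRight L b p))
            (fun q q' hq => block_injective m G ?_) g
          obtain ⟨h1, h2⟩ := Prod.ext_iff.1 hq
          exact Prod.ext (sub_left_inj.1 h1) (sub_left_inj.1 h2)
  have hU : {ω | ∃ b ∈ S, ∃ p : Fin (m + 1) × Fin (m + 1),
        u < B (1 + a * blockRight L b p) ω - B (a * blockLeft L b p) ω} = ⋃ b ∈ S, A b := by
    ext ω
    simp [A, E]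
  rw [hU]
  refine (sum_measure_le_measure_biUnion_add S hA).trans (add_le_add_right ?_ _)
  calc ∑ b ∈ S, ∑ b' ∈ S.erase b, μ (A b ∩ A b')
      ≤ ∑ b ∈ S, ∑ p, ∑ b' ∈ S.erase b, ∑ p', μ (E b p ∩ E b' p') := by
        refine Finset.sum_le_sum fun b _ => ?_
        rw [Finset.sum_comm]
        refine Finset.sum_le_sum fun b' _ => ?_
        have : A b ∩ A b' ⊆ ⋃ p ∈ (Finset.univ : Finset (Fin (m + 1) × Fin (m + 1))),
            ⋃ p' ∈ (Finset.univ : Finset (Fin (m + 1) × Fin (m + 1))), E b p ∩ E b' p' := by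
          rintro ω ⟨⟨p, hp⟩, ⟨p', hp'⟩⟩
          simp only [mem_iUnion]
          exact ⟨p, Finset.mem_univ _, p', Finset.mem_univ _, hp, hp'⟩
        exact (measure_mono this).trans ((measure_biUnion_finset_le _ _).trans
          (Finset.sum_le_sum fun p _ => measure_biUnion_finset_le _ _))
    _ ≤ ∑ b ∈ S, ∑ p : Fin (m + 1) × Fin (m + 1), ENNReal.ofReal (millsTerm u) *
        (pairTail κ (2*H) G + (Ns * Nτ * (m + 1) ^ 2) * e0) :=
        Finset.sum_le_sum fun b hb => Finset.sum_le_sum fun p _ => hrow b hb p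
    _ = _ := by
        rw [Finset.sum_const, Finset.sum_const, Finset.card_univ, nsmul_eq_mul, nsmul_eq_mul,
          hcardS, hcardP, ← mul_assoc]

end IsRoughFBM

/-- Supremum of the increments of `B` of length at most one starting before time `T`. -/
noncomputable def incrementSup {Ω : Type*} (B : ℝ → Ω → ℝ) (T : ℝ) (ω : Ω) : ℝ :=
  ⨆ (τ : Icc (0:ℝ) 1) (s : Icc (0:ℝ) T), (B ((s:ℝ) + (τ:ℝ)) ω - B (s:ℝ) ω)

lemma exists_increment_le {Ω : Type*} {B : ℝ → Ω → ℝ} {ω : Ω} (hB : Continuous fun t => B t ω)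
    (T : ℝ) : ∃ C, ∀ s ∈ Icc 0 T, ∀ τ ∈ Icc (0:ℝ) 1, B (s + τ) ω - B s ω ≤ C := by
  obtain ⟨C, hC⟩ := (isCompact_Icc (a := (0:ℝ)) (b := T + 1)).exists_bound_of_continuousOn
    hB.continuousOn
  refine ⟨C + C, fun s hs τ hτ => ?_⟩
  have h1 := abs_le.1 (hC (s + τ) ⟨by linarith [hs.1, hτ.1], by linarith [hs.2, hτ.2]⟩)
  have h2 := abs_le.1 (hC s ⟨hs.1, by linarith [hs.2]⟩)
  linarith

lemma le_incrementSup {Ω : Type*} {B : ℝ → Ω → ℝ} {ω : Ω} (hB : Continuous fun t => B t ω)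
    {T s τ : ℝ} (hs : s ∈ Icc 0 T) (hτ : τ ∈ Icc (0:ℝ) 1) :
    B (s + τ) ω - B s ω ≤ incrementSup B T ω := by
  obtain ⟨C, hC⟩ := exists_increment_le hB T
  have : Nonempty (Icc (0:ℝ) T) := ⟨⟨s, hs⟩⟩
  refine le_trans ?_ (le_ciSup (f := fun τ : Icc (0:ℝ) 1 => ⨆ s : Icc (0:ℝ) T,
    (B ((s:ℝ) + (τ:ℝ)) ω - B (s:ℝ) ω)) ⟨C, ?_⟩ ⟨τ, hτ⟩)
  · refine le_ciSup (f := fun s : Icc (0:ℝ) T => B ((s:ℝ) + τ) ω - B (s:ℝ) ω) ⟨C, ?_⟩ ⟨s, hs⟩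
    rintro _ ⟨s, rfl⟩
    exact hC s s.2 τ hτ
  · rintro _ ⟨τ, rfl⟩
    exact ciSup_le fun s => hC s s.2 τ τ.2

lemma exp_sub_exp_le_sum {H w : ℝ} (N : ℕ) :
    rexp (-(H * w)) - rexp (-(H * (w * (N + 1)))) ≤
      H * w * ∑ j ∈ Finset.range N, rexp (-(H * (w * (j + 1)))) := by
  have h1 := Finset.sum_range_sub' (fun j : ℕ => rexp (-(H * (w * (j + 1))))) N
  simp only [Nat.cast_zero, zero_add, mul_one] at h1
  rw [← h1, Finset.mul_sum]
  refine Finset.sum_le_sum fun j _ => ?_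
  have h2 : rexp (-(H * (w * ((j + 1 : ℕ) + 1)))) =
      rexp (-(H * (w * (j + 1)))) * rexp (-(H * w)) := by
    rw [← Real.exp_add]
    push_cast
    ring_nf
  rw [h2]
  nlinarith [Real.add_one_le_exp (-(H * w)), Real.exp_pos (-(H * (w * ((j : ℝ) + 1))))]

lemma block_sum_assembly {a u T K c H d e Q L M : ℝ} (ha : 0 < a) (hu : 0 < u) (hT : 0 < T)
    (hH : 0 < H) (hc : 0 ≤ c) (hd : 0 ≤ d) (he : 0 ≤ e) (hL : 0 < L) (hM : 0 ≤ M)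
    (hwK : u ^ 2 * L * a ≤ K)
    (hQ : ⌊T / (L * a)⌋₊ * (c * ∑ j ∈ Finset.range ⌊K / (u ^ 2 * L * a)⌋₊,
        rexp (-(H * (u ^ 2 * L * a * (j + 1))))) ≤
      Q + ⌊T / (L * a)⌋₊ * ⌊K / (u ^ 2 * L * a)⌋₊ * M *
        (d + ⌊T / (L * a)⌋₊ * ⌊K / (u ^ 2 * L * a)⌋₊ * M * e)) :
    1 / L ^ 2 * (c * (T - L * a) * ((rexp (-(H * (u ^ 2 * L * a))) - rexp (-(H * K))) / H) -
      T * K * M * (d + T * K * M / L ^ 2 * (e / (a ^ 2 * u ^ 2)))) ≤ a ^ 2 * u ^ 2 * Q := by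
  set w := u ^ 2 * L * a with hw
  have hw0 : 0 < w := by positivity
  have hK : 0 < K := by linarith
  set Ns : ℝ := (⌊T / (L * a)⌋₊ : ℝ) with hNs
  set Nτ : ℝ := (⌊K / w⌋₊ : ℝ) with hNτ
  set s := ∑ j ∈ Finset.range ⌊K / w⌋₊, rexp (-(H * (w * (j + 1)))) with hs
  have hLa : 0 < L * a := by positivity
  have n1 : Ns * (L * a) ≤ T := (le_div_iff₀ hLa).1 (Nat.floor_le (by positivity))
  have n2 : T - L * a ≤ Ns * (L * a) := by
    have := (div_lt_iff₀ hLa).1 (Nat.lt_floor_add_one (T / (L * a)))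
    linarith
  have n3 : Nτ * w ≤ K := (le_div_iff₀ hw0).1 (Nat.floor_le (by positivity))
  have n4 : K ≤ w * (Nτ + 1) := by
    have := (div_lt_iff₀ hw0).1 (Nat.lt_floor_add_one (K / w))
    linarith
  have hNs0 : 0 ≤ Ns := Nat.cast_nonneg _
  have hNτ0 : 0 ≤ Nτ := Nat.cast_nonneg _
  have hs1 : (rexp (-(H * w)) - rexp (-(H * K))) / H ≤ w * s := by
    rw [div_le_iff₀ hH]
    have h1 := exp_sub_exp_le_sum (H := H) (w := w) ⌊K / w⌋₊
    have h2 : rexp (-(H * (w * (Nτ + 1)))) ≤ rexp (-(H * K)) :=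
      Real.exp_le_exp.2 (neg_le_neg (mul_le_mul_of_nonneg_left n4 hH.le))
    linarith
  have hs0 : 0 ≤ (rexp (-(H * w)) - rexp (-(H * K))) / H :=
    div_nonneg (sub_nonneg.2 (Real.exp_le_exp.2
      (neg_le_neg (mul_le_mul_of_nonneg_left hwK hH.le)))) hH.le
  have hA : 0 < a ^ 2 * u ^ 2 := by positivity
  have hNN : (Ns * (L * a)) * (Nτ * w) ≤ T * K := mul_le_mul n1 n3 (by positivity) hT.le
  have e1 : a ^ 2 * u ^ 2 * (Ns * Nτ) = 1 / L ^ 2 * ((Ns * (L * a)) * (Nτ * w)) := by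
    rw [hw]
    field_simp
  have e2 : a ^ 2 * u ^ 2 * (Ns * (c * s)) = 1 / L ^ 2 * (c * (Ns * (L * a)) * (w * s)) := by
    rw [hw]
    field_simp
  have hNN' : Ns * Nτ ≤ T * K / L ^ 2 / (a ^ 2 * u ^ 2) := by
    rw [le_div_iff₀ hA, mul_comm, e1, one_div_mul_eq_div]
    gcongr
  have hmain : 1 / L ^ 2 * (c * (T - L * a) * ((rexp (-(H * w)) - rexp (-(H * K))) / H)) ≤
      a ^ 2 * u ^ 2 * (Ns * (c * s)) := by
    rw [e2]
    gcongr
  have herr : a ^ 2 * u ^ 2 * (Ns * Nτ * M * (d + Ns * Nτ * M * e)) ≤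
      1 / L ^ 2 * (T * K * M * (d + T * K * M / L ^ 2 * (e / (a ^ 2 * u ^ 2)))) := by
    calc a ^ 2 * u ^ 2 * (Ns * Nτ * M * (d + Ns * Nτ * M * e))
        = 1 / L ^ 2 * ((Ns * (L * a)) * (Nτ * w) * M * (d + Ns * Nτ * M * e)) := by
          rw [← mul_assoc, ← mul_assoc, e1]
          ring
      _ ≤ 1 / L ^ 2 * (T * K * M * (d + T * K / L ^ 2 / (a ^ 2 * u ^ 2) * M * e)) := by
          gcongr
      _ = _ := by
          field_simp
  have := mul_le_mul_of_nonneg_left hQ hA.le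
  rw [mul_add] at this
  rw [mul_sub]
  linarith

lemma pickandsScale_sq {H u : ℝ} (hu : 0 < u) :
    pickandsScale H u ^ 2 * u ^ 2 * u ^ (2 / H - 2) = (2:ℝ) ^ (1 / H) := by
  have h1 : pickandsScale H u ^ 2 = 2 ^ (1 / H) * (u ^ (2 / H))⁻¹ := by
    have e1 : 1 / (2 * H) * ((2 : ℕ) : ℝ) = 1 / H := by
      push_cast
      field_simp
    have e2 : ((2 : ℕ) : ℝ) * (1 / H) = 2 / H := by
      push_cast
      ring
    rw [pickandsScale, ← rpow_natCast, ← rpow_mul (by positivity), div_rpow (by norm_num)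
      (by positivity), e1, ← rpow_natCast u 2, ← rpow_mul hu.le, e2, div_eq_mul_inv]
  have h2 : u ^ 2 * u ^ (2 / H - 2) = u ^ (2 / H) := by
    rw [← rpow_natCast, ← rpow_add hu]
    congr 1
    push_cast
    ring
  rw [mul_assoc, h2, h1, mul_assoc, inv_mul_cancel₀ (by positivity), mul_one]

namespace IsRoughFBM

variable {Ω : Type*} [MeasurableSpace Ω] {μ : Measure Ω} [IsProbabilityMeasure μ]
  {H : ℝ} {B : ℝ → Ω → ℝ}

omit [IsProbabilityMeasure μ] in
lemma blocks_le_measure_incrementSup (h : IsRoughFBM μ H B) {a u T : ℝ} {m G Nτ : ℕ}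
    (ha : 0 < a) (hT : 0 < T) (hat : a * ((m + 1 + G) * (Nτ + 1)) ≤ 1) :
    μ {ω | ∃ b ∈ Finset.range ⌊T / ((m + 1 + G : ℕ) * a)⌋₊ ×ˢ Finset.range Nτ,
      ∃ p : Fin (m + 1) × Fin (m + 1),
        u < B (1 + a * blockRight (m + 1 + G) b p) ω - B (a * blockLeft (m + 1 + G) b p) ω} ≤
    μ {ω | u < incrementSup B T ω} := by
  refine measure_mono_ae ?_
  filter_upwards [h.cont] with ω hω
  rintro ⟨b, hb, p, hp⟩
  refine lt_of_lt_of_le hp ?_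
  set L := m + 1 + G with hL
  have hLR : (L : ℝ) = m + 1 + G := by simp [hL]
  rw [Finset.mem_product, Finset.mem_range, Finset.mem_range] at hb
  have hb1 : (b.1 : ℝ) + 1 ≤ ⌊T / (L * a)⌋₊ := by exact_mod_cast hb.1
  have hb2 : (b.2 : ℝ) + 1 ≤ Nτ := by exact_mod_cast hb.2
  have hp1 : ((p.1 : ℕ) : ℝ) ≤ m := by exact_mod_cast Nat.lt_succ_iff.1 p.1.2
  have hp2 : ((p.2 : ℕ) : ℝ) ≤ m := by exact_mod_cast Nat.lt_succ_iff.1 p.2.2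
  have hp1' : (0 : ℝ) ≤ ((p.1 : ℕ) : ℝ) := by positivity
  have hp2' : (0 : ℝ) ≤ ((p.2 : ℕ) : ℝ) := by positivity
  have hG : (0 : ℝ) ≤ G := by positivity
  have hLa : 0 < (L : ℝ) * a := by positivity
  have n1 : (⌊T / (L * a)⌋₊ : ℝ) * (L * a) ≤ T :=
    (le_div_iff₀ hLa).1 (Nat.floor_le (by positivity))
  have hx : a * (blockLeft L b p : ℝ) ∈ Icc 0 T := by
    simp only [blockLeft]
    push_cast
    refine ⟨by positivity, le_trans ?_ n1⟩
    calc a * ((b.1 : ℝ) * L + (p.1 : ℕ)) ≤ a * ((b.1 : ℝ) * L + L) :=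
          mul_le_mul_of_nonneg_left (by linarith) ha.le
      _ = ((b.1 : ℝ) + 1) * (L * a) := by ring
      _ ≤ _ := by gcongr
  have hτ : 1 + a * (blockRight L b p : ℝ) - a * blockLeft L b p ∈ Icc (0:ℝ) 1 := by
    have e : 1 + a * (blockRight L b p : ℝ) - a * blockLeft L b p =
        1 - a * ((b.2 + 1) * L + (p.1 : ℕ) - (p.2 : ℕ)) := by
      simp only [blockLeft, blockRight]
      push_cast
      ring
    rw [e]
    have h2 : (L : ℝ) ≤ (b.2 + 1) * L := le_mul_of_one_le_left (by positivity) (by simp)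
    have h3 : ((b.2 : ℝ) + 1) * L + (p.1 : ℕ) - (p.2 : ℕ) ≤ L * (Nτ + 1) := by
      have : ((b.2 : ℝ) + 1) * L ≤ Nτ * L := by gcongr
      linarith
    have h4 := mul_le_mul_of_nonneg_left h3 ha.le
    rw [hLR] at h4
    constructor
    · rw [hLR]
      linarith
    · rw [sub_le_self_iff]
      exact mul_nonneg ha.le (by linarith)
  have := le_incrementSup hω hx hτ
  rwa [add_sub_cancel] at this

/-- Lower bound for the tail of the supremum of increments, obtained from the block events at a
fixed level. -/
lemma eventually_block_sum_le (h : IsRoughFBM μ H B) {n k G : ℕ} {c d K T : ℝ} (hc0 : 0 ≤ c)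
    (hc : ENNReal.ofReal c < gridConst μ H B n k ^ 2) (hK : 0 < K) (hT : 0 < T) (hd0 : 0 ≤ d)
    (hd : pairTail ((1 / 2 ^ n : ℝ) ^ (2*H) / 8) (2*H) G ≤ ENNReal.ofReal d) :
    ∀ᶠ u in atTop,
      1 / (k * 2 ^ n + 1 + G : ℕ) ^ 2 *
        (c * (T - (k * 2 ^ n + 1 + G : ℕ) * (pickandsScale H u / 2 ^ n)) *
          ((rexp (-(H * (u ^ 2 * (k * 2 ^ n + 1 + G : ℕ) * (pickandsScale H u / 2 ^ n)))) -
            rexp (-(H * K))) / H) -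
        T * K * (k * 2 ^ n + 1) ^ 2 * (d + T * K * (k * 2 ^ n + 1) ^ 2 /
          (k * 2 ^ n + 1 + G : ℕ) ^ 2 *
            (rexp (-(u ^ 2 / 8)) / ((pickandsScale H u / 2 ^ n) ^ 2 * u ^ 2)))) ≤
      (pickandsScale H u / 2 ^ n) ^ 2 * u ^ 2 *
        ((μ {ω | u < incrementSup B T ω}).toReal / millsTerm u) := by
  obtain ⟨t, ht0, hsmall⟩ := exists_four_mul_le_rpow (α := 2*H) (by linarith [h.lt_half])
  obtain ⟨U, hU⟩ := h.exists_block_lower_bound hc K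
  set m := k * 2 ^ n with hm
  set L := m + 1 + G with hL
  have hLR : (L : ℝ) = m + 1 + G := by simp [hL]
  have hmR : (m : ℝ) = k * 2 ^ n := by simp [hm]
  have hL0 : (0 : ℝ) < L := by rw [hLR]; positivity
  have t1 : Tendsto (fun u => u ^ 2 * L * (pickandsScale H u / 2 ^ n)) atTop (nhds 0) := by
    have := (tendsto_sq_mul_pickandsScale h.pos h.lt_half).mul_const ((L : ℝ) / 2 ^ n)
    rw [zero_mul] at this
    refine this.congr fun u => by ring
  have t2 : Tendsto (fun u => L * (pickandsScale H u / 2 ^ n)) atTop (nhds 0) := by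
    have := (tendsto_pickandsScale h.pos h.lt_half).mul_const ((L : ℝ) / 2 ^ n)
    rw [zero_mul] at this
    refine this.congr fun u => by ring
  have t3 : Tendsto (fun u : ℝ => K / u ^ 2) atTop (nhds 0) :=
    tendsto_const_nhds.div_atTop (tendsto_pow_atTop two_ne_zero)
  have ht2 : 0 < min t (1 / 2) / 2 := by positivity
  filter_upwards [eventually_ge_atTop U, eventually_gt_atTop 0, t1.eventually_le_const hK,
    t2.eventually_le_const ht2, t3.eventually_le_const ht2] with u hu hu0 hwK hLa hKu
  set a := pickandsScale H u / 2 ^ n with ha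
  have ha0 : 0 < a := div_pos (pickandsScale_pos hu0) (by positivity)
  set w := u ^ 2 * L * a with hw
  have hw0 : 0 < w := by positivity
  set Nτ := ⌊K / w⌋₊ with hNτ
  set Ns := ⌊T / (L * a)⌋₊ with hNs
  have n3 : Nτ * w ≤ K := (le_div_iff₀ hw0).1 (Nat.floor_le (by positivity))
  have hat : a * ((m + 1 + G) * (Nτ + 1)) ≤ min t (1 / 2) := by
    have e : (Nτ : ℝ) * (L * a) ≤ K / u ^ 2 := by
      rw [le_div_iff₀ (by positivity)]
      refine le_trans (le_of_eq ?_) n3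
      rw [hw]
      ring
    rw [← hLR]
    linarith
  have hκ : u ^ 2 * a ^ (2*H) / 16 = (1 / 2 ^ n : ℝ) ^ (2*H) / 8 := by
    rw [ha, div_eq_mul_one_div (pickandsScale H u),
      mul_rpow (pickandsScale_nonneg H u) (by positivity), ← mul_assoc,
      sq_mul_pickandsScale_rpow h.pos hu0]
    ring
  have hsum := h.sum_measure_block_le (a := a) (u := u) (t := min t (1 / 2)) (m := m) (G := G)
    (Ns := Ns) (Nτ := Nτ) ha0 hu0 (min_le_right _ _)
    (fun x hx hx' => hsmall x hx (hx'.trans (min_le_left _ _))) hat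
  rw [hκ] at hsum
  have hM := millsTerm_pos hu0
  refine block_sum_assembly ha0 hu0 hT h.pos hc0 hd0 (Real.exp_pos _).le hL0 (by positivity)
    hwK ?_
  have hblock (b : ℕ × ℕ) (hb : b ∈ Finset.range Ns ×ˢ Finset.range Nτ) :
      ENNReal.ofReal (millsTerm u * (c * rexp (-(H * (w * (b.2 + 1)))))) ≤
      μ {ω | ∃ p : Fin (m + 1) × Fin (m + 1),
        u < B (1 + a * blockRight L b p) ω - B (a * blockLeft L b p) ω} := by
    have hb2 : (b.2 : ℝ) + 1 ≤ Nτ := by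
      exact_mod_cast Finset.mem_range.1 (Finset.mem_product.1 hb).2
    have e1 : u ^ 2 * (1 - (1 - (b.2 + 1) * (L * a))) = w * (b.2 + 1) := by
      rw [hw]
      ring
    have h1 := hU u hu (1 - (b.2 + 1) * (L * a)) (b.1 * (L * a)) (by positivity)
      (by rw [sub_le_self_iff]; positivity)
      (by
        rw [e1]
        nlinarith)
    rw [e1] at h1
    have e2 : {ω | ∃ i : Fin (m + 1) × Fin (m + 1),
        u < B (b.1 * (L * a) + (1 - (b.2 + 1) * (L * a)) +
          pickandsScale H u * (i.2 / 2 ^ n)) ω -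
          B (b.1 * (L * a) + pickandsScale H u * (i.1 / 2 ^ n)) ω} =
        {ω | ∃ p : Fin (m + 1) × Fin (m + 1),
        u < B (1 + a * blockRight L b p) ω - B (a * blockLeft L b p) ω} := by
      ext ω
      refine exists_congr fun p => ?_
      have x1 : (b.1 : ℝ) * (L * a) + (1 - (b.2 + 1) * (L * a)) +
          pickandsScale H u * (p.2 / 2 ^ n) = 1 + a * blockRight L b p := by
        simp only [blockRight, ha]
        push_cast
        ring
      have x2 : (b.1 : ℝ) * (L * a) + pickandsScale H u * (p.1 / 2 ^ n) =
          a * blockLeft L b p := by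
        simp only [blockLeft, ha]
        push_cast
        ring
      rw [x1, x2]
    rw [e2] at h1
    have e3 : millsTerm u * (c * rexp (-(H * (w * (b.2 + 1))))) =
        (u * √(2 * π) * rexp (u ^ 2 / 2 + H * (w * (b.2 + 1))))⁻¹ * c := by
      rw [millsTerm, Real.exp_add, Real.exp_neg, neg_div, Real.exp_neg]
      field_simp
    have hpos : 0 < u * √(2 * π) * rexp (u ^ 2 / 2 + H * (w * (b.2 + 1))) := by positivity
    rw [e3, ENNReal.ofReal_mul (by positivity)]
    refine (mul_le_mul_right h1 _).trans ?_
    rw [← mul_assoc, ← ENNReal.ofReal_mul (by positivity), inv_mul_cancel₀ hpos.ne',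
      ENNReal.ofReal_one, one_mul]
  have hup := h.blocks_le_measure_incrementSup (u := u) (T := T) (m := m) (G := G) (Nτ := Nτ)
    ha0 hT (hat.trans ((min_le_right _ _).trans (by norm_num)))
  have htot := (Finset.sum_le_sum hblock).trans (hsum.trans (add_le_add_left hup _))
  have htot2 : ENNReal.ofReal (∑ b ∈ Finset.range Ns ×ˢ Finset.range Nτ,
      millsTerm u * (c * rexp (-(H * (w * (b.2 + 1)))))) ≤
      ENNReal.ofReal ((μ {ω | u < incrementSup B T ω}).toReal + (Ns * Nτ * (m + 1) ^ 2) *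
        (millsTerm u * (d + (Ns * Nτ * (m + 1) ^ 2) * rexp (-(u ^ 2 / 8))))) := by
    rw [ENNReal.ofReal_sum_of_nonneg fun b _ => by positivity]
    refine htot.trans ?_
    have eN : ENNReal.ofReal ((Ns : ℝ) * Nτ * (m + 1) ^ 2) = Ns * Nτ * (m + 1) ^ 2 := by
      rw [ENNReal.ofReal_mul (by positivity), ENNReal.ofReal_mul (by positivity),
        ENNReal.ofReal_pow (by positivity), ENNReal.ofReal_add (by positivity) zero_le_one,
        ENNReal.ofReal_natCast, ENNReal.ofReal_natCast, ENNReal.ofReal_natCast,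
        ENNReal.ofReal_one]
    rw [ENNReal.ofReal_add ENNReal.toReal_nonneg (by positivity),
      ENNReal.ofReal_toReal (measure_ne_top _ _), ENNReal.ofReal_mul (by positivity), eN,
      ENNReal.ofReal_mul hM.le, ENNReal.ofReal_add hd0 (by positivity),
      ENNReal.ofReal_mul (by positivity), eN]
    gcongr
  rw [ENNReal.ofReal_le_ofReal_iff (by positivity), Finset.sum_product] at htot2
  simp only [Finset.sum_const, Finset.card_range, nsmul_eq_mul, ← Finset.mul_sum] at htot2
  have e5 : (k : ℝ) * 2 ^ n + 1 = m + 1 := by rw [hmR]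
  rw [e5]
  rw [div_add' _ _ _ hM.ne', le_div_iff₀ hM]
  linarith

end IsRoughFBM

lemma tendsto_exp_neg_sq_div_pickandsScale (H : ℝ) (n : ℕ) :
    Tendsto (fun u => rexp (-(u ^ 2 / 8)) / ((pickandsScale H u / 2 ^ n) ^ 2 * u ^ 2)) atTop
      (nhds 0) := by
  have h1 := (rpow_mul_exp_neg_mul_sq_isLittleO_exp_neg (show (0:ℝ) < 1 / 8 by norm_num)
    (2 / H - 2)).trans_tendsto
    (tendsto_exp_atBot.comp (tendsto_id.const_mul_atTop_of_neg (show -(1 / 2 : ℝ) < 0 by norm_num)))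
  have h2 := h1.mul_const ((2 ^ n) ^ 2 / (2:ℝ) ^ (1 / H))
  rw [zero_mul] at h2
  refine h2.congr' ?_
  filter_upwards [eventually_gt_atTop 0] with u hu
  have := pickandsScale_pos (H := H) hu
  rw [← pickandsScale_sq hu, div_pow]
  have : 0 < u ^ (2 / H - 2) := by positivity
  field_simp

namespace IsRoughFBM

variable {Ω : Type*} [MeasurableSpace Ω] {μ : Measure Ω} [IsProbabilityMeasure μ]
  {H : ℝ} {B : ℝ → Ω → ℝ}

lemma eventually_le_measure_incrementSup_div (h : IsRoughFBM μ H B) {n k G : ℕ} {c d K T ℓ : ℝ}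
    (hc0 : 0 ≤ c) (hc : ENNReal.ofReal c < gridConst μ H B n k ^ 2) (hK : 0 < K) (hT : 0 < T)
    (hd0 : 0 ≤ d) (hd : pairTail ((1 / 2 ^ n : ℝ) ^ (2*H) / 8) (2*H) G ≤ ENNReal.ofReal d)
    (hℓ : ℓ < (1 / 2 : ℝ) ^ (1 / H) * ((2 ^ n) ^ 2 * (1 / (k * 2 ^ n + 1 + G : ℕ) ^ 2 *
      (c * T * ((1 - rexp (-(H * K))) / H) - T * K * (k * 2 ^ n + 1) ^ 2 * d)))) :
    ∀ᶠ u in atTop, ℓ ≤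
      (μ {ω | u < incrementSup B T ω}).toReal / (u ^ (2 / H - 2) * stdNormalTail u) := by
  have t1 : Tendsto (fun u => u ^ 2 * (k * 2 ^ n + 1 + G : ℕ) * (pickandsScale H u / 2 ^ n))
      atTop (nhds 0) := by
    have := (tendsto_sq_mul_pickandsScale h.pos h.lt_half).mul_const
      (((k * 2 ^ n + 1 + G : ℕ) : ℝ) / 2 ^ n)
    rw [zero_mul] at this
    refine this.congr fun u => by ring
  have t2 : Tendsto (fun u => (k * 2 ^ n + 1 + G : ℕ) * (pickandsScale H u / 2 ^ n))
      atTop (nhds 0) := by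
    have := (tendsto_pickandsScale h.pos h.lt_half).mul_const
      (((k * 2 ^ n + 1 + G : ℕ) : ℝ) / 2 ^ n)
    rw [zero_mul] at this
    refine this.congr fun u => by ring
  have hlim := ((((tendsto_const_nhds (x := T)).sub t2).const_mul c).mul
    (((((Real.continuous_exp.tendsto _).comp (t1.const_mul H).neg).sub
      (tendsto_const_nhds (x := rexp (-(H * K))))).div_const H))).sub
    (((tendsto_const_nhds (x := d)).add ((tendsto_exp_neg_sq_div_pickandsScale H n).const_mul
      (T * K * (k * 2 ^ n + 1) ^ 2 / (k * 2 ^ n + 1 + G : ℕ) ^ 2))).const_mul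
        (T * K * (k * 2 ^ n + 1) ^ 2))
  have hlim2 := ((hlim.const_mul (1 / (k * 2 ^ n + 1 + G : ℕ) ^ 2 : ℝ)).const_mul
    ((2 ^ n : ℝ) ^ 2)).const_mul ((1 / 2 : ℝ) ^ (1 / H))
  simp only [mul_zero, neg_zero, Real.exp_zero, sub_zero, add_zero] at hlim2
  filter_upwards [hlim2.eventually_const_lt hℓ, eventually_gt_atTop 0, eventually_ge_atTop 1,
    h.eventually_block_sum_le hc0 hc hK hT hd0 hd] with u h1 hu hu1 h2
  refine h1.le.trans ?_
  have hM := millsTerm_pos hu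
  have hP : 0 < (2:ℝ) ^ (1 / H) := by positivity
  have hpu : 0 < u ^ (2 / H - 2) := by positivity
  have hΨ : 0 < stdNormalTail u := lt_of_lt_of_le (by positivity) (le_stdNormalTail hu1)
  calc _ ≤ (1 / 2 : ℝ) ^ (1 / H) * ((2 ^ n) ^ 2 * ((pickandsScale H u / 2 ^ n) ^ 2 * u ^ 2 *
        ((μ {ω | u < incrementSup B T ω}).toReal / millsTerm u))) := by
        refine mul_le_mul_of_nonneg_left (mul_le_mul_of_nonneg_left h2 (by positivity))
          (by positivity)
    _ = (μ {ω | u < incrementSup B T ω}).toReal / (u ^ (2 / H - 2) * millsTerm u) := by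
        have hq := pickandsScale_pos (H := H) hu
        rw [div_rpow zero_le_one zero_le_two, one_rpow, ← pickandsScale_sq hu, div_pow]
        field_simp
    _ ≤ _ := by
        gcongr
        exact stdNormalTail_le hu

/-- Every value below the claimed constant is eventually a lower bound for the ratio. -/
lemma eventually_lt_measure_incrementSup_div (h : IsRoughFBM μ H B) {HH T ℓ : ℝ} (hHH : 0 < HH)
    (hP : HasPickandsConstant μ H B HH) (hT : 0 < T)
    (hℓ : ℓ < (T / H) * (1 / 2 : ℝ) ^ (1 / H) * HH ^ 2) :
    ∀ᶠ u in atTop, ℓ ≤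
      (μ {ω | u < incrementSup B T ω}).toReal / (u ^ (2 / H - 2) * stdNormalTail u) := by
  have hH := h.pos
  have t1 : Tendsto (fun ε : ℝ => (1 / 2 : ℝ) ^ (1 / H) * ((HH - 2 * ε) ^ 2 * T *
      ((1 - rexp (-(H * ε⁻¹))) / H))) (nhdsWithin 0 (Ioi 0))
      (nhds ((1 / 2 : ℝ) ^ (1 / H) * ((HH - 2 * 0) ^ 2 * T * ((1 - 0) / H)))) := by
    have e1 : Tendsto (fun ε : ℝ => ε) (nhdsWithin 0 (Ioi 0)) (nhds 0) :=
      tendsto_id.mono_left nhdsWithin_le_nhds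
    have e2 : Tendsto (fun ε : ℝ => rexp (-(H * ε⁻¹))) (nhdsWithin 0 (Ioi 0)) (nhds 0) :=
      tendsto_exp_neg_atTop_nhds_zero.comp (tendsto_inv_nhdsGT_zero.const_mul_atTop hH)
    exact (((((e1.const_mul 2).const_sub HH).pow 2).mul_const T).mul
      ((e2.const_sub 1).div_const H)).const_mul _
  have e0 : (1 / 2 : ℝ) ^ (1 / H) * ((HH - 2 * 0) ^ 2 * T * ((1 - 0) / H)) =
      (T / H) * (1 / 2 : ℝ) ^ (1 / H) * HH ^ 2 := by ring
  rw [e0] at t1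
  have hsmall : ∀ᶠ ε : ℝ in nhdsWithin 0 (Ioi 0), ε < HH / 2 :=
    nhdsWithin_le_nhds (Iio_mem_nhds (by positivity))
  obtain ⟨ε, hε1, hε2, hε0⟩ := ((t1.eventually_const_lt hℓ).and (hsmall.and
    self_mem_nhdsWithin)).exists
  set X := (1 - rexp (-(H * ε⁻¹))) / H with hX
  obtain ⟨n, hn⟩ := h.exists_le_gridConst hHH hP hε0
  have t2 : Tendsto (fun d : ℝ => (1 / 2 : ℝ) ^ (1 / H) * ((HH - 2 * ε) ^ 2 * T * X -
      T * ε⁻¹ * (2 ^ n) ^ 2 * d)) (nhdsWithin 0 (Ioi 0))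
      (nhds ((1 / 2 : ℝ) ^ (1 / H) * ((HH - 2 * ε) ^ 2 * T * X -
      T * ε⁻¹ * (2 ^ n) ^ 2 * 0))) := by
    refine Tendsto.mono_left ?_ nhdsWithin_le_nhds
    exact Continuous.tendsto (by fun_prop) 0
  rw [mul_zero, sub_zero] at t2
  obtain ⟨d, hd1, hd0⟩ := ((t2.eventually_const_lt hε1).and self_mem_nhdsWithin).exists
  obtain ⟨G, hG⟩ := ((tendsto_pairTail (κ := (1 / 2 ^ n : ℝ) ^ (2*H) / 8) (by positivity)
    h.two_H_pos).eventually_le_const (ENNReal.ofReal_pos.2 hd0)).exists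
  have r1 : Tendsto (fun k : ℕ => (k : ℝ) / (k * 2 ^ n + 1 + G)) atTop (nhds (1 / 2 ^ n)) := by
    have : Tendsto (fun k : ℕ => 1 / (2 ^ n + (1 + G) * (k : ℝ)⁻¹)) atTop
        (nhds (1 / (2 ^ n + (1 + G) * 0))) :=
      tendsto_const_nhds.div (tendsto_const_nhds.add
        (tendsto_inv_atTop_nhds_zero_nat.const_mul _)) (by simp)
    rw [mul_zero, add_zero] at this
    refine this.congr' ?_
    filter_upwards [eventually_gt_atTop 0] with k hk
    have : (0 : ℝ) < k := by exact_mod_cast hk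
    field_simp
    ring
  have r2 : Tendsto (fun k : ℕ => ((k : ℝ) * 2 ^ n + 1) / (k * 2 ^ n + 1 + G)) atTop
      (nhds 1) := by
    have : Tendsto (fun k : ℕ => 1 - G * (1 / ((k * 2 ^ n + G : ℕ) + 1 : ℝ))) atTop
        (nhds (1 - G * 0)) := by
      refine ((tendsto_one_div_add_atTop_nhds_zero_nat.comp ?_).const_mul (G : ℝ)).const_sub 1
      refine tendsto_atTop_mono (fun k => ?_) tendsto_id
      exact (Nat.le_mul_of_pos_right k (by positivity)).trans (Nat.le_add_right _ _)
    rw [mul_zero, sub_zero] at this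
    refine this.congr fun k => ?_
    push_cast
    field_simp
    ring
  have t3 := (((((r1.pow 2).const_mul ((2 ^ n) ^ 2 * (HH - 2 * ε) ^ 2 * T * X)).sub
    ((r2.pow 2).const_mul ((2 ^ n) ^ 2 * T * ε⁻¹ * d)))).const_mul ((1 / 2 : ℝ) ^ (1 / H)))
  have hd2 : ℓ < (1 / 2 : ℝ) ^ (1 / H) * ((2 ^ n) ^ 2 * (HH - 2 * ε) ^ 2 * T * X *
      (1 / 2 ^ n) ^ 2 - (2 ^ n) ^ 2 * T * ε⁻¹ * d * 1 ^ 2) := by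
    refine hd1.trans_eq ?_
    field_simp
  obtain ⟨k, hk1, hk2, hk0⟩ := ((t3.eventually_const_lt hd2).and
    (hn.and (eventually_gt_atTop 0))).exists
  have hk0' : (0 : ℝ) < k := by exact_mod_cast hk0
  refine h.eventually_le_measure_incrementSup_div (n := n) (k := k) (G := G)
    (c := ((HH - 2 * ε) * k) ^ 2) (d := d) (K := ε⁻¹) (by positivity) ?_ (by positivity) hT
    hd0.le hG ?_
  · rw [ENNReal.ofReal_pow (mul_nonneg (by linarith) hk0'.le)]
    refine ENNReal.pow_lt_pow_left two_ne_zero ?_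
    rw [ENNReal.ofReal_lt_iff_lt_toReal (mul_nonneg (by linarith) hk0'.le)
      (h.gridConst_ne_top hHH hP n k)]
    refine lt_of_lt_of_le ?_ hk2
    gcongr
    linarith
  · refine hk1.trans_eq ?_
    push_cast
    rw [div_pow, div_pow, ← hX]
    have : (0 : ℝ) < k * 2 ^ n + 1 + G := by positivity
    field_simp

end IsRoughFBM

lemma abs_add_rpow_le {α : ℝ} (h0 : 0 < α) (h1 : α ≤ 1) (x y : ℝ) :
    |x + y| ^ α ≤ |x| ^ α + |y| ^ α :=
  (rpow_le_rpow (abs_nonneg _) (abs_add_le x y) h0.le).trans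
    (rpow_add_le_add_rpow (abs_nonneg _) (abs_nonneg _) h0.le h1)

lemma ofReal_exp_add_le (p r : ℝ) :
    ENNReal.ofReal (rexp (p + r)) ≤
      ENNReal.ofReal (rexp (2 * p)) + ENNReal.ofReal (rexp (2 * r)) := by
  rw [← ENNReal.ofReal_add (Real.exp_pos _).le (Real.exp_pos _).le]
  refine ENNReal.ofReal_le_ofReal ?_
  rw [Real.exp_add, two_mul, two_mul, Real.exp_add, Real.exp_add]
  nlinarith [sq_nonneg (rexp p - rexp r), Real.exp_pos p, Real.exp_pos r,
    mul_pos (Real.exp_pos p) (Real.exp_pos r)]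

namespace IsRoughFBM

variable {Ω : Type*} [MeasurableSpace Ω] {μ : Measure Ω} [IsProbabilityMeasure μ]
  {H : ℝ} {B : ℝ → Ω → ℝ}

lemma lintegral_iSup_exp_increment_le (h : IsRoughFBM μ H B) {x c q : ℝ} (hx : 0 ≤ x)
    (hq : 0 ≤ q) (hc : c * c * q ^ (2*H) = 2) (n : ℕ) :
    ∫⁻ ω, ⨆ j : Fin (1 * 2 ^ n + 1),
      ENNReal.ofReal (rexp (c * (B (x + q * (j / 2 ^ n)) ω - B x ω))) ∂μ ≤
    ENNReal.ofReal (rexp 1) * gridConst μ H B n 1 := by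
  have hH : (2 * H) ≠ 0 := h.two_H_pos.ne'
  have hg : Measurable fun z : Fin (1 * 2 ^ n + 1) → ℝ => ⨆ i, ENNReal.ofReal (rexp (z i)) :=
    Measurable.iSup fun i => by fun_prop
  have e1 := h.increments (fun _ : Fin (1 * 2 ^ n + 1) => c) (x := fun _ => x)
    (y := fun j => x + q * (j / 2 ^ n)) (fun _ => hx) (fun i => by positivity)
  have e2 := h.increments (fun _ : Fin (1 * 2 ^ n + 1) => √2) (x := fun _ => 0)
    (y := fun j => 0 + j / 2 ^ n) (fun _ => le_rfl) (fun i => by positivity)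
  refine (e1.lintegral_eq (e2.congr_cov fun i j => ?_) hg).trans_le ?_
  · have h3 (z : ℝ) : c * c * |q * z| ^ (2*H) = 2 * |z| ^ (2*H) := by
      rw [abs_mul, mul_rpow (abs_nonneg _) (abs_nonneg _), abs_of_nonneg hq, ← mul_assoc, hc]
    have h4 := h3 (i / 2 ^ n)
    have h5 := h3 (j / 2 ^ n)
    have h6 := h3 (i / 2 ^ n - j / 2 ^ n)
    have h7 : x - (x + q * ((j : ℕ) / 2 ^ n)) = -(q * ((j : ℕ) / 2 ^ n)) := by ring
    have h8 : x + q * ((i : ℕ) / 2 ^ n) - (x + q * ((j : ℕ) / 2 ^ n)) =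
        q * ((i : ℕ) / 2 ^ n - (j : ℕ) / 2 ^ n) := by ring
    simp only [incrementCov, h7, h8, abs_neg, add_sub_cancel_left, sub_self, abs_zero,
      zero_rpow hH, zero_add, sub_zero, zero_sub, Real.mul_self_sqrt (zero_le_two)]
    linarith
  · rw [gridConst, ← lintegral_const_mul' _ _ ENNReal.ofReal_ne_top]
    refine lintegral_mono fun ω => ?_
    simp only [gridSup, ENNReal.mul_iSup]
    refine iSup_mono fun j => ?_
    rw [pickandsExp, ← ENNReal.ofReal_mul (by positivity), ← Real.exp_add, h.zero, sub_zero]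
    refine ENNReal.ofReal_le_ofReal (Real.exp_le_exp.2 ?_)
    have h1 : (0 + ((j : ℕ) : ℝ) / 2 ^ n) ^ (2*H) ≤ 1 := by
      refine rpow_le_one (by positivity) ?_ h.two_H_pos.le
      rw [zero_add, div_le_one (by positivity)]
      exact_mod_cast (Nat.lt_succ_iff.1 j.2).trans (one_mul _).le
    linarith

lemma lintegral_iSup_exp_cell_le (h : IsRoughFBM μ H B) {x₀ y₀ θ q : ℝ} (hx : 0 ≤ x₀)
    (hxy : x₀ ≤ y₀) (hq : 0 ≤ q) (hθ : (2 * θ) * (2 * θ) * q ^ (2*H) = 2) (n : ℕ) :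
    ∫⁻ ω, ⨆ i : Fin (1 * 2 ^ n + 1) × Fin (1 * 2 ^ n + 1), ENNReal.ofReal (rexp (θ *
      (B (y₀ + q * (i.2 / 2 ^ n)) ω - B (x₀ + q * (i.1 / 2 ^ n)) ω))) ∂μ ≤
    ENNReal.ofReal (rexp (θ ^ 2 * |y₀ - x₀| ^ (2*H) / 2)) *
      (2 * (ENNReal.ofReal (rexp 1) * contConst μ H B 1)) := by
  have hy : 0 ≤ y₀ := hx.trans hxy
  have hH : (2 * H) ≠ 0 := h.two_H_pos.ne'
  have hH1 : 2 * H ≤ 1 := by linarith [h.lt_half]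
  set F := Fin (1 * 2 ^ n + 1) with hF
  set y : F ⊕ F → ℝ := Sum.elim (fun j => y₀ + q * ((j : ℕ) / 2 ^ n))
    (fun j => x₀ + q * ((j : ℕ) / 2 ^ n)) with hyd
  set x : F ⊕ F → ℝ := Sum.elim (fun _ => y₀) (fun _ => x₀) with hxd
  set Θ : F ⊕ F → ℝ := Sum.elim (fun _ => θ) (fun _ => -θ) with hΘ
  have hg : Measurable fun z : F ⊕ F → ℝ =>
      ⨆ i : F × F, ENNReal.ofReal (rexp (z (.inl i.2) + z (.inr i.1))) :=
    Measurable.iSup fun i => by fun_prop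
  have key := h.lintegral_exp_increment_mul (θ₀ := θ) hx hy Θ (x := x) (y := y)
    (by rintro (i | i) <;> simp [hxd, hx, hy])
    (by rintro (i | i) <;> simp only [hyd, Sum.elim_inl, Sum.elim_inr] <;> positivity) hg
  have hG : gridConst μ H B n 1 ≤ contConst μ H B 1 := by
    have := h.iSup_gridConst 1
    rw [Nat.cast_one] at this
    rw [← this]
    exact le_iSup (fun n => gridConst μ H B n 1) n
  calc _ = ∫⁻ ω, ENNReal.ofReal (rexp (θ * (B y₀ ω - B x₀ ω))) *
        ⨆ i : F × F, ENNReal.ofReal (rexp (Θ (.inl i.2) * (B (y (.inl i.2)) ω - B (x (.inl i.2)) ω)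
          + Θ (.inr i.1) * (B (y (.inr i.1)) ω - B (x (.inr i.1)) ω))) ∂μ := by
        refine lintegral_congr fun ω => ?_
        rw [ENNReal.mul_iSup]
        refine iSup_congr fun i => ?_
        rw [← ENNReal.ofReal_mul (by positivity), ← Real.exp_add]
        congr 2
        simp only [hyd, hxd, hΘ, Sum.elim_inl, Sum.elim_inr]
        ring
    _ = _ := key
    _ ≤ _ := by
        refine mul_le_mul_right ?_ _
        calc _ ≤ ∫⁻ ω, ((⨆ j : F, ENNReal.ofReal (rexp ((2 * θ) *
                (B (y₀ + q * (j / 2 ^ n)) ω - B y₀ ω)))) +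
              ⨆ j : F, ENNReal.ofReal (rexp ((-(2 * θ)) *
                (B (x₀ + q * (j / 2 ^ n)) ω - B x₀ ω)))) ∂μ := by
              refine lintegral_mono fun ω => iSup_le fun i => ?_
              have d1 := abs_add_rpow_le h.two_H_pos hH1 (q * (i.2 / 2 ^ n)) (y₀ - x₀)
              have d2 := abs_add_rpow_le h.two_H_pos hH1 (q * (i.1 / 2 ^ n)) (x₀ - y₀)
              have hθ2 : 0 ≤ θ * θ := mul_self_nonneg _
              refine le_trans ?_ (add_le_add
                (le_iSup (fun j : F => ENNReal.ofReal (rexp ((2 * θ) *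
                  (B (y₀ + q * (j / 2 ^ n)) ω - B y₀ ω)))) i.2)
                (le_iSup (fun j : F => ENNReal.ofReal (rexp ((-(2 * θ)) *
                  (B (x₀ + q * (j / 2 ^ n)) ω - B x₀ ω)))) i.1))
              rw [mul_assoc 2 θ, ← mul_neg, mul_assoc 2 (-θ)]
              refine le_trans (ENNReal.ofReal_le_ofReal (Real.exp_le_exp.2 ?_))
                (ofReal_exp_add_le _ _)
              simp only [hyd, hxd, hΘ, Sum.elim_inl, Sum.elim_inr, sub_self, abs_zero,
                zero_rpow hH, add_sub_cancel_left]
              rw [show y₀ + q * (((i.2 : F) : ℕ) / 2 ^ n : ℝ) - x₀ =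
                q * (((i.2 : F) : ℕ) / 2 ^ n : ℝ) + (y₀ - x₀) by ring,
                show x₀ + q * (((i.1 : F) : ℕ) / 2 ^ n : ℝ) - y₀ =
                q * (((i.1 : F) : ℕ) / 2 ^ n : ℝ) + (x₀ - y₀) by ring]
              nlinarith [mul_le_mul_of_nonneg_left d1 hθ2, mul_le_mul_of_nonneg_left d2 hθ2]
          _ ≤ ENNReal.ofReal (rexp 1) * gridConst μ H B n 1 +
              ENNReal.ofReal (rexp 1) * gridConst μ H B n 1 := by
              rw [lintegral_add_left]
              · exact add_le_add (h.lintegral_iSup_exp_increment_le hy hq hθ n)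
                  (h.lintegral_iSup_exp_increment_le hx hq (by rw [neg_mul_neg]; exact hθ) n)
              · refine Measurable.iSup fun j => ?_
                have := h.meas
                fun_prop
          _ ≤ _ := by
              rw [two_mul]
              gcongr

end IsRoughFBM

lemma sum_exp_neg_mul_le {b : ℝ} (hb0 : 0 < b) (hb1 : b ≤ 1) (n : ℕ) :
    ∑ r ∈ Finset.range n, rexp (-(b * r)) ≤ 2 / b := by
  have h1 : rexp (-b) ≤ 1 - b / 2 := by
    rw [Real.exp_neg]
    refine (inv_anti₀ (by positivity) (Real.add_one_le_exp b)).trans ?_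
    rw [inv_le_iff_one_le_mul₀ (by positivity)]
    nlinarith
  have h2 : ∀ r : ℕ, rexp (-(b * r)) = rexp (-b) ^ r := fun r => by
    rw [← Real.exp_nat_mul]
    ring_nf
  simp_rw [h2]
  have h3 := mul_neg_geom_sum (rexp (-b)) n
  rw [le_div_iff₀ hb0]
  have h4 : 0 ≤ ∑ r ∈ Finset.range n, rexp (-b) ^ r := by positivity
  have h5 : 0 ≤ rexp (-b) ^ n := by positivity
  nlinarith

lemma sum_exp_rpow_le {H θ : ℝ} {N : ℕ} (hN : 1 ≤ N) (h0 : 0 < H) (h1 : H ≤ 1 / 2)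
    (hθ : θ ^ 2 = (N : ℝ) ^ (2*H) / 2) :
    ∑ j ∈ Finset.range (N + 1), rexp (θ ^ 2 * ((j : ℝ) / N) ^ (2*H) / 2) ≤
      4 / H * (N : ℝ) ^ (1 - 2*H) * rexp (θ ^ 2 / 2) := by
  have hN0 : (0 : ℝ) < N := by exact_mod_cast hN
  have hN1 : (1 : ℝ) ≤ N := by exact_mod_cast hN
  set b := H / 2 * (N : ℝ) ^ (2*H - 1) with hb
  have hb0 : 0 < b := by positivity
  have hb1 : b ≤ 1 := by
    have : (N : ℝ) ^ (2*H - 1) ≤ 1 := rpow_le_one_of_one_le_of_nonpos hN1 (by linarith)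
    rw [hb]
    nlinarith
  have hbN : θ ^ 2 * (2 * H) / (2 * N) = b := by
    rw [hb, hθ, rpow_sub hN0, rpow_one]
    field_simp
  rw [← Finset.sum_range_reflect]
  calc _ ≤ ∑ r ∈ Finset.range (N + 1), rexp (θ ^ 2 / 2) * rexp (-(b * r)) := by
        refine Finset.sum_le_sum fun r hr => ?_
        have hr' : r ≤ N := Nat.lt_succ_iff.1 (Finset.mem_range.1 hr)
        have hr1 : (r : ℝ) / N ≤ 1 := by
          rw [div_le_one hN0]
          exact_mod_cast hr'
        rw [← Real.exp_add, Nat.add_sub_cancel, Nat.cast_sub hr', sub_div, div_self hN0.ne',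
          Real.exp_le_exp]
        have h3 := rpow_one_add_le_one_add_mul_self (s := -((r : ℝ) / N)) (by linarith)
          (p := 2*H) (by linarith) (by linarith)
        have h4 := mul_le_mul_of_nonneg_left h3 (sq_nonneg θ)
        rw [← hbN]
        have h5 : θ ^ 2 * (2 * H) / (2 * N) * r = θ ^ 2 * (2 * H * (r / N)) / 2 := by
          field_simp
        rw [h5, sub_eq_add_neg]
        linarith
    _ ≤ _ := by
        rw [← Finset.mul_sum]
        have h2 := sum_exp_neg_mul_le hb0 hb1 (N + 1)
        have h3 : 2 / b = 4 / H * (N : ℝ) ^ (1 - 2*H) := by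
          rw [hb, ← neg_sub (2*H) 1, rpow_neg hN0.le]
          field_simp
          norm_num
        rw [← h3, mul_comm]
        gcongr

namespace IsRoughFBM

variable {Ω : Type*} [MeasurableSpace Ω] {μ : Measure Ω} [IsProbabilityMeasure μ]
  {H : ℝ} {B : ℝ → Ω → ℝ}

/-- Maximum of the exponentiated increments of `B` between the dyadic points of level `n` of
`[x₀, x₀ + q]` and those of `[y₀, y₀ + q]`. -/
noncomputable def cellSup (B : ℝ → Ω → ℝ) (θ q x₀ y₀ : ℝ) (n : ℕ) (ω : Ω) : ENNReal :=
  ⨆ i : Fin (1 * 2 ^ n + 1) × Fin (1 * 2 ^ n + 1), ENNReal.ofReal (rexp (θ *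
      (B (y₀ + q * (i.2 / 2 ^ n)) ω - B (x₀ + q * (i.1 / 2 ^ n)) ω)))

/-- Sum of `cellSup` over the pairs of cells of side `1 / N` which contain the endpoints of an
interval of length at most one starting before time `T`. -/
noncomputable def cellSum (B : ℝ → Ω → ℝ) (θ T : ℝ) (N n : ℕ) (ω : Ω) : ENNReal :=
  ∑ i ∈ Finset.range (⌊T * N⌋₊ + 1), ∑ j ∈ Finset.range (N + 1),
    cellSup B θ (1 / N) (i / N) ((i + j : ℕ) / N) n ω

omit [IsProbabilityMeasure μ] in
lemma measurable_cellSup (h : IsRoughFBM μ H B) (θ q x₀ y₀ : ℝ) (n : ℕ) :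
    Measurable (cellSup B θ q x₀ y₀ n) :=
  Measurable.iSup fun j => by
    have := h.meas
    fun_prop

omit [IsProbabilityMeasure μ] in
lemma measurable_cellSum (h : IsRoughFBM μ H B) (θ T : ℝ) (N n : ℕ) :
    Measurable (cellSum B θ T N n) :=
  Finset.measurable_fun_sum _ fun _ _ => Finset.measurable_fun_sum _ fun _ _ =>
    h.measurable_cellSup _ _ _ _ _

lemma lintegral_cellSum_le (h : IsRoughFBM μ H B) {θ T : ℝ} {N : ℕ} (hN : 1 ≤ N)
    (hT : 0 ≤ T) (hθ : θ ^ 2 = (N : ℝ) ^ (2*H) / 2) (n : ℕ) :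
    ∫⁻ ω, cellSum B θ T N n ω ∂μ ≤
      ENNReal.ofReal (4 * (T + 1) / H * (N : ℝ) ^ (2 - 2*H) * rexp (θ ^ 2 / 2)) *
        (2 * (ENNReal.ofReal (rexp 1) * contConst μ H B 1)) := by
  have hN0 : (0 : ℝ) < N := by exact_mod_cast hN
  have hN1 : (1 : ℝ) ≤ N := by exact_mod_cast hN
  have hq : (2 * θ) * (2 * θ) * (1 / (N : ℝ)) ^ (2*H) = 2 := by
    have e : (2 * θ) * (2 * θ) = 2 * (N : ℝ) ^ (2*H) := by
      linear_combination 4 * hθ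
    rw [e, one_div, inv_rpow hN0.le, mul_assoc, mul_inv_cancel₀ (by positivity), mul_one]
  have hs := sum_exp_rpow_le hN h.pos h.lt_half.le hθ
  set C := 2 * (ENNReal.ofReal (rexp 1) * contConst μ H B 1)
  unfold cellSum
  rw [lintegral_finsetSum _ fun i _ => Finset.measurable_fun_sum _ fun j _ =>
    h.measurable_cellSup _ _ _ _ _]
  calc _ ≤ ∑ i ∈ Finset.range (⌊T * N⌋₊ + 1), ENNReal.ofReal
          (4 / H * (N : ℝ) ^ (1 - 2*H) * rexp (θ ^ 2 / 2)) * C := by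
        refine Finset.sum_le_sum fun i _ => ?_
        rw [lintegral_finsetSum _ fun j _ => h.measurable_cellSup _ _ _ _ _]
        calc _ ≤ ∑ j ∈ Finset.range (N + 1),
              ENNReal.ofReal (rexp (θ ^ 2 * ((j : ℝ) / N) ^ (2*H) / 2)) * C := by
              refine Finset.sum_le_sum fun j _ => ?_
              have e : (((i + j : ℕ) : ℝ) / N - i / N) = j / N := by
                push_cast
                ring
              have := h.lintegral_iSup_exp_cell_le (x₀ := i / N) (y₀ := (i + j : ℕ) / N)
                (by positivity) (by gcongr; simp) (by positivity) hq n
              rwa [e, abs_of_nonneg (by positivity : (0 : ℝ) ≤ (j : ℝ) / N)] at this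
          _ ≤ _ := by
              rw [← Finset.sum_mul, ← ENNReal.ofReal_sum_of_nonneg fun j _ => by positivity]
              gcongr
    _ ≤ _ := by
        rw [Finset.sum_const, Finset.card_range, nsmul_eq_mul, ← mul_assoc,
          ← ENNReal.ofReal_natCast, ← ENNReal.ofReal_mul (by positivity)]
        refine mul_le_mul_left (ENNReal.ofReal_le_ofReal ?_) _
        have hf : (⌊T * N⌋₊ : ℝ) ≤ T * N := Nat.floor_le (by positivity)
        have e : (N : ℝ) ^ (2 - 2*H) = N * (N : ℝ) ^ (1 - 2*H) := by
          rw [← rpow_one_add' hN0.le (by linarith [h.lt_half])]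
          ring_nf
        have h0 := h.pos
        calc _ ≤ ((T + 1) * N) * (4 / H * (N : ℝ) ^ (1 - 2*H) * rexp (θ ^ 2 / 2)) := by
              gcongr
              push_cast
              nlinarith
          _ = _ := by
              rw [e]
              ring

omit [MeasurableSpace Ω] in
lemma ofReal_exp_le_liminf_cellSum {θ T m : ℝ} {N : ℕ} (hN : 1 ≤ N) (hT : 0 ≤ T) (hθ : 0 < θ)
    {ω : Ω} (hω : Continuous fun t => B t ω) (hm : m < incrementSup B T ω) :
    ENNReal.ofReal (rexp (θ * m)) ≤ liminf (fun n => cellSum B θ T N n ω) atTop := by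
  have hN0 : (0 : ℝ) < N := by exact_mod_cast hN
  have : Nonempty (Icc (0:ℝ) T) := ⟨⟨0, le_rfl, hT⟩⟩
  obtain ⟨τ, hτ⟩ := exists_lt_of_lt_ciSup hm
  obtain ⟨s, hs⟩ := exists_lt_of_lt_ciSup hτ
  obtain ⟨⟨τ, hτ0, hτ1⟩, s, hs0, hsT⟩ := τ, s
  simp only at hs
  have hcell (t : ℝ) (ht : 0 ≤ t) (n : ℕ) : ∃ k : Fin (1 * 2 ^ n + 1),
      (⌊(t * N - ⌊t * N⌋₊) * 2 ^ n⌋₊ : ℝ) = k := by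
    have h1 : t * N - ⌊t * N⌋₊ ≤ 1 := by linarith [Nat.lt_floor_add_one (t * N)]
    refine ⟨⟨⌊(t * N - ⌊t * N⌋₊) * 2 ^ n⌋₊, ?_⟩, rfl⟩
    rw [Nat.lt_succ_iff]
    refine Nat.floor_le_of_le ?_
    push_cast
    gcongr
  have happ (t : ℝ) (ht : 0 ≤ t) : Tendsto (fun n : ℕ => (⌊t * N⌋₊ : ℝ) / N +
      1 / N * ((⌊(t * N - ⌊t * N⌋₊) * 2 ^ n⌋₊ : ℝ) / 2 ^ n)) atTop (nhds t) := by
    have h1 : 0 ≤ t * N - ⌊t * N⌋₊ := sub_nonneg.2 (Nat.floor_le (by positivity))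
    have h2 : Tendsto (fun n : ℕ => (⌊(t * N - ⌊t * N⌋₊) * 2 ^ n⌋₊ : ℝ) / 2 ^ n) atTop
        (nhds (t * N - ⌊t * N⌋₊)) :=
      (tendsto_nat_floor_mul_div_atTop h1).comp
        (tendsto_pow_atTop_atTop_of_one_lt (by norm_num : (1 : ℝ) < 2))
    have h3 := (h2.const_mul (1 / (N : ℝ))).const_add ((⌊t * N⌋₊ : ℝ) / N)
    have e : (⌊t * N⌋₊ : ℝ) / N + 1 / N * (t * N - ⌊t * N⌋₊) = t := by
      field_simp
      ring
    rwa [e] at h3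
  have hlim := ((hω.tendsto _).comp (happ (s + τ) (by positivity))).sub
    ((hω.tendsto _).comp (happ s hs0))
  refine le_liminf_of_le (by isBoundedDefault) ?_
  filter_upwards [hlim.eventually (lt_mem_nhds hs)] with n hn
  obtain ⟨k1, hk1⟩ := hcell s hs0 n
  obtain ⟨k2, hk2⟩ := hcell (s + τ) (by positivity) n
  have hi : ⌊s * N⌋₊ < ⌊T * N⌋₊ + 1 := Nat.lt_succ_iff.2 (Nat.floor_mono (by gcongr))
  have hle : ⌊s * N⌋₊ ≤ ⌊(s + τ) * N⌋₊ := Nat.floor_mono (by gcongr; linarith)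
  have hj : ⌊(s + τ) * N⌋₊ - ⌊s * N⌋₊ < N + 1 := by
    have : ⌊(s + τ) * N⌋₊ ≤ ⌊s * N⌋₊ + N := by
      rw [← Nat.floor_add_natCast (by positivity)]
      refine Nat.floor_mono ?_
      nlinarith
    omega
  unfold cellSum
  refine le_trans ?_ (Finset.single_le_sum (fun i _ => zero_le) (Finset.mem_range.2 hi))
  refine le_trans ?_ (Finset.single_le_sum (fun i _ => zero_le) (Finset.mem_range.2 hj))
  rw [Nat.add_sub_cancel' hle, cellSup]
  refine le_trans ?_ (le_iSup _ (k1, k2))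
  refine ENNReal.ofReal_le_ofReal (Real.exp_le_exp.2 (mul_le_mul_of_nonneg_left ?_ hθ.le))
  rw [← hk1, ← hk2]
  exact hn.le

end IsRoughFBM

lemma sum_exp_add_natCast_le (v : ℝ) (J : ℕ) :
    ∑ j ∈ Finset.range J, rexp (v + j) ≤ rexp (v + J) := by
  induction J with
  | zero => simp [Real.exp_nonneg]
  | succ J ih =>
    rw [Finset.sum_range_succ, Nat.cast_succ, ← add_assoc, Real.exp_add (v + J) 1]
    nlinarith [Real.add_one_le_exp (1 : ℝ), Real.exp_pos (v + J)]

lemma sum_ite_ofReal_exp_le (v : ℝ) (W : ENNReal) (J : ℕ) :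
    ∑ j ∈ Finset.range J, (if ENNReal.ofReal (rexp (v + j)) ≤ W then
      ENNReal.ofReal (rexp (v + j)) else 0) ≤ 2 * W := by
  induction J with
  | zero => simp
  | succ J ih =>
    rw [Finset.sum_range_succ]
    split_ifs with hJ
    · rw [two_mul]
      refine add_le_add (le_trans (Finset.sum_le_sum fun j _ =>
        ite_le_sup _ _ _ |>.trans (sup_of_le_left zero_le).le) (le_trans ?_ hJ)) hJ
      rw [← ENNReal.ofReal_sum_of_nonneg fun _ _ => (Real.exp_pos _).le]
      exact ENNReal.ofReal_le_ofReal (sum_exp_add_natCast_le v J)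
    · rwa [add_zero]

lemma sum_exp_mul_measure_le {Ω : Type*} [MeasurableSpace Ω] {μ : Measure Ω} {W : Ω → ENNReal}
    (hW : Measurable W) (v : ℝ) (J : ℕ) :
    ∑ j ∈ Finset.range J, ENNReal.ofReal (rexp (v + j)) *
      μ {ω | ENNReal.ofReal (rexp (v + j)) ≤ W ω} ≤ 2 * ∫⁻ ω, W ω ∂μ := by
  have hs (j : ℕ) : MeasurableSet {ω | ENNReal.ofReal (rexp (v + j)) ≤ W ω} :=
    measurableSet_le measurable_const hW
  rw [← lintegral_const_mul _ hW]
  refine le_trans (le_of_eq ?_) (lintegral_mono fun ω => sum_ite_ofReal_exp_le v (W ω) J)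
  rw [lintegral_finsetSum _ fun j _ => Measurable.ite (hs j) measurable_const measurable_const]
  refine Finset.sum_congr rfl fun j _ => ?_
  rw [← lintegral_indicator_const (hs j)]
  refine lintegral_congr fun ω => ?_
  rw [indicator_apply]
  rfl

lemma rpow_mul_stdNormalTail_ge {H θ : ℝ} (h0 : 0 < H) (h1 : H < 1 / 2) (hθ : 1 ≤ θ) {j : ℝ}
    (hj0 : 0 ≤ j) (hj : j ≤ θ) :
    rexp (-5 / 2) / √(2 * π) * θ ^ (2 / H - 3) * rexp (-(θ ^ 2 / 2 + j)) ≤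
      (θ + j / θ) ^ (2 / H - 2) * stdNormalTail (θ + j / θ) := by
  have hθ0 : 0 < θ := by linarith
  set u := θ + j / θ with hu
  have hju : 0 ≤ j / θ := by positivity
  have hju1 : j / θ ≤ 1 := (div_le_one hθ0).2 hj
  have hu0 : 0 < u := by linarith
  have hH : 0 ≤ 2 / H - 3 := by
    rw [sub_nonneg, le_div_iff₀ h0]
    linarith
  have hu2 : u ^ 2 ≤ θ ^ 2 + 2 * j + 1 := by
    have : u ^ 2 = θ ^ 2 + 2 * j + (j / θ) ^ 2 := by
      rw [hu]
      field_simp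
      ring
    nlinarith
  have h2 := le_stdNormalTail (u := u) (by linarith)
  calc _ ≤ rexp (-5 / 2) / √(2 * π) * u ^ (2 / H - 3) * rexp (-(θ ^ 2 / 2 + j)) := by
        gcongr
        linarith
    _ = u ^ (2 / H - 2) * (u⁻¹ * (√(2 * π))⁻¹ * (rexp (-5 / 2) * rexp (-(θ ^ 2 / 2 + j)))) := by
        rw [show 2 / H - 2 = 2 / H - 3 + 1 by ring, rpow_add_one hu0.ne']
        field_simp
    _ ≤ u ^ (2 / H - 2) * (rexp (-2) * millsTerm u) := by
        refine mul_le_mul_of_nonneg_left ?_ (by positivity)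
        rw [millsTerm, mul_inv, mul_left_comm (rexp (-2)), ← Real.exp_add, ← Real.exp_add]
        exact mul_le_mul_of_nonneg_left (Real.exp_le_exp.2 (by linarith)) (by positivity)
    _ ≤ _ := by gcongr

namespace IsRoughFBM

variable {Ω : Type*} [MeasurableSpace Ω] {μ : Measure Ω} [IsProbabilityMeasure μ]
  {H : ℝ} {B : ℝ → Ω → ℝ}

lemma sum_exp_mul_measure_incrementSup_le (h : IsRoughFBM μ H B) {θ T : ℝ} {N : ℕ} (hN : 1 ≤ N)
    (hT : 0 ≤ T) (hθ0 : 0 < θ) (hθ : θ ^ 2 = (N : ℝ) ^ (2*H) / 2) (J : ℕ) :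
    ∑ j ∈ Finset.range J, ENNReal.ofReal (rexp (θ ^ 2 + j)) *
      μ {ω | θ + j / θ < incrementSup B T ω} ≤
      2 * (ENNReal.ofReal (4 * (T + 1) / H * (N : ℝ) ^ (2 - 2*H) * rexp (θ ^ 2 / 2)) *
        (2 * (ENNReal.ofReal (rexp 1) * contConst μ H B 1))) := by
  have hW : Measurable fun ω => liminf (fun n => cellSum B θ T N n ω) atTop :=
    Measurable.liminf fun n => h.measurable_cellSum θ T N n
  calc _ ≤ ∑ j ∈ Finset.range J, ENNReal.ofReal (rexp (θ ^ 2 + j)) *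
        μ {ω | ENNReal.ofReal (rexp (θ ^ 2 + j)) ≤
          liminf (fun n => cellSum B θ T N n ω) atTop} := by
        refine Finset.sum_le_sum fun j _ => mul_le_mul_right (measure_mono_ae ?_) _
        filter_upwards [h.cont] with ω hω hm
        have := ofReal_exp_le_liminf_cellSum hN hT hθ0 hω hm
        rwa [show θ * (θ + j / θ) = θ ^ 2 + j by field_simp] at this
    _ ≤ 2 * ∫⁻ ω, liminf (fun n => cellSum B θ T N n ω) atTop ∂μ :=
        sum_exp_mul_measure_le hW _ _
    _ ≤ _ := by
        refine mul_le_mul_right ((lintegral_liminf_le fun n =>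
          h.measurable_cellSum θ T N n).trans ?_) _
        refine liminf_le_of_le (by isBoundedDefault) fun b hb => ?_
        obtain ⟨n, hn⟩ := hb.exists
        exact hn.trans (h.lintegral_cellSum_le hN hT hθ n)

/-- The normalised tail of `incrementSup` does not tend to infinity. -/
lemma isCoboundedUnder_measure_incrementSup_div (h : IsRoughFBM μ H B) {HH T : ℝ}
    (hHH : 0 < HH) (hP : HasPickandsConstant μ H B HH) (hT : 0 ≤ T) :
    IsCoboundedUnder (· ≥ ·) atTop fun u : ℝ =>
      (μ {ω | u < incrementSup B T ω}).toReal / (u ^ (2 / H - 2) * stdNormalTail u) := by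
  have h0 := h.pos
  set K := (2 * (ENNReal.ofReal (rexp 1) * contConst μ H B 1)).toReal with hK
  have hKtop : 2 * (ENNReal.ofReal (rexp 1) * contConst μ H B 1) ≠ ⊤ :=
    ENNReal.mul_ne_top (by simp) (ENNReal.mul_ne_top (by simp) (h.contConst_ne_top hHH hP 1))
  set c := rexp (-5 / 2) / √(2 * π) with hc
  have hc0 : 0 < c := by positivity
  have hK0 : 0 ≤ K := ENNReal.toReal_nonneg
  refine ⟨2 * (4 * (T + 1) / H) * √2 ^ (2 / H - 2) * K / c, fun A hA => ?_⟩
  replace hA : ∀ᶠ u in atTop, A ≤ (μ {ω | u < incrementSup B T ω}).toReal /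
    (u ^ (2 / H - 2) * stdNormalTail u) := eventually_map.1 hA
  rcases le_or_gt A 0 with hA0 | hA0
  · exact hA0.trans (by positivity)
  obtain ⟨U, hU⟩ := eventually_atTop.1 hA
  have hlim : Tendsto (fun N : ℕ => (N : ℝ) ^ H / √2) atTop atTop :=
    ((tendsto_rpow_atTop h0).comp tendsto_natCast_atTop_atTop).atTop_div_const (by positivity)
  obtain ⟨N, hN, hNU⟩ := ((eventually_ge_atTop 1).and
    (hlim.eventually (eventually_ge_atTop (max U 1)))).exists
  set θ := (N : ℝ) ^ H / √2 with hθd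
  have hN0 : (0 : ℝ) < N := by exact_mod_cast hN
  have hθ1 : 1 ≤ θ := (le_max_right _ _).trans hNU
  have hθU : U ≤ θ := (le_max_left _ _).trans hNU
  have hθ0 : 0 < θ := by linarith
  have hθ2 : θ ^ 2 = (N : ℝ) ^ (2*H) / 2 := by
    rw [hθd, div_pow, Real.sq_sqrt zero_le_two, ← rpow_natCast, ← rpow_mul hN0.le]
    congr 2
    push_cast
    ring
  have hNθ : (N : ℝ) ^ (2 - 2*H) = √2 ^ (2 / H - 2) * θ ^ (2 / H - 2) := by
    rw [← mul_rpow (by positivity) hθ0.le, hθd, mul_div_cancel₀ _ (by positivity),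
      ← rpow_mul hN0.le]
    congr 1
    field_simp
  have hsum := h.sum_exp_mul_measure_incrementSup_le hN hT hθ0 hθ2 (⌊θ⌋₊ + 1)
  rw [← ENNReal.ofReal_toReal hKtop, ← hK, ← ENNReal.ofReal_mul (by positivity),
    ← ENNReal.ofReal_ofNat 2, ← ENNReal.ofReal_mul zero_le_two] at hsum
  have hterm (j : ℕ) (hj : j ∈ Finset.range (⌊θ⌋₊ + 1)) :
      ENNReal.ofReal (A * (c * θ ^ (2 / H - 3) * rexp (θ ^ 2 / 2))) ≤
      ENNReal.ofReal (rexp (θ ^ 2 + j)) * μ {ω | θ + j / θ < incrementSup B T ω} := by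
    have hjθ : (j : ℝ) ≤ θ := (Nat.le_floor_iff hθ0.le).1
      (Nat.lt_succ_iff.1 (Finset.mem_range.1 hj))
    have h3 := rpow_mul_stdNormalTail_ge h0 h.lt_half hθ1 (Nat.cast_nonneg j) hjθ
    have h4 : 0 < (θ + j / θ) ^ (2 / H - 2) * stdNormalTail (θ + j / θ) :=
      lt_of_lt_of_le (by positivity) h3
    have h5 := hU (θ + j / θ) (hθU.trans (le_add_of_nonneg_right (by positivity)))
    rw [le_div_iff₀ h4] at h5
    rw [← ENNReal.ofReal_toReal (measure_ne_top μ {ω | θ + j / θ < incrementSup B T ω}),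
      ← ENNReal.ofReal_mul (by positivity)]
    refine ENNReal.ofReal_le_ofReal ?_
    calc _ = rexp (θ ^ 2 + j) * (A * (c * θ ^ (2 / H - 3) * rexp (-(θ ^ 2 / 2 + j)))) := by
          rw [show θ ^ 2 / 2 = (θ ^ 2 + j) + -(θ ^ 2 / 2 + j) by ring, Real.exp_add]
          ring_nf
      _ ≤ _ := by
          refine mul_le_mul_of_nonneg_left (le_trans ?_ h5) (Real.exp_pos _).le
          exact mul_le_mul_of_nonneg_left h3 hA0.le
  have htot := (Finset.sum_le_sum hterm).trans hsum
  rw [Finset.sum_const, Finset.card_range, nsmul_eq_mul, ← ENNReal.ofReal_natCast,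
    ← ENNReal.ofReal_mul (by positivity), ENNReal.ofReal_le_ofReal_iff (by positivity)] at htot
  have hfl : θ ≤ (⌊θ⌋₊ + 1 : ℕ) := by
    push_cast
    exact (Nat.lt_floor_add_one θ).le
  have htot' := (mul_le_mul_of_nonneg_right hfl (by positivity)).trans htot
  have e : θ ^ (2 / H - 2) = θ ^ (2 / H - 3) * θ := by
    rw [← rpow_add_one hθ0.ne']
    ring_nf
  refine (le_div_iff₀ hc0).2 (le_of_mul_le_mul_right ?_
    (show 0 < θ ^ (2 / H - 2) * rexp (θ ^ 2 / 2) by positivity))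
  calc A * c * (θ ^ (2 / H - 2) * rexp (θ ^ 2 / 2)) =
        θ * (A * (c * θ ^ (2 / H - 3) * rexp (θ ^ 2 / 2))) := by
        rw [e]
        ring
    _ ≤ _ := htot'
    _ = _ := by
        rw [hNθ]
        ring

end IsRoughFBM

/-- Lower asymptotic bound for the Shepp statistics of fBm, `H ∈ (0,1/2)`:
`liminf_{u→∞} P(M_H(T) > u)/(u^{2/H-2} Ψ(u)) ≥ (T/H) (1/2)^{1/H} 𝓗_{2H}²`. -/
theorem shepp_fbm_tail_liminf
    {Ω : Type*} [MeasurableSpace Ω] (μ : Measure Ω) [IsProbabilityMeasure μ]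
    (H : ℝ) (hH : H ∈ Set.Ioo (0:ℝ) (1/2))
    (B : ℝ → Ω → ℝ)
    (hmeas : ∀ t : ℝ, Measurable (B t))
    (hzero : ∀ ω, B 0 ω = 0)
    (hcont : ∀ᵐ ω ∂μ, Continuous fun t => B t ω)
    (hgauss : ∀ (n : ℕ) (c : Fin n → ℝ) (t : Fin n → ℝ),
      ∃ v : NNReal, μ.map (fun ω => ∑ i, c i * B (t i) ω) =
        ProbabilityTheory.gaussianReal 0 v)
    (hcov : ∀ t s : ℝ, 0 ≤ t → 0 ≤ s →
      ∫ ω, B t ω * B s ω ∂μ = (t ^ (2*H) + s ^ (2*H) - |t - s| ^ (2*H)) / 2)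
    (HH : ℝ) (hHH : 0 < HH)
    (hPick : Tendsto (fun lam : ℝ => lam⁻¹ *
        ∫ ω, Real.exp (⨆ t : Set.Icc (0:ℝ) lam,
          (Real.sqrt 2 * B (t:ℝ) ω - (t:ℝ) ^ (2*H))) ∂μ) atTop (nhds HH))
    (T : ℝ) (hT : 0 < T) :
    (T / H) * ((1/2 : ℝ) ^ (1/H)) * HH ^ 2 ≤
      Filter.liminf (fun u : ℝ =>
        (μ {ω | u < ⨆ (τ : Set.Icc (0:ℝ) (1)) (s : Set.Icc (0:ℝ) (T)),
            (B ((s:ℝ) + (τ:ℝ)) ω - B (s:ℝ) ω)}).toReal /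
          (u ^ (2/H - 2) * stdNormalTail u)) atTop := by
  have h : IsRoughFBM μ H B := ⟨hH.1, hH.2, hmeas, hzero, hcont, hgauss, hcov⟩
  refine le_of_forall_lt fun ℓ hℓ => ?_
  obtain ⟨ℓ', hℓ', hlt⟩ := exists_between hℓ
  exact hℓ'.trans_le (le_liminf_of_le
    (h.isCoboundedUnder_measure_incrementSup_div hHH hPick hT.le)
    (h.eventually_lt_measure_incrementSup_div hHH hPick hT hlt))
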